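/- Let p ≥ 2 and let μ be a Borel probability measure on [0,1] (viewed on the circle) invariant and ergodic under T_p with dim μ > 0. Let m > n > 1 be integers with m ≁ p and n ≁ p, and let f, g be non-singular affine maps of ℝ with f([0,1]) ⊆ [0,1] and g([0,1]) ⊆ [0,1]. Then for μ-almost every x, the sequence (1/N)∑_{i=0}^{N-1} δ_{(T_m^i f(x), T_n^i g(x))} converges weak-* to λ × λ. -/

import Mathlib

open MeasureTheory Filter Set Topology
open scoped ENNReal

/-- The (lower) Hausdorff dimension of a measure:
`dim μ = inf { dim_H A : A Borel, μ(A) > 0 }`. -/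
noncomputable def measureDim {X : Type*} [EMetricSpace X] [MeasurableSpace X]
    (μ : Measure X) : ℝ≥0∞ :=
  ⨅ (A : Set X) (_ : MeasurableSet A) (_ : 0 < μ A), dimH A

/-- `T_n x = n x mod 1` as a self-map of `[0,1) ⊆ ℝ`. -/
noncomputable def Tmap (n : ℕ) (x : ℝ) : ℝ := Int.fract (n * x)


section Maximal
variable {Ω : Type*} [MeasurableSpace Ω]

/-- Auxiliary maximal function. -/
noncomputable def gmax (T : Ω → Ω) (g : Ω → ℝ) : ℕ → Ω → ℝ
  | 0 => fun _ => 0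
  | n + 1 => fun x => max 0 (g x + gmax T g n (T x))

lemma gmax_nonneg (T : Ω → Ω) (g : Ω → ℝ) (n : ℕ) (x : Ω) : 0 ≤ gmax T g n x := by
  cases n with
  | zero => simp [gmax]
  | succ n => simp [gmax]

lemma gmax_mono_succ (T : Ω → Ω) (g : Ω → ℝ) (n : ℕ) : ∀ x, gmax T g n x ≤ gmax T g (n+1) x := by
  induction n with
  | zero => intro x; simpa [gmax] using gmax_nonneg T g 1 x
  | succ n ih =>
    intro x
    have := ih (T x)
    simp only [gmax] at this ⊢
    exact max_le_max le_rfl (by linarith)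

lemma gmax_mono (T : Ω → Ω) (g : Ω → ℝ) (x : Ω) : Monotone (fun n => gmax T g n x) :=
  monotone_nat_of_le_succ fun n => gmax_mono_succ T g n x

lemma sum_le_gmax (T : Ω → Ω) (g : Ω → ℝ) (n : ℕ) :
    ∀ x, ∑ i ∈ Finset.range n, g (T^[i] x) ≤ gmax T g n x := by
  induction n with
  | zero => intro x; simp [gmax]
  | succ n ih =>
    intro x
    rw [Finset.sum_range_succ']
    have := ih (T x)
    simp only [Function.iterate_succ, Function.comp, Function.iterate_zero, id] at this ⊢
    simp only [gmax]
    refine le_trans ?_ (le_max_right _ _)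
    linarith

lemma gmax_measurable {T : Ω → Ω} (hT : Measurable T) {g : Ω → ℝ} (hg : Measurable g) (n : ℕ) :
    Measurable (gmax T g n) := by
  induction n with
  | zero => exact measurable_const
  | succ n ih => exact measurable_const.max (hg.add (ih.comp hT))

lemma gmax_bdd {T : Ω → Ω} {g : Ω → ℝ} {B : ℝ} (hB : 0 ≤ B) (hg : ∀ x, |g x| ≤ B) (n : ℕ) :
    ∀ x, |gmax T g n x| ≤ n * B := by
  induction n with
  | zero => intro x; simp [gmax]
  | succ n ih =>
    intro x
    rw [abs_of_nonneg (gmax_nonneg _ _ _ _)]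
    simp only [gmax]
    have h1 := (abs_le.1 (hg x)).2
    have h2 := (abs_le.1 (ih (T x))).2
    have h3 : (0:ℝ) ≤ n * B := by positivity
    push_cast
    apply max_le <;> nlinarith

lemma integrable_of_bdd {μ : Measure Ω} [IsFiniteMeasure μ] {f : Ω → ℝ} (hf : Measurable f)
    {B : ℝ} (h : ∀ x, |f x| ≤ B) : Integrable f μ :=
  Integrable.of_bound hf.aestronglyMeasurable B (Eventually.of_forall fun x => by simpa using h x)

/-- Maximal ergodic inequality. -/
theorem maximal_ergodic {μ : Measure Ω} [IsProbabilityMeasure μ] {T : Ω → Ω}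
    (hT : MeasurePreserving T μ μ) {f : Ω → ℝ} (hf : Measurable f) {B : ℝ}
    (hfB : ∀ x, |f x| ≤ B) (hf0 : ∀ x, 0 ≤ f x) (δ : ℝ) :
    δ * μ.real {x | ∃ N : ℕ, δ * N < ∑ i ∈ Finset.range N, f (T^[i] x)} ≤ ∫ x, f x ∂μ := by
  set g : Ω → ℝ := fun x => f x - δ with hgdef
  have hgm : Measurable g := hf.sub_const δ
  have hgB : ∀ x, |g x| ≤ B + |δ| := fun x => by
    have := abs_sub (f x) δ
    have := hfB x
    simp only [g]; linarith
  have hB0 : 0 ≤ B + |δ| := by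
    obtain ⟨x⟩ : Nonempty Ω := nonempty_of_isProbabilityMeasure μ
    exact (abs_nonneg _).trans (hgB x)
  have hTm := hT.measurable
  set E : ℕ → Set Ω := fun n => {x | 0 < gmax T g n x} with hE
  have hEm : ∀ n, MeasurableSet (E n) := fun n =>
    measurableSet_lt measurable_const (gmax_measurable hTm hgm n)
  have key : ∀ n, δ * μ.real (E n) ≤ ∫ x, f x ∂μ := by
    intro n
    have hIntg : ∀ n, Integrable (gmax T g n) μ := fun n =>
      integrable_of_bdd (gmax_measurable hTm hgm n) (gmax_bdd hB0 hgB n)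
    have hgi : Integrable g μ := integrable_of_bdd hgm hgB
    have hfi : Integrable f μ := integrable_of_bdd hf hfB
    have hcomp : ∫ x, gmax T g n (T x) ∂μ = ∫ x, gmax T g n x ∂μ := by
      have := integral_map (μ := μ) hT.aemeasurable (f := gmax T g n)
        (by rw [hT.map_eq]; exact (hIntg n).aestronglyMeasurable)
      rw [hT.map_eq] at this
      exact this.symm
    have hci : Integrable (fun x => gmax T g n (T x)) μ :=
      (hT.integrable_comp (hIntg n).aestronglyMeasurable).2 (hIntg n)
    have h1 : ∀ x, gmax T g n x - gmax T g n (T x) ≤ (E n).indicator g x := by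
      intro x
      by_cases hx : x ∈ E n
      · rw [Set.indicator_of_mem hx]
        have hx' : 0 < gmax T g n x := hx
        cases n with
        | zero => simp [gmax] at hx'
        | succ m =>
          have : gmax T g (m+1) x = g x + gmax T g m (T x) := by
            simp only [gmax] at hx' ⊢
            rcases lt_max_iff.1 hx' with h | h
            · exact absurd h (lt_irrefl _)
            · exact max_eq_right h.le
          have h2 := gmax_mono_succ T g m (T x)
          linarith
      · rw [Set.indicator_of_notMem hx]
        have hx' : gmax T g n x ≤ 0 := not_lt.1 hx
        have := gmax_nonneg T g n (T x)
        linarith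
    have h2 : 0 ≤ ∫ x, (E n).indicator g x ∂μ := by
      have := integral_mono (μ := μ) ((hIntg n).sub hci) (hgi.indicator (hEm n)) h1
      rw [integral_sub' (hIntg n) hci, hcomp, sub_self] at this
      exact this
    rw [integral_indicator (hEm n)] at h2
    have h3 : ∫ x in E n, g x ∂μ = ∫ x in E n, f x ∂μ - δ * μ.real (E n) := by
      simp only [g]
      rw [integral_sub hfi.integrableOn (integrable_const _)]
      simp [mul_comm]
    have h4 : ∫ x in E n, f x ∂μ ≤ ∫ x, f x ∂μ :=
      setIntegral_le_integral hfi (Eventually.of_forall hf0)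
    linarith
  have hsub : {x | ∃ N : ℕ, δ * N < ∑ i ∈ Finset.range N, f (T^[i] x)} ⊆ ⋃ n, E n := by
    rintro x ⟨N, hN⟩
    refine mem_iUnion.2 ⟨N, ?_⟩
    have := sum_le_gmax T g N x
    simp only [g, Finset.sum_sub_distrib, Finset.sum_const, Finset.card_range, nsmul_eq_mul] at this
    show 0 < gmax T g N x
    nlinarith
  have hmono : Monotone E := fun a b hab x hx => lt_of_lt_of_le hx (gmax_mono T g x hab)
  have hlim : Tendsto (fun n => δ * μ.real (E n)) atTop (𝓝 (δ * μ.real (⋃ n, E n))) := by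
    refine Tendsto.const_mul _ ?_
    exact (ENNReal.tendsto_toReal (measure_ne_top _ _)).comp (tendsto_measure_iUnion_atTop hmono)
  have hU := le_of_tendsto' hlim key
  by_cases hδ : 0 ≤ δ
  · exact (mul_le_mul_of_nonneg_left (measureReal_mono hsub) hδ).trans hU
  · have h0 : 0 ≤ ∫ x, f x ∂μ := integral_nonneg hf0
    have h1 : 0 ≤ μ.real {x | ∃ N : ℕ, δ * N < ∑ i ∈ Finset.range N, f (T^[i] x)} :=
      measureReal_nonneg
    nlinarith
end Maximal

section SLLN
variable {Ω : Type*} [MeasurableSpace Ω]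

/-- Strong law for bounded variables with linear growth of second moments. -/
theorem slln_of_second_moment {μ : Measure Ω} [IsProbabilityMeasure μ] (Z : ℕ → Ω → ℝ)
    (hZm : ∀ i, Measurable (Z i)) {B : ℝ} (hZB : ∀ i x, |Z i x| ≤ B) {C : ℝ}
    (hC : ∀ N : ℕ, ∫ x, (∑ i ∈ Finset.range N, Z i x) ^ 2 ∂μ ≤ C * N) :
    ∀ᵐ x ∂μ, Tendsto (fun N : ℕ => (1 / N : ℝ) * ∑ i ∈ Finset.range N, Z i x) atTop (𝓝 0) := by
  have hB0 : 0 ≤ B := by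
    obtain ⟨x⟩ : Nonempty Ω := nonempty_of_isProbabilityMeasure μ
    exact (abs_nonneg _).trans (hZB 0 x)
  set S : ℕ → Ω → ℝ := fun N x => ∑ i ∈ Finset.range N, Z i x with hS
  have hSm : ∀ N, Measurable (S N) := fun N => Finset.measurable_sum _ fun i _ => hZm i
  have hsum : ∫⁻ x, ∑' r : ℕ, ENNReal.ofReal ((S ((r+1)^2) x / ((r+1:ℕ):ℝ)^2)^2) ∂μ < ∞ := by
    rw [lintegral_tsum (fun r => (((hSm _).div_const _).pow_const 2).ennreal_ofReal.aemeasurable)]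
    have hb : ∀ r : ℕ, ∫⁻ x, ENNReal.ofReal ((S ((r+1)^2) x / ((r+1:ℕ):ℝ)^2)^2) ∂μ
        ≤ ENNReal.ofReal (C * (1 / ((r+1:ℕ):ℝ)^2)) := by
      intro r
      rw [← ofReal_integral_eq_lintegral_ofReal]
      · apply ENNReal.ofReal_le_ofReal
        simp_rw [div_pow]
        rw [integral_div]
        have := hC ((r+1)^2)
        rw [div_le_iff₀ (by positivity)]
        refine this.trans (le_of_eq ?_)
        have : ((r+1:ℕ):ℝ) ≠ 0 := by positivity
        push_cast at this ⊢
        field_simp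
      · refine integrable_of_bdd (B := ((((r+1)^2:ℕ):ℝ) * B / ((r+1:ℕ):ℝ)^2)^2)
          (((hSm _).div_const _).pow_const 2) fun x => ?_
        rw [abs_of_nonneg (sq_nonneg _), sq_le_sq, abs_div, abs_div]
        have : |S ((r+1)^2) x| ≤ |(((r+1)^2:ℕ):ℝ) * B| := by
          rw [abs_of_nonneg (by positivity : (0:ℝ) ≤ (((r+1)^2:ℕ):ℝ) * B)]
          refine (Finset.abs_sum_le_sum_abs _ _).trans ?_
          refine (Finset.sum_le_sum fun i _ => hZB i x).trans ?_
          simp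
        gcongr
      · exact Eventually.of_forall fun x => sq_nonneg _
    refine lt_of_le_of_lt (ENNReal.tsum_le_tsum hb) ?_
    have hs : Summable fun r : ℕ => C * (1 / ((r+1:ℕ):ℝ)^2) := by
      apply Summable.mul_left
      exact (summable_nat_add_iff 1).2 (Real.summable_one_div_nat_pow.2 (by norm_num))
    exact hs.tsum_ofReal_lt_top
  have hae := ae_lt_top (Measurable.ennreal_tsum fun r =>
    (((hSm _).div_const _).pow_const 2).ennreal_ofReal) hsum.ne
  filter_upwards [hae] with x hx
  have hsq : Tendsto (fun r : ℕ => S ((r+1)^2) x / ((r+1:ℕ):ℝ)^2) atTop (𝓝 0) := by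
    have h1 := ENNReal.tendsto_atTop_zero_of_tsum_ne_top hx.ne
    have h2 := (ENNReal.tendsto_toReal ENNReal.zero_ne_top).comp h1
    have h3 : Tendsto (fun r : ℕ => (S ((r+1)^2) x / ((r+1:ℕ):ℝ)^2)^2) atTop (𝓝 0) := by
      refine h2.congr fun r => ?_
      simp only [Function.comp]
      rw [ENNReal.toReal_ofReal (sq_nonneg _)]
    have h4 := h3.sqrt
    simp only [Real.sqrt_sq_eq_abs, Real.sqrt_zero] at h4
    exact (tendsto_zero_iff_abs_tendsto_zero _).2 h4
  have hsq' : Tendsto (fun r : ℕ => S (r^2) x / (r:ℝ)^2) atTop (𝓝 0) :=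
    (tendsto_add_atTop_iff_nat 1).1 hsq
  have hsqrt : Tendsto Nat.sqrt atTop atTop := by
    apply tendsto_atTop_atTop.2
    intro b
    exact ⟨b^2, fun a ha => Nat.le_sqrt'.2 ha⟩
  have h5 := (hsq'.comp hsqrt).abs
  have h6 : Tendsto (fun N : ℕ => (2 * B) / (Nat.sqrt N : ℝ)) atTop (𝓝 0) :=
    (tendsto_const_div_atTop_nhds_zero_nat _).comp hsqrt
  have h7 := h5.add h6
  simp only [abs_zero, add_zero] at h7
  apply squeeze_zero_norm' _ h7
  filter_upwards [eventually_ge_atTop 1] with N hN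
  set r := Nat.sqrt N with hr
  have hr1 : 1 ≤ r := Nat.le_sqrt'.2 (by simpa using hN)
  have hrN : r^2 ≤ N := Nat.sqrt_le' N
  have hNr : N ≤ r^2 + 2*r := by
    have := Nat.sqrt_le_add N
    nlinarith
  have hsplit : |S N x| ≤ |S (r^2) x| + 2 * r * B := by
    have : S N x = S (r^2) x + ∑ i ∈ Finset.Ico (r^2) N, Z i x := by
      simp only [S]; rw [Finset.sum_range_add_sum_Ico _ hrN]
    rw [this]
    refine (abs_add_le _ _).trans ?_
    gcongr
    refine (Finset.abs_sum_le_sum_abs _ _).trans ?_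
    refine (Finset.sum_le_sum fun i _ => hZB i x).trans ?_
    simp only [Finset.sum_const, Nat.card_Ico, nsmul_eq_mul]
    gcongr
    have : N - r^2 ≤ 2 * r := by omega
    exact_mod_cast this
  have hrpos : (0:ℝ) < r := by exact_mod_cast hr1
  have hrN' : (r:ℝ)^2 ≤ N := by exact_mod_cast hrN
  have hNpos : (0:ℝ) < N := by exact_mod_cast hN
  rw [Real.norm_eq_abs, abs_mul, abs_of_pos (by positivity : (0:ℝ) < 1 / N)]
  simp only [Function.comp]
  rw [abs_div, abs_of_pos (by positivity : (0:ℝ) < (r:ℝ)^2)]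
  calc 1 / (N:ℝ) * |S N x| ≤ 1 / (r:ℝ)^2 * (|S (r^2) x| + 2 * r * B) := by gcongr
    _ = |S (r^2) x| / (r:ℝ)^2 + 2 * B / r := by field_simp
end SLLN


section MeanErgodic
variable {Ω : Type*} [MeasurableSpace Ω]

lemma sq_integral_le {μ : Measure Ω} [IsProbabilityMeasure μ] {f : Ω → ℝ} (hf : Integrable f μ)
    (hf2 : Integrable (fun x => f x ^ 2) μ) : (∫ x, f x ∂μ) ^ 2 ≤ ∫ x, f x ^ 2 ∂μ := by
  set m := ∫ x, f x ∂μ with hm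
  have h : 0 ≤ ∫ x, (f x - m) ^ 2 ∂μ := integral_nonneg fun x => sq_nonneg _
  have : ∫ x, (f x - m) ^ 2 ∂μ = ∫ x, f x ^ 2 ∂μ - m ^ 2 := by
    have e : ∀ x, (f x - m)^2 = (f x ^ 2 - 2 * m * f x) + m ^ 2 := fun x => by ring
    simp_rw [e]
    have hi : Integrable (fun x => f x ^ 2 - 2 * m * f x) μ := hf2.sub (hf.const_mul _)
    rw [integral_add hi (integrable_const _),
      integral_sub hf2 (hf.const_mul _), integral_const_mul, ← hm]
    simp
    ring
  linarith

lemma integral_abs_le_sqrt {μ : Measure Ω} [IsProbabilityMeasure μ] {f : Ω → ℝ}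
    (hf : Measurable f) {B : ℝ} (hB : ∀ x, |f x| ≤ B) {e : ℝ} (he : ∫ x, f x ^ 2 ∂μ ≤ e) :
    ∫ x, |f x| ∂μ ≤ √e := by
  have h1 : Integrable (fun x => |f x|) μ := (integrable_of_bdd hf hB).abs
  have h2 : Integrable (fun x => |f x| ^ 2) μ :=
    integrable_of_bdd (B := B^2) (by fun_prop) fun x => by
      rw [abs_of_nonneg (sq_nonneg _)]
      exact pow_le_pow_left₀ (abs_nonneg _) (hB x) 2
  have := sq_integral_le h1 h2
  simp only [sq_abs] at this
  apply Real.le_sqrt_of_sq_le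
  exact this.trans he

theorem mean_ergodic_L1 {μ : Measure Ω} [IsProbabilityMeasure μ] {T : Ω → Ω}
    (hT : Ergodic T μ) {b : Ω → ℝ} (hb : Measurable b) {B : ℝ} (hB : ∀ x, |b x| ≤ B) :
    Tendsto (fun n : ℕ => ∫ x, |(1 / n : ℝ) * ∑ i ∈ Finset.range n, b (T^[i] x) - ∫ y, b y ∂μ| ∂μ)
      atTop (𝓝 0) := by
  have hTm := hT.measurable
  have hmp := hT.toMeasurePreserving
  have hbL : MemLp b 2 μ := MemLp.of_bound hb.aestronglyMeasurable B (Eventually.of_forall hB)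
  set U : Lp ℝ 2 μ →L[ℝ] Lp ℝ 2 μ :=
    (Lp.compMeasurePreservingₗᵢ ℝ T hmp).toContinuousLinearMap with hU
  have hUn : ‖U‖ ≤ 1 := LinearIsometry.norm_toContinuousLinearMap_le _
  have hlim := U.tendsto_birkhoffAverage_orthogonalProjection hUn (hbL.toLp b)
  set z := (U.eqLocus (1 : Lp ℝ 2 μ →L[ℝ] Lp ℝ 2 μ)).orthogonalProjectionOnto (hbL.toLp b) with hz
  have hzfix : U z.1 = z.1 := z.2
  obtain ⟨c, hc⟩ : ∃ c, (z.1 : Ω → ℝ) =ᵐ[μ] Function.const Ω c := by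
    apply hT.ae_eq_const_of_ae_eq_comp_ae (Lp.aestronglyMeasurable _)
    have h1 := Lp.coeFn_compMeasurePreserving z.1 hmp
    have h2 : Lp.compMeasurePreserving T hmp z.1 = z.1 := hzfix
    rw [h2] at h1
    exact h1.symm
  have hiter : ∀ i : ℕ, (U^[i] (hbL.toLp b) : Ω → ℝ) =ᵐ[μ] fun x => b (T^[i] x) := by
    intro i
    induction i with
    | zero => simpa using hbL.coeFn_toLp
    | succ i ih =>
      rw [Function.iterate_succ_apply']
      have h1 := Lp.coeFn_compMeasurePreserving (U^[i] (hbL.toLp b)) hmp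
      have h2 : (U (U^[i] (hbL.toLp b)) : Ω → ℝ) =ᵐ[μ] (U^[i] (hbL.toLp b) : Ω → ℝ) ∘ T := h1
      refine h2.trans ?_
      have h3 := hmp.quasiMeasurePreserving.ae_eq_comp ih
      refine h3.trans ?_
      exact Eventually.of_forall fun x => by simp
  have h1 : ∀ n : ℕ, ((∑ k ∈ Finset.range n, _root_.id (U^[k] (hbL.toLp b)) : Lp ℝ 2 μ) : Ω → ℝ)
      =ᵐ[μ] fun x => ∑ i ∈ Finset.range n, b (T^[i] x) := by
    intro n
    induction n with
    | zero =>
      simp only [Finset.range_zero, Finset.sum_empty]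
      exact Lp.coeFn_zero ℝ 2 μ
    | succ n ih =>
      rw [Finset.sum_range_succ]
      refine (Lp.coeFn_add _ _).trans ?_
      filter_upwards [ih, hiter n] with x h1 h2
      rw [Pi.add_apply, h1, Finset.sum_range_succ]
      simp [h2]
  have hav : ∀ n : ℕ, ((birkhoffAverage ℝ U _root_.id n (hbL.toLp b) : Lp ℝ 2 μ) : Ω → ℝ) =ᵐ[μ]
      fun x => (1 / n : ℝ) * ∑ i ∈ Finset.range n, b (T^[i] x) := by
    intro n
    rw [birkhoffAverage, birkhoffSum]
    have h0 := Lp.coeFn_smul ((n:ℝ)⁻¹) (∑ k ∈ Finset.range n, _root_.id (U^[k] (hbL.toLp b)))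
    refine h0.trans ?_
    filter_upwards [h1 n] with x hx
    rw [Pi.smul_apply, hx, smul_eq_mul, one_div]
  have hnorm := tendsto_iff_norm_sub_tendsto_zero.1 hlim
  have hAm : ∀ n : ℕ, Measurable fun x => (1 / n : ℝ) * ∑ i ∈ Finset.range n, b (T^[i] x) := fun n =>
    (Finset.measurable_sum _ fun i _ => hb.comp (hTm.iterate i)).const_mul _
  have hB0 : 0 ≤ B := by
    obtain ⟨x⟩ : Nonempty Ω := nonempty_of_isProbabilityMeasure μ
    exact (abs_nonneg _).trans (hB x)
  have hAB : ∀ (n : ℕ) x, |(1 / n : ℝ) * ∑ i ∈ Finset.range n, b (T^[i] x)| ≤ B := by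
    intro n x
    rw [abs_mul, abs_of_nonneg (by positivity : (0:ℝ) ≤ 1 / n)]
    have : |∑ i ∈ Finset.range n, b (T^[i] x)| ≤ n * B :=
      (Finset.abs_sum_le_sum_abs _ _).trans ((Finset.sum_le_sum fun i _ => hB _).trans (by simp))
    rcases Nat.eq_zero_or_pos n with rfl | hn
    · simpa using hB0
    · have hn' : (0:ℝ) < n := by exact_mod_cast hn
      rw [one_div, inv_mul_le_iff₀ hn']
      exact this
  have hL1 : Tendsto (fun n : ℕ =>
      ∫ x, |(1 / n : ℝ) * ∑ i ∈ Finset.range n, b (T^[i] x) - c| ∂μ) atTop (𝓝 0) := by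
    refine squeeze_zero (fun n => integral_nonneg fun x => abs_nonneg _) (fun n => ?_) hnorm
    have e1 : ((birkhoffAverage ℝ U _root_.id n (hbL.toLp b) - z.1 : Lp ℝ 2 μ) : Ω → ℝ) =ᵐ[μ]
        fun x => (1 / n : ℝ) * ∑ i ∈ Finset.range n, b (T^[i] x) - c := by
      filter_upwards [Lp.coeFn_sub (birkhoffAverage ℝ U _root_.id n (hbL.toLp b)) z.1, hav n, hc]
        with x h1 h2 h3
      rw [h1, Pi.sub_apply, h2, h3]; rfl
    have e2 : ∫ x, ((1 / n : ℝ) * ∑ i ∈ Finset.range n, b (T^[i] x) - c)^2 ∂μ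
        = ‖birkhoffAverage ℝ U _root_.id n (hbL.toLp b) - z.1‖^2 := by
      rw [← real_inner_self_eq_norm_sq, L2.inner_def]
      apply integral_congr_ae
      filter_upwards [e1] with x hx
      rw [hx]
      simp [sq]
    have := integral_abs_le_sqrt (μ := μ) ((hAm n).sub_const c) (B := B + |c|)
      (fun x => (abs_sub _ _).trans (by linarith [hAB n x])) e2.le
    rwa [Real.sqrt_sq (norm_nonneg _)] at this
  have hcb : c = ∫ y, b y ∂μ := by
    have h1 : ∀ n : ℕ, 1 ≤ n → |(∫ y, b y ∂μ) - c| ≤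
        ∫ x, |(1 / n : ℝ) * ∑ i ∈ Finset.range n, b (T^[i] x) - c| ∂μ := by
      intro n hn
      have hbi : ∀ i : ℕ, ∫ x, b (T^[i] x) ∂μ = ∫ y, b y ∂μ := fun i => by
        have := integral_map (μ := μ) (hmp.iterate i).aemeasurable (f := b)
          hb.aestronglyMeasurable
        rw [(hmp.iterate i).map_eq] at this
        exact this.symm
      have h2 : ∫ x, ((1 / n : ℝ) * ∑ i ∈ Finset.range n, b (T^[i] x) - c) ∂μ
          = (∫ y, b y ∂μ) - c := by
        rw [integral_sub (integrable_of_bdd (hAm n) (hAB n)) (integrable_const _),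
          integral_const_mul, integral_finsetSum]
        · simp only [hbi]
          have : (n:ℝ) ≠ 0 := by positivity
          simp
          field_simp
        · exact fun i _ => integrable_of_bdd (hb.comp (hTm.iterate i)) fun x => hB _
      rw [← h2]
      exact abs_integral_le_integral_abs
    have h3 : |(∫ y, b y ∂μ) - c| ≤ 0 :=
      ge_of_tendsto hL1 (by filter_upwards [eventually_ge_atTop 1] with n hn using h1 n hn)
    have := abs_eq_zero.1 (le_antisymm h3 (abs_nonneg _))
    linarith
  rw [← hcb]
  exact hL1
end MeanErgodic



section Cells

lemma condExp_comp_mp {Ω : Type*} {m m0 : MeasurableSpace Ω} (μ : Measure Ω)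
    [IsProbabilityMeasure μ] {S : Ω → Ω} (hS : MeasurePreserving S μ μ)
    {f : Ω → ℝ} (hf : Integrable f μ) (hm : m ≤ m0) :
    (μ[f | m]) ∘ S =ᵐ[μ] μ[f ∘ S | m.comap S] := by
  have hle : m.comap S ≤ m0 := by
    rintro s ⟨t, ht, rfl⟩
    exact hS.measurable (hm _ ht)
  refine ae_eq_condExp_of_forall_setIntegral_eq hle (hS.integrable_comp_of_integrable hf)
    (fun _ _ _ => (hS.integrable_comp_of_integrable integrable_condExp).integrableOn) ?_ ?_
  · rintro s ⟨t, ht, rfl⟩ -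
    have ht' := hm _ ht
    have h1 : ∀ g : Ω → ℝ, Integrable g μ →
        ∫ x in S ⁻¹' t, (g ∘ S) x ∂μ = ∫ x in t, g x ∂μ := by
      intro g hg
      have := setIntegral_map (μ := μ) ht' (f := g) (g := S)
        (by rw [hS.map_eq]; exact hg.aestronglyMeasurable) hS.aemeasurable
      rw [hS.map_eq] at this
      exact this.symm
    rw [h1 _ integrable_condExp, h1 _ hf, setIntegral_condExp hm hf ht]
  · have h1 : StronglyMeasurable[m] (μ[f | m]) := stronglyMeasurable_condExp
    have h2 : Measurable[m.comap S] ((μ[f | m]) ∘ S) :=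
      h1.measurable.comp (comap_measurable S)
    exact h2.stronglyMeasurable.aestronglyMeasurable


/-- Index of the `p`-adic cell of level `k` containing `x`. -/
noncomputable def cidx (p k : ℕ) (x : ℝ) : ℤ := ⌊(p:ℝ)^k * x⌋

/-- The `p`-adic cell of level `k` containing `x`. -/
def cell (p k : ℕ) (x : ℝ) : Set ℝ := {y | cidx p k y = cidx p k x}

/-- Average of `f` over the cell of level `k` containing `x`. -/
noncomputable def CE (μ : Measure ℝ) (p k : ℕ) (f : ℝ → ℝ) (x : ℝ) : ℝ :=
  (μ.real (cell p k x))⁻¹ * ∫ y in cell p k x, f y ∂μ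

lemma cidx_measurable (p k : ℕ) : Measurable (cidx p k) :=
  Int.measurable_floor.comp (measurable_const.mul measurable_id)

lemma cell_measurable (p k : ℕ) (x : ℝ) : MeasurableSet (cell p k x) :=
  cidx_measurable p k (MeasurableSet.singleton _)

lemma Tmap_measurable (p : ℕ) : Measurable (Tmap p) :=
  measurable_fract.comp (measurable_const.mul measurable_id)

lemma Tmap_iterate_succ (p k : ℕ) (x : ℝ) :
    (Tmap p)^[k+1] x = Int.fract ((p:ℝ)^(k+1) * x) := by
  induction k with
  | zero => simp [Tmap]
  | succ k ih =>
    rw [Function.iterate_succ_apply', ih, Tmap]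
    have : (p:ℝ) * Int.fract ((p:ℝ)^(k+1) * x) =
        (p:ℝ)^(k+1+1) * x - ((p * ⌊(p:ℝ)^(k+1) * x⌋ : ℤ) : ℝ) := by
      rw [Int.fract]; push_cast; ring
    rw [this, Int.fract_sub_intCast]

lemma Tmap_iterate (p k : ℕ) (hk : 1 ≤ k) (x : ℝ) :
    (Tmap p)^[k] x = Int.fract ((p:ℝ)^k * x) := by
  obtain ⟨j, rfl⟩ : ∃ j, k = j + 1 := ⟨k - 1, by omega⟩
  exact Tmap_iterate_succ p j x

lemma Tmap_iterate' (p k : ℕ) {x : ℝ} (hx : x ∈ Ico (0:ℝ) 1) :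
    (Tmap p)^[k] x = Int.fract ((p:ℝ)^k * x) := by
  rcases Nat.eq_zero_or_pos k with rfl | h
  · simp [Int.fract_eq_self.2 hx]
  · exact Tmap_iterate p k h x

lemma cidx_div {p : ℕ} (hp : 1 ≤ p) (k j : ℕ) (x : ℝ) :
    cidx p k x = cidx p (k+j) x / (p:ℤ)^j := by
  have h : (0:ℝ) < (p:ℝ)^j := by positivity
  have : (p:ℝ)^k * x = ((p:ℝ)^(k+j) * x) / ((p^j : ℕ) : ℝ) := by
    push_cast
    rw [pow_add]; field_simp
  rw [cidx, cidx, this, Int.floor_div_natCast]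
  push_cast
  rfl

lemma cidx_fract_add (p k n : ℕ) (x : ℝ) :
    cidx p (k+n) x = (p:ℤ)^n * cidx p k x + cidx p n (Int.fract ((p:ℝ)^k * x)) := by
  have : (p:ℝ)^(k+n) * x = (((p:ℤ)^n * cidx p k x : ℤ) : ℝ) + (p:ℝ)^n * Int.fract ((p:ℝ)^k * x) := by
    rw [Int.fract, cidx]; push_cast; ring
  rw [cidx, this, Int.floor_intCast_add]
  rfl

lemma cidx_T {p : ℕ} (hp : 1 ≤ p) (d : ℕ) (z : ℝ) :
    cidx p d (Tmap p z) = cidx p (d+1) z % (p:ℤ)^d := by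
  have h1 := cidx_fract_add p 1 d z
  have h2 := cidx_div hp 1 d z
  rw [show 1 + d = d + 1 by ring] at h1 h2
  have h3 := Int.emod_add_mul_ediv (cidx p (d+1) z) ((p:ℤ)^d)
  rw [← h2] at h3
  rw [Tmap]
  rw [pow_one] at h1
  linarith

lemma cell_eq {p k : ℕ} {x y : ℝ} (h : cidx p k x = cidx p k y) : cell p k x = cell p k y := by
  simp [cell, h]

lemma mem_cell (p k : ℕ) (x : ℝ) : x ∈ cell p k x := rfl

lemma cell_subset {p : ℕ} (hp : 1 ≤ p) {k l : ℕ} (hkl : k ≤ l) (x : ℝ) :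
    cell p l x ⊆ cell p k x := by
  intro y hy
  obtain ⟨j, rfl⟩ := Nat.exists_eq_add_of_le hkl
  have hy' : cidx p (k+j) y = cidx p (k+j) x := hy
  show cidx p k y = cidx p k x
  rw [cidx_div hp k j, hy', ← cidx_div hp]

lemma dist_le_of_mem_cell {p : ℕ} (hp : 1 ≤ p) {k : ℕ} {x y : ℝ} (h : y ∈ cell p k x) :
    |y - x| ≤ ((p:ℝ)^k)⁻¹ := by
  have h' : ⌊(p:ℝ)^k * y⌋ = ⌊(p:ℝ)^k * x⌋ := h
  have := Int.abs_sub_lt_one_of_floor_eq_floor h'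
  have hpos : (0:ℝ) < (p:ℝ)^k := by positivity
  rw [← mul_sub, abs_mul, abs_of_pos hpos] at this
  rw [← one_div, le_div_iff₀ hpos]; linarith

variable (μ : Measure ℝ) [IsProbabilityMeasure μ]

lemma CE_congr {p k : ℕ} {f : ℝ → ℝ} {x y : ℝ} (h : cidx p k x = cidx p k y) :
    CE μ p k f x = CE μ p k f y := by
  simp [CE, cell_eq h]

lemma CE_factor (p k : ℕ) (f : ℝ → ℝ) : ∃ F : ℤ → ℝ, CE μ p k f = fun x => F (cidx p k x) :=
  ⟨fun c => (μ.real {y | cidx p k y = c})⁻¹ * ∫ y in {y | cidx p k y = c}, f y ∂μ, rfl⟩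

lemma CE_measurable (p k : ℕ) (f : ℝ → ℝ) : Measurable (CE μ p k f) := by
  obtain ⟨F, hF⟩ := CE_factor μ p k f
  rw [hF]
  exact (measurable_from_top (f := F)).comp (cidx_measurable p k)

lemma real_cell_measurable (p k : ℕ) : Measurable fun x => μ.real (cell p k x) :=
  (measurable_from_top (f := fun c : ℤ => μ.real {y | cidx p k y = c})).comp (cidx_measurable p k)

lemma CE_le {p k : ℕ} {f : ℝ → ℝ} {B : ℝ} {x : ℝ} (hB0 : 0 ≤ B)
    (hB : ∀ y ∈ cell p k x, |f y| ≤ B) : |CE μ p k f x| ≤ B := by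
  rw [CE, abs_mul, abs_of_nonneg (by positivity)]
  have h : |∫ y in cell p k x, f y ∂μ| ≤ B * μ.real (cell p k x) :=
    norm_setIntegral_le_of_norm_le_const (μ := μ) (s := cell p k x) (f := f) (C := B)
      (measure_lt_top _ _) (fun y hy => hB y hy)
  by_cases h0 : μ.real (cell p k x) = 0
  · simp [h0, hB0]
  · have : 0 < μ.real (cell p k x) := lt_of_le_of_ne measureReal_nonneg (Ne.symm h0)
    rw [inv_mul_le_iff₀ this]; linarith

lemma CE_sub {p k : ℕ} {f g : ℝ → ℝ} (hf : Integrable f μ) (hg : Integrable g μ) (x : ℝ) :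
    CE μ p k (fun y => f y - g y) x = CE μ p k f x - CE μ p k g x := by
  simp only [CE]
  rw [integral_sub hf.integrableOn hg.integrableOn]; ring

lemma CE_sub_le {p k : ℕ} {f g : ℝ → ℝ} (hf : Integrable f μ) (hg : Integrable g μ) {x e : ℝ}
    (he : 0 ≤ e) (h : ∀ y ∈ cell p k x, |f y - g y| ≤ e) :
    |CE μ p k f x - CE μ p k g x| ≤ e := by
  rw [← CE_sub μ hf hg]
  exact CE_le μ he h

/-- The sigma-algebra of level `k` cells. -/
@[reducible] noncomputable def cellAlg (p k : ℕ) : MeasurableSpace ℝ := MeasurableSpace.comap (cidx p k) ⊤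

lemma cellAlg_le (p k : ℕ) : cellAlg p k ≤ (inferInstance : MeasurableSpace ℝ) :=
  (cidx_measurable p k).comap_le

lemma ae_cell_pos (p k : ℕ) : ∀ᵐ x ∂μ, 0 < μ.real (cell p k x) := by
  have : {x | ¬ 0 < μ.real (cell p k x)} ⊆
      ⋃ c : {c : ℤ // μ {y | cidx p k y = c} = 0}, {y | cidx p k y = c.1} := by
    intro x hx
    have h0 : μ.real (cell p k x) = 0 := le_antisymm (not_lt.1 hx) measureReal_nonneg
    have h1 : μ {y | cidx p k y = cidx p k x} = 0 := (measureReal_eq_zero_iff).1 h0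
    exact mem_iUnion.2 ⟨⟨cidx p k x, h1⟩, rfl⟩
  rw [ae_iff]
  exact measure_mono_null this (measure_iUnion_null fun c => c.2)

lemma CE_self {p k : ℕ} (F : ℤ → ℝ) {x : ℝ} (hx : 0 < μ.real (cell p k x)) :
    CE μ p k (fun y => F (cidx p k y)) x = F (cidx p k x) := by
  rw [CE, setIntegral_congr_fun (cell_measurable p k x)
    (g := fun _ => F (cidx p k x)) (fun y hy => by
      have : cidx p k y = cidx p k x := hy
      simp [this])]
  simp
  field_simp

lemma CE_eq_condExp {p k : ℕ} {f : ℝ → ℝ} (hf : Integrable f μ) {B : ℝ} (hB : ∀ x, |f x| ≤ B) :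
    CE μ p k f =ᵐ[μ] μ[f | cellAlg p k] := by
  have hB0 : 0 ≤ B := (abs_nonneg _).trans (hB 0)
  have hIntg : Integrable (CE μ p k f) μ :=
    integrable_of_bdd (CE_measurable μ p k f) fun x => CE_le μ hB0 fun y _ => hB y
  refine ae_eq_condExp_of_forall_setIntegral_eq (cellAlg_le p k) hf
    (fun _ _ _ => hIntg.integrableOn) ?_ ?_
  · rintro s ⟨S, -, rfl⟩ -
    have hun : cidx p k ⁻¹' S = ⋃ c : S, {y | cidx p k y = c.1} := by
      ext y; simp
    have hm : ∀ c : S, MeasurableSet {y | cidx p k y = c.1} := fun c =>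
      cidx_measurable p k (MeasurableSet.singleton _)
    have hd : Pairwise (Function.onFun Disjoint fun c : S => {y | cidx p k y = c.1}) := by
      intro a b hab
      refine Set.disjoint_left.2 fun y hy hy' => hab (Subtype.ext ?_)
      exact (hy : cidx p k y = a.1).symm.trans hy'
    rw [hun, integral_iUnion hm hd hIntg.integrableOn, integral_iUnion hm hd hf.integrableOn]
    congr 1
    ext c
    rcases Set.eq_empty_or_nonempty {y | cidx p k y = c.1} with h | ⟨x, hx⟩
    · rw [h]; simp
    · have hx' : {y | cidx p k y = c.1} = cell p k x := by
        ext y; simp only [cell, mem_ofPred_eq]; rw [(hx : cidx p k x = c.1)]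
      rw [hx', setIntegral_congr_fun (cell_measurable p k x)
        (g := fun _ => CE μ p k f x) (fun y hy => CE_congr μ hy)]
      rw [setIntegral_const, smul_eq_mul, CE]
      by_cases h0 : μ.real (cell p k x) = 0
      · have : μ (cell p k x) = 0 := (measureReal_eq_zero_iff).1 h0
        rw [h0, Measure.restrict_eq_zero.2 this]; simp
      · field_simp
  · obtain ⟨F, hF⟩ := CE_factor μ p k f
    rw [hF]
    have : Measurable[cellAlg p k] fun x => F (cidx p k x) :=
      (measurable_from_top (f := F)).comp (comap_measurable (cidx p k))
    exact this.stronglyMeasurable.aestronglyMeasurable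

lemma integral_mul_CE {p k : ℕ} {f : ℝ → ℝ} (hf : Measurable f) {B : ℝ} (hB : ∀ x, |f x| ≤ B)
    (F : ℤ → ℝ) {B' : ℝ} (hF : ∀ c, |F c| ≤ B') :
    ∫ x, F (cidx p k x) * CE μ p k f x ∂μ = ∫ x, F (cidx p k x) * f x ∂μ := by
  have hfi : Integrable f μ := integrable_of_bdd hf hB
  have h1 : Measurable[cellAlg p k] fun x => F (cidx p k x) :=
    (measurable_from_top (f := F)).comp (comap_measurable (cidx p k))
  have h2 := condExp_stronglyMeasurable_mul_of_bound (μ := μ) (cellAlg_le p k)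
    h1.stronglyMeasurable hfi B' (Eventually.of_forall fun x => hF _)
  have h3 := integral_condExp (μ := μ) (cellAlg_le p k)
    (f := (fun x => F (cidx p k x)) * f)
  rw [show ∫ x, F (cidx p k x) * f x ∂μ = ∫ x, ((fun x => F (cidx p k x)) * f) x ∂μ from rfl, ← h3]
  apply integral_congr_ae
  filter_upwards [h2, CE_eq_condExp μ hfi hB (p := p) (k := k)] with x hx hx'
  rw [hx, Pi.mul_apply, hx']

lemma integral_CE {p k : ℕ} {f : ℝ → ℝ} (hf : Measurable f) {B : ℝ} (hB : ∀ x, |f x| ≤ B) :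
    ∫ x, CE μ p k f x ∂μ = ∫ x, f x ∂μ := by
  simpa using integral_mul_CE μ hf hB (fun _ => 1) (B' := 1) (by simp) (p := p) (k := k)

end Cells


section Doob

lemma doob_abs {Ω : Type*} {m0 : MeasurableSpace Ω} {μ : Measure Ω} [IsProbabilityMeasure μ]
    (ℱ : Filtration ℕ m0) (X : Ω → ℝ) (W : ℕ → Ω → ℝ)
    (hW : ∀ j, W j =ᵐ[μ] μ[X | ℱ j]) (n : ℕ) {l : ℝ} (hl : 0 < l) :
    l * μ.real {x | ∃ j ≤ n, l ≤ |W j x - W 0 x|} ≤ ∫ x, |W n x - W 0 x| ∂μ := by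
  set M : ℕ → Ω → ℝ := fun j => μ[X | ℱ j] with hM
  have hmart : Martingale M ℱ μ := martingale_condExp X ℱ μ
  have hconst : Martingale (fun _ : ℕ => M 0) ℱ μ := by
    refine martingale_const_fun ℱ μ ?_ integrable_condExp
    exact stronglyMeasurable_condExp.mono (ℱ.mono bot_le)
  have hd := hmart.sub hconst
  have hsub := hd.submartingale.sup hd.neg.submartingale
  set f : ℕ → Ω → ℝ := (M - fun _ => M 0) ⊔ -(M - fun _ => M 0) with hf
  have hfabs : ∀ j x, f j x = |M j x - M 0 x| := fun j x => by
    rw [abs_eq_max_neg]; rfl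
  have hnn : 0 ≤ f := fun j x => by rw [hfabs]; exact abs_nonneg _
  have key := maximal_ineq hsub hnn (ε := ⟨l, hl.le⟩) n
  have hW' : ∀ᵐ x ∂μ, ∀ j, W j x = M j x := ae_all_iff.2 hW
  set A := {ω | l ≤ (Finset.range (n + 1)).sup' Finset.nonempty_range_add_one fun k => f k ω} with hA
  have hset : {x | ∃ j ≤ n, l ≤ |W j x - W 0 x|} =ᵐ[μ] A := by
    filter_upwards [hW'] with x hx
    apply propext
    show (∃ j ≤ n, l ≤ |W j x - W 0 x|) ↔ l ≤ (Finset.range (n + 1)).sup' _ fun k => f k x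
    rw [Finset.le_sup'_iff]
    simp only [Finset.mem_range, Nat.lt_succ_iff, hfabs, hx]
  have hIntg : Integrable (f n) μ := hsub.integrable n
  have h1 : l * μ.real A ≤ ∫ x in A, f n x ∂μ := by
    have h2 : (0:ℝ) ≤ ∫ x in A, f n x ∂μ := integral_nonneg (hnn n)
    have h3 := ENNReal.toReal_mono ENNReal.ofReal_ne_top key
    rw [ENNReal.toReal_mul] at h3
    exact h3.trans_eq (ENNReal.toReal_ofReal h2)
  rw [measureReal_congr hset]
  refine h1.trans ((setIntegral_le_integral hIntg (Eventually.of_forall (hnn n))).trans (le_of_eq ?_))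
  apply integral_congr_ae
  filter_upwards [hW'] with x hx
  rw [hfabs, hx, hx]

lemma mart_orth {Ω : Type*} {m1 m2 m0 : MeasurableSpace Ω} {μ : Measure Ω}
    [IsProbabilityMeasure μ] (h12 : m1 ≤ m2) (h2 : m2 ≤ m0) {X : Ω → ℝ}
    {W1 W2 : Ω → ℝ} (hm1 : Measurable W1) (hm2 : Measurable W2)
    (hm1' : StronglyMeasurable[m1] W1)
    {B : ℝ} (hB1 : ∀ x, |W1 x| ≤ B) (hB2 : ∀ x, |W2 x| ≤ B)
    (hW1 : W1 =ᵐ[μ] μ[X | m1]) (hW2 : W2 =ᵐ[μ] μ[X | m2]) :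
    ∫ x, (W2 x - W1 x) ^ 2 ∂μ = ∫ x, W2 x ^ 2 ∂μ - ∫ x, W1 x ^ 2 ∂μ := by
  have i1 : Integrable W1 μ := integrable_of_bdd hm1 hB1
  have i2 : Integrable W2 μ := integrable_of_bdd hm2 hB2
  have sqb : ∀ {a b : ℝ}, |a| ≤ B → |b| ≤ B → |a * b| ≤ B * B := by
    intro a b ha hb
    rw [abs_mul]; exact mul_le_mul ha hb (abs_nonneg _) ((abs_nonneg _).trans ha)
  have i11 : Integrable (fun x => W1 x * W1 x) μ :=
    integrable_of_bdd (hm1.mul hm1) fun x => sqb (hB1 x) (hB1 x)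
  have i12 : Integrable (fun x => W1 x * W2 x) μ :=
    integrable_of_bdd (hm1.mul hm2) fun x => sqb (hB1 x) (hB2 x)
  have i22 : Integrable (fun x => W2 x * W2 x) μ :=
    integrable_of_bdd (hm2.mul hm2) fun x => sqb (hB2 x) (hB2 x)
  have hc : μ[W2 | m1] =ᵐ[μ] W1 := by
    refine (condExp_congr_ae hW2).trans ?_
    exact (condExp_condExp_of_le h12 h2).trans hW1.symm
  have h3 := condExp_stronglyMeasurable_mul_of_bound (μ := μ) (h12.trans h2) hm1' i2 B
    (Eventually.of_forall hB1)
  have h4 := integral_condExp (μ := μ) (h12.trans h2) (f := W1 * W2)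
  have h5 : ∫ x, W1 x * W2 x ∂μ = ∫ x, W1 x * W1 x ∂μ := by
    rw [show ∫ x, W1 x * W2 x ∂μ = ∫ x, (W1 * W2) x ∂μ from rfl, ← h4]
    apply integral_congr_ae
    filter_upwards [h3, hc] with x hx hx'
    rw [hx, Pi.mul_apply, hx']
  have e : ∀ x, (W2 x - W1 x) ^ 2 = (W2 x * W2 x - 2 * (W1 x * W2 x)) + W1 x * W1 x :=
    fun x => by ring
  simp_rw [e]
  have j1 := integral_add (i22.sub (i12.const_mul 2)) i11
  simp only [Pi.sub_apply] at j1
  rw [j1, integral_sub i22 (i12.const_mul 2), integral_const_mul, h5]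
  simp_rw [pow_two]
  ring

end Doob

section VV

variable (μ : Measure ℝ) [IsProbabilityMeasure μ]

/-- Conditional expectation of `h ∘ T^d` on cells of level `d`. -/
noncomputable def VV (p : ℕ) (h : ℝ → ℝ) (d : ℕ) : ℝ → ℝ :=
  CE μ p d (fun y => h ((Tmap p)^[d] y))

lemma VV_measurable (p : ℕ) (h : ℝ → ℝ) (d : ℕ) : Measurable (VV μ p h d) := CE_measurable _ _ _ _

lemma VV_le (p : ℕ) {h : ℝ → ℝ} {B : ℝ} (hB : ∀ x, |h x| ≤ B) (d : ℕ) (x : ℝ) :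
    |VV μ p h d x| ≤ B := CE_le μ ((abs_nonneg _).trans (hB 0)) fun _ _ => hB _

lemma Titer_measurable (p k : ℕ) : Measurable ((Tmap p)^[k]) := (Tmap_measurable p).iterate k

lemma cidx_T_iter {p : ℕ} (hp : 1 ≤ p) (d e : ℕ) (z : ℝ) :
    cidx p d ((Tmap p)^[e] z) = if e = 0 then cidx p d z else cidx p (d+e) z % (p:ℤ)^d := by
  induction e generalizing z with
  | zero => simp
  | succ e ih =>
    rw [Function.iterate_succ_apply, ih]
    rw [if_neg (Nat.succ_ne_zero e)]
    split_ifs with h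
    · subst h; exact cidx_T hp d z
    · rw [cidx_T hp (d+e) z]
      rw [Int.emod_emod_of_dvd _ (pow_dvd_pow _ (by omega))]
      rfl

/-- Sigma-algebra in the backward filtration. -/
@[reducible] noncomputable def BF (p K d : ℕ) : MeasurableSpace ℝ :=
  (cellAlg p d).comap ((Tmap p)^[K-d])

lemma BF_le (p K d : ℕ) : BF p K d ≤ (inferInstance : MeasurableSpace ℝ) := by
  rintro s ⟨t, ht, rfl⟩
  exact Titer_measurable p (K-d) (cellAlg_le p d _ ht)

lemma BF_mono {p : ℕ} (hp : 1 ≤ p) {K d d' : ℕ} (h : d ≤ d') (h' : d' ≤ K) :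
    BF p K d ≤ BF p K d' := by
  rcases h.eq_or_lt with rfl | hlt
  · exact le_rfl
  rintro s ⟨t, ⟨S, -, rfl⟩, rfl⟩
  refine ⟨_, ⟨{c | c % (p:ℤ)^d ∈ S}, trivial, rfl⟩, ?_⟩
  ext z
  have h1 : (Tmap p)^[K-d] z = (Tmap p)^[d'-d] ((Tmap p)^[K-d'] z) := by
    rw [← Function.iterate_add_apply]; congr 1; omega
  simp only [mem_preimage]
  rw [h1, cidx_T_iter hp d (d'-d), if_neg (by omega), show d + (d'-d) = d' by omega]
  rfl

lemma VV_comp_ae {p : ℕ} (hT : MeasurePreserving (Tmap p) μ μ) {h : ℝ → ℝ} (hh : Measurable h)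
    {B : ℝ} (hB : ∀ x, |h x| ≤ B) {K d : ℕ} (hd : d ≤ K) :
    (fun x => VV μ p h d ((Tmap p)^[K-d] x)) =ᵐ[μ]
      μ[fun x => h ((Tmap p)^[K] x) | BF p K d] := by
  have hm : Measurable fun y => h ((Tmap p)^[d] y) := hh.comp (Titer_measurable p d)
  have hi : Integrable (fun y => h ((Tmap p)^[d] y)) μ := integrable_of_bdd hm fun x => hB _
  have h1 := CE_eq_condExp μ (p := p) (k := d) hi (fun x => hB _)
  have hS := hT.iterate (K-d)
  have h2 := hS.quasiMeasurePreserving.ae_eq_comp h1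
  have h3 := condExp_comp_mp μ hS hi (cellAlg_le p d)
  have e : (fun y => h ((Tmap p)^[d] y)) ∘ (Tmap p)^[K-d] = fun x => h ((Tmap p)^[K] x) := by
    ext y
    show h ((Tmap p)^[d] ((Tmap p)^[K-d] y)) = h ((Tmap p)^[K] y)
    rw [← Function.iterate_add_apply]; congr 2; omega
  rw [e] at h3
  exact h2.trans h3

lemma VV_comp_sm (p : ℕ) (h : ℝ → ℝ) (K d : ℕ) :
    StronglyMeasurable[BF p K d] (fun x => VV μ p h d ((Tmap p)^[K-d] x)) := by
  obtain ⟨F, hF⟩ := CE_factor μ p d (fun y => h ((Tmap p)^[d] y))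
  have h1 : Measurable[cellAlg p d] fun x => F (cidx p d x) :=
    (measurable_from_top (f := F)).comp (comap_measurable (cidx p d))
  have h2 : Measurable[BF p K d] fun x => F (cidx p d ((Tmap p)^[K-d] x)) :=
    h1.comp (comap_measurable _)
  rw [VV, hF]
  exact h2.stronglyMeasurable

lemma VV_orth {p : ℕ} (hp : 1 ≤ p) (hT : MeasurePreserving (Tmap p) μ μ) {h : ℝ → ℝ}
    (hh : Measurable h) {B : ℝ} (hB : ∀ x, |h x| ≤ B) {K D : ℕ} (hD : D ≤ K) :
    ∫ x, (VV μ p h K x - VV μ p h D ((Tmap p)^[K-D] x)) ^ 2 ∂μ =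
      ∫ x, VV μ p h K x ^ 2 ∂μ - ∫ x, VV μ p h D x ^ 2 ∂μ := by
  have h1 := VV_comp_ae μ hT hh hB hD
  have h2 := VV_comp_ae μ hT hh hB (le_refl K)
  have h3 := mart_orth (m0 := inferInstance) (BF_mono hp hD le_rfl) (BF_le p K K)
    ((VV_measurable μ p h D).comp (Titer_measurable p (K-D)))
    ((VV_measurable μ p h K).comp (Titer_measurable p (K-K)))
    (VV_comp_sm μ p h K D) (fun x => VV_le μ p hB D _) (fun x => VV_le μ p hB K _) h1 h2
  simp only [Function.comp, Nat.sub_self, Function.iterate_zero, id] at h3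
  rw [h3]
  congr 1
  have hS := hT.iterate (K-D)
  have := integral_map (μ := μ) hS.aemeasurable (f := fun x => VV μ p h D x ^ 2)
    ((VV_measurable μ p h D).pow_const 2).aestronglyMeasurable
  rw [hS.map_eq] at this
  exact this.symm

lemma VV_cauchy {p : ℕ} (hp : 1 ≤ p) (hT : MeasurePreserving (Tmap p) μ μ) {h : ℝ → ℝ}
    (hh : Measurable h) {B : ℝ} (hB : ∀ x, |h x| ≤ B) {e : ℝ} (he : 0 < e) :
    ∃ D0, ∀ D ≥ D0, ∀ K ≥ D,
      ∫ x, (VV μ p h K x - VV μ p h D ((Tmap p)^[K-D] x)) ^ 2 ∂μ ≤ e := by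
  set v : ℕ → ℝ := fun d => ∫ x, VV μ p h d x ^ 2 ∂μ with hv
  have hmono : Monotone v := by
    intro D K hDK
    have h1 := VV_orth μ hp hT hh hB hDK
    have h2 : 0 ≤ ∫ x, (VV μ p h K x - VV μ p h D ((Tmap p)^[K-D] x)) ^ 2 ∂μ :=
      integral_nonneg fun x => sq_nonneg _
    rw [h1] at h2
    simp only [hv]; linarith
  have hbdd : BddAbove (range v) := by
    refine ⟨B^2, ?_⟩
    rintro _ ⟨d, rfl⟩
    have : ∀ x, VV μ p h d x ^ 2 ≤ B ^ 2 := fun x => by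
      rw [← sq_abs]; exact pow_le_pow_left₀ (abs_nonneg _) (VV_le μ p hB d x) 2
    have h1 : Integrable (fun x => VV μ p h d x ^ 2) μ :=
      integrable_of_bdd ((VV_measurable μ p h d).pow_const 2) (B := B^2) fun x => by
        rw [abs_of_nonneg (sq_nonneg _)]; exact this x
    have h2 := integral_mono h1 (integrable_const (B^2)) this
    simpa using h2
  have ht := tendsto_atTop_ciSup hmono hbdd
  obtain ⟨D0, hD0⟩ := (ht.eventually (lt_mem_nhds (sub_lt_self _ he))).exists
  refine ⟨D0, fun D hD K hK => ?_⟩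
  rw [VV_orth μ hp hT hh hB hK]
  have h1 : v K ≤ ⨆ i, v i := le_ciSup hbdd K
  have h2 := hmono hD
  simp only [hv] at h1 h2 hD0 ⊢
  linarith

lemma VV_L1 {p : ℕ} (hp : 1 ≤ p) (hT : MeasurePreserving (Tmap p) μ μ) {h : ℝ → ℝ}
    (hh : Measurable h) {B : ℝ} (hB : ∀ x, |h x| ≤ B) {e : ℝ} (he : 0 < e) :
    ∃ D0, ∀ D ≥ D0, ∀ K ≥ D,
      ∫ x, |VV μ p h K x - VV μ p h D ((Tmap p)^[K-D] x)| ∂μ ≤ e := by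
  obtain ⟨D0, h0⟩ := VV_cauchy μ hp hT hh hB (pow_pos he 2)
  refine ⟨D0, fun D hD K hK => ?_⟩
  have := integral_abs_le_sqrt (μ := μ) (B := 2 * B)
    ((VV_measurable μ p h K).sub ((VV_measurable μ p h D).comp (Titer_measurable p (K-D))))
    (fun x => by
      have h1 := VV_le μ p hB K x
      have h2 := VV_le μ p hB D ((Tmap p)^[K-D] x)
      have := abs_sub (VV μ p h K x) (VV μ p h D ((Tmap p)^[K-D] x))
      simp only [Pi.sub_apply, Function.comp]
      linarith) (h0 D hD K hK)
  rwa [Real.sqrt_sq he.le] at this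

/-- Maker-type maximal lemma. -/
lemma maker {p : ℕ} (hp : 1 ≤ p) (hT : MeasurePreserving (Tmap p) μ μ) {h : ℝ → ℝ}
    (hh : Measurable h) {B : ℝ} (hB : ∀ x, |h x| ≤ B) {δ ε : ℝ} (hδ : 0 < δ) (hε : 0 < ε) :
    ∃ D0, ∀ D ≥ D0, μ.real {x | ∃ N : ℕ, δ * N < ∑ k ∈ Finset.range N,
      if D ≤ k then |VV μ p h k x - VV μ p h D ((Tmap p)^[k-D] x)| else 0} ≤ ε := by
  have hB0 : 0 ≤ B := (abs_nonneg _).trans (hB 0)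
  set l := δ * ε / 2 with hl
  have hlpos : 0 < l := by positivity
  obtain ⟨D0, h0⟩ := VV_L1 μ hp hT hh hB (e := l ^ 2 / (2 * B + 1)) (by positivity)
  refine ⟨D0, fun D hD => ?_⟩
  set r : ℕ → ℝ → ℝ := fun k x =>
    if D ≤ k then |VV μ p h k x - VV μ p h D ((Tmap p)^[k-D] x)| else 0 with hr
  have hrm : ∀ k, Measurable (r k) := fun k => by
    simp only [hr]
    split_ifs
    · have h1 := VV_measurable μ p h k
      have h2 := (VV_measurable μ p h D).comp (Titer_measurable p (k-D))
      exact (h1.sub h2).abs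
    · exact measurable_const
  have hr2 : ∀ k x, r k x ≤ 2 * B := fun k x => by
    simp only [hr]
    split_ifs
    · have h1 := VV_le μ p hB k x
      have h2 := VV_le μ p hB D ((Tmap p)^[k-D] x)
      have := abs_sub (VV μ p h k x) (VV μ p h D ((Tmap p)^[k-D] x))
      linarith
    · linarith
  have hK : ∀ K ≥ D, μ.real {x | ∃ N ≤ K, δ * (N:ℕ) < ∑ k ∈ Finset.range N, r k x} ≤ ε := by
    intro K hKD
    set W : ℕ → ℝ → ℝ := fun j x =>
      VV μ p h (min (D+j) K) ((Tmap p)^[K - min (D+j) K] x) with hW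
    let ℱ : Filtration ℕ (inferInstance : MeasurableSpace ℝ) :=
      { seq := fun j => BF p K (min (D+j) K)
        mono' := fun i j hij => BF_mono hp (min_le_min (by omega) le_rfl) (min_le_right _ _)
        le' := fun j => BF_le _ _ _ }
    have hWc : ∀ j, W j =ᵐ[μ] μ[fun x => h ((Tmap p)^[K] x) | ℱ j] := fun j =>
      VV_comp_ae μ hT hh hB (min_le_right _ _)
    have hdoob := doob_abs ℱ _ W hWc (K - D) hlpos
    set E := {x | ∃ j ≤ K - D, l ≤ |W j x - W 0 x|} with hE
    have hWm : ∀ j, Measurable (W j) := fun j =>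
      (VV_measurable μ p h _).comp (Titer_measurable p _)
    have hEm : MeasurableSet E := by
      have : E = ⋃ j ∈ Finset.range (K - D + 1), {x | l ≤ |W j x - W 0 x|} := by
        ext x; simp [hE, Nat.lt_succ_iff]
      rw [this]
      exact Finset.measurableSet_biUnion _ fun j _ =>
        measurableSet_le measurable_const ((hWm j).sub (hWm 0)).abs
    have hE1 : l * μ.real E ≤ l ^ 2 / (2 * B + 1) := by
      refine hdoob.trans ((le_of_eq ?_).trans (h0 D hD K hKD))
      refine integral_congr_ae (Eventually.of_forall fun x => ?_)
      simp only [hW]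
      rw [show min (D + (K - D)) K = K by omega, show min (D+0) K = D by omega]
      simp
    have hE2 : 2 * B * μ.real E ≤ l := by
      have h1 : μ.real E ≤ l / (2 * B + 1) := by
        rw [le_div_iff₀ (by positivity)]
        rw [le_div_iff₀ (by positivity)] at hE1
        nlinarith
      rw [le_div_iff₀ (by positivity)] at h1
      nlinarith [measureReal_nonneg (μ := μ) (s := E)]
    set f : ℝ → ℝ := fun x => l + E.indicator (fun _ => 2 * B) x with hf
    have hfm : Measurable f := measurable_const.add (measurable_const.indicator hEm)
    have hind : ∀ x, 0 ≤ E.indicator (fun _ => 2 * B) x ∧ E.indicator (fun _ => 2 * B) x ≤ 2 * B :=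
      fun x => by
        by_cases hx : x ∈ E
        · rw [indicator_of_mem hx]; constructor <;> linarith
        · rw [indicator_of_notMem hx]; constructor <;> linarith
    have hf0 : ∀ x, 0 ≤ f x := fun x => by
      have := (hind x).1; simp only [hf]; linarith
    have hfB : ∀ x, |f x| ≤ l + 2 * B := fun x => by
      rw [abs_of_nonneg (hf0 x)]
      have := (hind x).2; simp only [hf]; linarith
    have hmax := maximal_ergodic hT hfm hfB hf0 δ
    have hfint : ∫ x, f x ∂μ ≤ δ * ε := by
      have i1 : Integrable (E.indicator fun _ => 2 * B) μ := (integrable_const _).indicator hEm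
      simp only [hf]
      rw [integral_add (integrable_const _) i1, integral_indicator hEm]
      simp
      rw [hl] at hE2 ⊢
      linarith
    have hmain : ∀ k ≤ K, ∀ y, r k ((Tmap p)^[K] y) ≤ f ((Tmap p)^[k] y) := by
      intro k hk y
      have e1 : (Tmap p)^[K] y = (Tmap p)^[K-k] ((Tmap p)^[k] y) := by
        rw [← Function.iterate_add_apply]; congr 1; omega
      by_cases hz : (Tmap p)^[k] y ∈ E
      · simp only [hf]
        rw [indicator_of_mem hz]
        have := hr2 k ((Tmap p)^[K] y)
        linarith
      · have := (hind ((Tmap p)^[k] y)).1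
        suffices hs : r k ((Tmap p)^[K] y) ≤ l by simp only [hf]; linarith
        simp only [hr]
        split_ifs with hDk
        · rw [e1]
          by_contra hcon
          apply hz
          refine ⟨k - D, by omega, ?_⟩
          simp only [hW]
          rw [show min (D + (k - D)) K = k by omega, show min (D+0) K = D by omega]
          rw [← Function.iterate_add_apply _ (k-D) (K-k), show k - D + (K - k) = K - D by omega] at hcon
          exact (not_le.1 hcon).le
        · exact hlpos.le
    have hAm : MeasurableSet {x | ∃ N ≤ K, δ * (N:ℕ) < ∑ k ∈ Finset.range N, r k x} := by
      have : {x | ∃ N ≤ K, δ * (N:ℕ) < ∑ k ∈ Finset.range N, r k x} =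
          ⋃ N ∈ Finset.range (K+1), {x | δ * (N:ℕ) < ∑ k ∈ Finset.range N, r k x} := by
        ext x; simp [Nat.lt_succ_iff]
      rw [this]
      exact Finset.measurableSet_biUnion _ fun j _ =>
        measurableSet_lt measurable_const (Finset.measurable_sum _ fun i _ => hrm i)
    have hpre := (hT.iterate K).measureReal_preimage hAm.nullMeasurableSet
    rw [← hpre]
    have hsub : (Tmap p)^[K] ⁻¹' {x | ∃ N ≤ K, δ * (N:ℕ) < ∑ k ∈ Finset.range N, r k x} ⊆
        {x | ∃ N : ℕ, δ * N < ∑ i ∈ Finset.range N, f ((Tmap p)^[i] x)} := by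
      rintro y ⟨N, hN, hy⟩
      refine ⟨N, hy.trans_le (Finset.sum_le_sum fun k hk => hmain k ?_ y)⟩
      have := Finset.mem_range.1 hk
      omega
    have h3 := measureReal_mono (μ := μ) hsub
    have h4 : δ * μ.real {x | ∃ N : ℕ, δ * N < ∑ i ∈ Finset.range N, f ((Tmap p)^[i] x)} ≤ δ * ε :=
      hmax.trans hfint
    exact h3.trans (le_of_mul_le_mul_left h4 hδ)
  have hun : {x | ∃ N : ℕ, δ * N < ∑ k ∈ Finset.range N, r k x} =
      ⋃ K, {x | ∃ N ≤ K, δ * (N:ℕ) < ∑ k ∈ Finset.range N, r k x} := by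
    ext x
    simp only [mem_ofPred_eq, mem_iUnion]
    constructor
    · rintro ⟨N, hN⟩; exact ⟨N, N, le_rfl, hN⟩
    · rintro ⟨K, N, -, hN⟩; exact ⟨N, hN⟩
  have hmono : Monotone fun K => {x | ∃ N ≤ K, δ * (N:ℕ) < ∑ k ∈ Finset.range N, r k x} := by
    rintro K K' hKK x ⟨N, hN, hx⟩
    exact ⟨N, hN.trans hKK, hx⟩
  have ht := tendsto_measure_iUnion_atTop (μ := μ) hmono
  rw [← hun] at ht
  have ht' := (ENNReal.tendsto_toReal (measure_ne_top μ _)).comp ht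
  exact le_of_tendsto ht' (eventually_atTop.2 ⟨D, fun K hKD => hK K hKD⟩)

end VV


section Decay

variable (μ : Measure ℝ) [IsProbabilityMeasure μ]

lemma tsum_cell_measure (p k : ℕ) : ∑' c : ℤ, μ {y | cidx p k y = c} = 1 := by
  rw [← measure_iUnion]
  · have : (⋃ c : ℤ, {y | cidx p k y = c}) = univ := by ext y; simp
    rw [this, measure_univ]
  · intro a b hab
    refine Set.disjoint_left.2 fun y hy hy' => hab ?_
    exact (hy : cidx p k y = a).symm.trans hy'
  · intro c; exact cidx_measurable p k (MeasurableSet.singleton _)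

lemma cell_decay {p : ℕ} (hp : 2 ≤ p) (hdim : 0 < measureDim μ) :
    ∃ η : ℝ, 0 < η ∧ ∀ᵐ x ∂μ, ∀ᶠ N : ℕ in atTop, μ.real (cell p N x) < (p:ℝ) ^ (-(η * N)) := by
  obtain ⟨s, hs0, hsd⟩ := ENNReal.lt_iff_exists_nnreal_btwn.1 hdim
  have hs0' : (0:ℝ) < s := by exact_mod_cast hs0
  have hp1 : (1:ℝ) < p := by exact_mod_cast (by omega : 1 < p)
  have hp0 : (0:ℝ) < p := by linarith
  set η : ℝ := s / 2 with hη
  set ρ : ℝ := (p:ℝ) ^ (-η) with hρ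
  have hρ0 : 0 < ρ := Real.rpow_pos_of_pos hp0 _
  have hρ1 : ρ < 1 := Real.rpow_lt_one_of_one_lt_of_neg hp1 (by linarith)
  have hρpow : ∀ N : ℕ, (p:ℝ) ^ (-(η * N)) = ρ ^ N := fun N => by
    rw [hρ, ← Real.rpow_mul_natCast hp0.le]; congr 1; ring
  refine ⟨η, by positivity, ?_⟩
  set A : Set ℝ := ⋂ n : ℕ, ⋃ N : ℕ, {x | ρ ^ (n+N) ≤ μ.real (cell p (n+N) x)} with hA
  have hAm : MeasurableSet A := MeasurableSet.iInter fun n => MeasurableSet.iUnion fun N =>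
    measurableSet_le measurable_const (real_cell_measurable μ p (n+N))
  have hA0 : μ A = 0 := by
    by_contra hne
    have h1 : measureDim μ ≤ dimH A := by
      unfold measureDim
      exact iInf₂_le_of_le A hAm (iInf_le_of_le (pos_iff_ne_zero.2 hne) le_rfl)
    have h2 : dimH A ≤ s := by
      apply dimH_le_of_hausdorffMeasure_ne_top
      let heavy : ℕ → ℤ → Prop := fun k c => ρ ^ k ≤ μ.real {y | cidx p k y = c}
      classical
      let t : ∀ n : ℕ, ℕ × ℤ → Set ℝ := fun n q =>
        if heavy (n+q.1) q.2 then {y | cidx p (n+q.1) y = q.2} else ∅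
      have hdiam : ∀ k c, Metric.ediam {y | cidx p k y = c} ≤ ENNReal.ofReal (((p:ℝ)^k)⁻¹) := by
        intro k c
        refine Metric.ediam_le fun x hx y hy => ?_
        rw [edist_dist, Real.dist_eq]
        apply ENNReal.ofReal_le_ofReal
        apply dist_le_of_mem_cell (by omega : 1 ≤ p)
        exact (hx : cidx p k x = c).trans (hy : cidx p k y = c).symm
      have key := Measure.hausdorffMeasure_le_liminf_tsum (s:ℝ) A (l := atTop)
        (fun n : ℕ => ENNReal.ofReal (((p:ℝ)^n)⁻¹)) (by
          rw [← ENNReal.ofReal_zero]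
          apply ENNReal.tendsto_ofReal
          exact tendsto_inv_atTop_zero.comp (tendsto_pow_atTop_atTop_of_one_lt hp1)) t (by
          refine Eventually.of_forall fun n q => ?_
          simp only [t]
          split_ifs
          · refine (hdiam _ _).trans (ENNReal.ofReal_le_ofReal ?_)
            apply inv_anti₀ (by positivity)
            exact pow_le_pow_right₀ hp1.le (by omega)
          · simp) (by
          refine Eventually.of_forall fun n x hx => ?_
          obtain ⟨N, hN⟩ := mem_iUnion.1 (mem_iInter.1 hx n)
          refine mem_iUnion.2 ⟨(N, cidx p (n+N) x), ?_⟩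
          have : heavy (n+N) (cidx p (n+N) x) := hN
          simp only [t]
          rw [if_pos this]
          exact rfl)
      have hterm : ∀ n : ℕ, ∑' q, Metric.ediam (t n q) ^ (s:ℝ) ≤ ∑' N : ℕ, ENNReal.ofReal (ρ ^ N) := by
        intro n
        rw [ENNReal.tsum_prod (f := fun N c => Metric.ediam (t n (N, c)) ^ (s:ℝ))]
        refine ENNReal.tsum_le_tsum fun N => ?_
        calc ∑' c, Metric.ediam (t n (N, c)) ^ (s:ℝ)
            ≤ ∑' c, ENNReal.ofReal (ρ ^ (n+N)) * μ {y | cidx p (n+N) y = c} := by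
              refine ENNReal.tsum_le_tsum fun c => ?_
              simp only [t]
              split_ifs with hh
              · have e1 : Metric.ediam {y | cidx p (n+N) y = c} ^ (s:ℝ) ≤
                    ENNReal.ofReal (((p:ℝ)^(n+N))⁻¹) ^ (s:ℝ) :=
                  ENNReal.rpow_le_rpow (hdiam _ _) hs0'.le
                refine e1.trans ?_
                rw [ENNReal.ofReal_rpow_of_pos (by positivity)]
                have e2 : (((p:ℝ)^(n+N))⁻¹) ^ (s:ℝ) = ρ ^ (n+N) * ρ ^ (n+N) := by
                  rw [← hρpow, ← Real.rpow_add hp0, ← Real.rpow_natCast, ← Real.rpow_neg hp0.le,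
                    ← Real.rpow_mul hp0.le, hη]
                  congr 1; ring
                rw [e2, ENNReal.ofReal_mul (by positivity)]
                gcongr
                rw [← ofReal_measureReal]
                exact ENNReal.ofReal_le_ofReal hh
              · rw [Metric.ediam_empty, ENNReal.zero_rpow_of_pos hs0']; exact zero_le
          _ = ENNReal.ofReal (ρ ^ (n+N)) := by
              rw [ENNReal.tsum_mul_left, tsum_cell_measure, mul_one]
          _ ≤ ENNReal.ofReal (ρ ^ N) :=
              ENNReal.ofReal_le_ofReal (pow_le_pow_of_le_one hρ0.le hρ1.le (by omega))
      have hfin : ∑' N : ℕ, ENNReal.ofReal (ρ ^ N) ≠ ∞ := by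
        rw [← ENNReal.ofReal_tsum_of_nonneg (fun N => by positivity)
          (summable_geometric_of_lt_one hρ0.le hρ1)]
        exact ENNReal.ofReal_ne_top
      refine ne_top_of_le_ne_top hfin (key.trans ?_)
      refine (liminf_le_liminf (Eventually.of_forall hterm)).trans ?_
      simp
    exact absurd (h1.trans h2) (not_le.2 hsd)
  have : ∀ᵐ x ∂μ, x ∉ A := measure_eq_zero_iff_ae_notMem.1 hA0
  filter_upwards [this] with x hx
  simp only [hA, mem_iInter, mem_iUnion, mem_ofPred_eq, not_forall, not_exists, not_le] at hx
  obtain ⟨n, hn⟩ := hx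
  refine eventually_atTop.2 ⟨n, fun N hN => ?_⟩
  obtain ⟨k, rfl⟩ := Nat.exists_eq_add_of_le hN
  rw [hρpow]
  exact hn k

end Decay


section GG

variable (μ : Measure ℝ) [IsProbabilityMeasure μ]

lemma ae_Ico {p : ℕ} (hT : MeasurePreserving (Tmap p) μ μ) : ∀ᵐ x ∂μ, x ∈ Ico (0:ℝ) 1 := by
  have h := hT.measure_preimage (measurableSet_Ico (a := (0:ℝ)) (b := 1)).compl.nullMeasurableSet
  have h1 : Tmap p ⁻¹' (Ico (0:ℝ) 1)ᶜ = ∅ := by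
    ext x
    simp only [mem_preimage, mem_compl_iff, mem_empty_iff_false, iff_false, not_not]
    exact ⟨Int.fract_nonneg _, Int.fract_lt_one _⟩
  rw [h1, measure_empty] at h
  exact mem_ae_iff.2 h.symm

/-- Indicator of the first digit being `a`. -/
noncomputable def hdig (p : ℕ) (a : ℤ) (y : ℝ) : ℝ := if cidx p 1 y = a then 1 else 0

lemma hdig_measurable (p : ℕ) (a : ℤ) : Measurable (hdig p a) :=
  Measurable.ite (cidx_measurable p 1 (MeasurableSet.singleton a)) measurable_const measurable_const

lemma hdig_le (p : ℕ) (a : ℤ) (y : ℝ) : |hdig p a y| ≤ 1 := by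
  unfold hdig; split_ifs <;> simp

/-- Relative mass of the child cell. -/
noncomputable def gg (p j : ℕ) (x : ℝ) : ℝ := μ.real (cell p (j+1) x) / μ.real (cell p j x)

lemma gg_measurable (p j : ℕ) : Measurable (gg μ p j) :=
  (real_cell_measurable μ p (j+1)).div (real_cell_measurable μ p j)

lemma gg_nonneg (p j : ℕ) (x : ℝ) : 0 ≤ gg μ p j x := by unfold gg; positivity

lemma gg_le_one {p : ℕ} (hp : 1 ≤ p) (j : ℕ) (x : ℝ) : gg μ p j x ≤ 1 :=
  div_le_one_of_le₀ (measureReal_mono (cell_subset hp (Nat.le_succ j) x)) measureReal_nonneg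

lemma gg_abs {p : ℕ} (hp : 1 ≤ p) (j : ℕ) (x : ℝ) : |gg μ p j x| ≤ 1 := by
  rw [abs_of_nonneg (gg_nonneg μ p j x)]; exact gg_le_one μ hp j x

lemma cell_succ {p : ℕ} (hp : 1 ≤ p) (j : ℕ) (x : ℝ) :
    cell p (j+1) x = cell p j x ∩ {y | cidx p 1 ((Tmap p)^[j] y) = cidx p 1 ((Tmap p)^[j] x)} := by
  rcases Nat.eq_zero_or_pos j with rfl | hj
  · ext y
    constructor
    · intro hy; exact ⟨cell_subset hp (Nat.zero_le _) x hy, hy⟩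
    · intro hy; exact hy.2
  · ext y
    have h1 := cidx_fract_add p j 1 y
    have h2 := cidx_fract_add p j 1 x
    rw [← Tmap_iterate p j hj] at h1 h2
    constructor
    · intro hy
      have h3 : cidx p j y = cidx p j x := cell_subset hp (Nat.le_succ j) x hy
      refine ⟨h3, ?_⟩
      have hy' : cidx p (j+1) y = cidx p (j+1) x := hy
      rw [h1, h2, h3] at hy'
      exact add_left_cancel hy'
    · rintro ⟨h3, h4⟩
      show cidx p (j+1) y = cidx p (j+1) x
      rw [h1, h2, (h3 : cidx p j y = cidx p j x),
        (h4 : cidx p 1 ((Tmap p)^[j] y) = cidx p 1 ((Tmap p)^[j] x))]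

lemma gg_eq {p : ℕ} (hp : 1 ≤ p) (j : ℕ) (x : ℝ) :
    gg μ p j x = VV μ p (hdig p (cidx p 1 ((Tmap p)^[j] x))) j x := by
  have hm : MeasurableSet {y | cidx p 1 ((Tmap p)^[j] y) = cidx p 1 ((Tmap p)^[j] x)} :=
    ((cidx_measurable p 1).comp (Titer_measurable p j)) (MeasurableSet.singleton _)
  have : (fun y => hdig p (cidx p 1 ((Tmap p)^[j] x)) ((Tmap p)^[j] y)) =
      {y | cidx p 1 ((Tmap p)^[j] y) = cidx p 1 ((Tmap p)^[j] x)}.indicator (fun _ => (1:ℝ)) := by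
    ext y; simp [hdig, indicator]
  rw [VV, CE, this, setIntegral_indicator hm, ← cell_succ hp, gg]
  simp
  field_simp

lemma digit_mem {p : ℕ} (hp : 1 ≤ p) {x : ℝ} (hx : x ∈ Ico (0:ℝ) 1) :
    ∃ a ∈ Finset.range p, cidx p 1 x = (a:ℤ) := by
  have hp' : (0:ℝ) < p := by exact_mod_cast hp
  have h0 : 0 ≤ cidx p 1 x := Int.floor_nonneg.2 (by have := hx.1; positivity)
  have h1 : cidx p 1 x < p := by
    rw [cidx, Int.floor_lt]; push_cast
    have := hx.2
    nlinarith
  refine ⟨(cidx p 1 x).toNat, ?_, ?_⟩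
  · rw [Finset.mem_range]; omega
  · omega

lemma Titer_Ico (p : ℕ) (j : ℕ) {x : ℝ} (hx : x ∈ Ico (0:ℝ) 1) : (Tmap p)^[j] x ∈ Ico (0:ℝ) 1 := by
  rw [Tmap_iterate' p j hx]; exact ⟨Int.fract_nonneg _, Int.fract_lt_one _⟩

lemma gg_L1 {p : ℕ} (hp : 1 ≤ p) (hT : MeasurePreserving (Tmap p) μ μ) {e : ℝ} (he : 0 < e) :
    ∃ D0, ∀ D ≥ D0, ∀ K ≥ D, ∫ x, |gg μ p K x - gg μ p D ((Tmap p)^[K-D] x)| ∂μ ≤ e := by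
  have hp' : (0:ℝ) < p := by exact_mod_cast hp
  have h1 := fun a : ℕ => VV_L1 μ hp hT (hdig_measurable p (a:ℤ)) (hdig_le p a)
    (e := e / p) (by positivity)
  choose D0 hD0 using h1
  refine ⟨(Finset.range p).sup D0, fun D hD K hK => ?_⟩
  have hDa : ∀ a ∈ Finset.range p, D0 a ≤ D := fun a ha => (Finset.le_sup ha).trans hD
  set R : ℕ → ℝ → ℝ := fun a x =>
    |VV μ p (hdig p a) K x - VV μ p (hdig p a) D ((Tmap p)^[K-D] x)| with hR
  have hRi : ∀ a, Integrable (R a) μ := fun a => by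
    refine integrable_of_bdd (B := 2) ?_ ?_
    · exact ((VV_measurable μ p _ K).sub ((VV_measurable μ p _ D).comp (Titer_measurable p _))).abs
    · intro x
      have h1 := VV_le μ p (hdig_le p a) K x
      have h2 := VV_le μ p (hdig_le p a) D ((Tmap p)^[K-D] x)
      have := abs_sub (VV μ p (hdig p a) K x) (VV μ p (hdig p a) D ((Tmap p)^[K-D] x))
      simp only [hR, abs_abs]; linarith
  calc ∫ x, |gg μ p K x - gg μ p D ((Tmap p)^[K-D] x)| ∂μ
      ≤ ∫ x, ∑ a ∈ Finset.range p, R a x ∂μ := by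
        refine integral_mono_ae ?_ (integrable_finsetSum _ fun a _ => hRi a) ?_
        · refine integrable_of_bdd (B := 2) ?_ ?_
          · exact ((gg_measurable μ p K).sub
              ((gg_measurable μ p D).comp (Titer_measurable p _))).abs
          · intro x
            have h1 := gg_abs μ hp K x
            have h2 := gg_abs μ hp D ((Tmap p)^[K-D] x)
            have := abs_sub (gg μ p K x) (gg μ p D ((Tmap p)^[K-D] x))
            simp only [abs_abs]; linarith
        · filter_upwards [ae_Ico μ hT] with x hx
          obtain ⟨a, ha, hax⟩ := digit_mem hp (Titer_Ico p K hx)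
          have e1 : gg μ p K x = VV μ p (hdig p a) K x := by rw [gg_eq μ hp, hax]
          have e2 : gg μ p D ((Tmap p)^[K-D] x) = VV μ p (hdig p a) D ((Tmap p)^[K-D] x) := by
            rw [gg_eq μ hp, ← Function.iterate_add_apply, show D + (K - D) = K by omega, hax]
          rw [e1, e2]
          exact Finset.single_le_sum (f := fun a => R a x) (fun b _ => abs_nonneg _) ha
    _ = ∑ a ∈ Finset.range p, ∫ x, R a x ∂μ := integral_finsetSum _ fun a _ => hRi a
    _ ≤ ∑ a ∈ Finset.range p, e / p :=
        Finset.sum_le_sum fun a ha => hD0 a D (hDa a ha) K hK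
    _ = e := by simp; field_simp

lemma cidx_range {p : ℕ} (hp : 1 ≤ p) (k : ℕ) {x : ℝ} (hx : x ∈ Ico (0:ℝ) 1) :
    cidx p k x ∈ Finset.Ico (0:ℤ) (p^k) := by
  have hp' : (0:ℝ) < (p:ℝ)^k := by positivity
  rw [Finset.mem_Ico]
  constructor
  · exact Int.floor_nonneg.2 (by have := hx.1; positivity)
  · rw [cidx, Int.floor_lt]; push_cast
    have := hx.2
    nlinarith

lemma ae_cell_lb {p : ℕ} (hp : 1 ≤ p) (hT : MeasurePreserving (Tmap p) μ μ) (k : ℕ) :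
    ∃ e > 0, ∀ᵐ x ∂μ, e ≤ μ.real (cell p k x) := by
  classical
  set S := (Finset.Ico (0:ℤ) (p^k)).filter fun c => 0 < μ.real {y | cidx p k y = c} with hS
  have hmem : ∀ᵐ x ∂μ, cidx p k x ∈ S := by
    filter_upwards [ae_Ico μ hT, ae_cell_pos μ p k] with x hx hx'
    exact Finset.mem_filter.2 ⟨cidx_range hp k hx, hx'⟩
  have hne : S.Nonempty := by
    obtain ⟨x, hx⟩ := hmem.exists
    exact ⟨_, hx⟩
  obtain ⟨c, hc, hmin⟩ := Finset.exists_min_image S (fun c => μ.real {y | cidx p k y = c}) hne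
  refine ⟨_, (Finset.mem_filter.1 hc).2, ?_⟩
  filter_upwards [hmem] with x hx
  exact hmin _ hx

lemma gg_lb {p : ℕ} (hp : 1 ≤ p) (hT : MeasurePreserving (Tmap p) μ μ) (j : ℕ) :
    ∃ e > 0, ∀ᵐ x ∂μ, e ≤ gg μ p j x := by
  obtain ⟨e, he, h⟩ := ae_cell_lb μ hp hT (j+1)
  refine ⟨e, he, ?_⟩
  filter_upwards [h, ae_cell_pos μ p j] with x hx hx'
  rw [gg, le_div_iff₀ hx']
  have : μ.real (cell p j x) ≤ 1 := measureReal_le_one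
  nlinarith

lemma int_inv_gg {p : ℕ} (hp : 1 ≤ p) (hT : MeasurePreserving (Tmap p) μ μ) (j : ℕ) :
    ∫ x, (gg μ p j x)⁻¹ ∂μ ≤ p := by
  obtain ⟨e, he, hlb⟩ := gg_lb μ hp hT j
  choose F hF using fun a : ℕ => CE_factor μ p j (fun y => hdig p a ((Tmap p)^[j] y))
  set Φ : ℕ → ℤ → ℝ := fun a c => (max (F a c) e)⁻¹ with hΦ
  have hmaxpos : ∀ a c, 0 < max (F a c) e := fun a c => lt_max_of_lt_right he
  have hΦb : ∀ a c, |Φ a c| ≤ e⁻¹ := fun a c => by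
    rw [abs_of_nonneg (inv_nonneg.2 (hmaxpos a c).le)]
    exact inv_anti₀ he (le_max_right _ _)
  have hm : ∀ a : ℕ, Measurable fun y => hdig p a ((Tmap p)^[j] y) := fun a =>
    (hdig_measurable p a).comp (Titer_measurable p j)
  have hΦm : ∀ a, Measurable fun x => Φ a (cidx p j x) := fun a =>
    (measurable_from_top (f := Φ a)).comp (cidx_measurable p j)
  have hterm : ∀ a : ℕ, ∫ x, Φ a (cidx p j x) * hdig p a ((Tmap p)^[j] x) ∂μ ≤ 1 := by
    intro a
    rw [← integral_mul_CE μ (hm a) (fun x => hdig_le p a _) (Φ a) (hΦb a)]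
    have hle : ∀ x, Φ a (cidx p j x) * CE μ p j (fun y => hdig p a ((Tmap p)^[j] y)) x ≤ 1 := by
      intro x
      rw [hF a]
      simp only [hΦ]
      rw [inv_mul_le_iff₀ (hmaxpos _ _), mul_one]
      exact le_max_left _ _
    have := integral_mono (μ := μ) (g := fun _ => (1:ℝ)) (integrable_of_bdd (B := e⁻¹ * 1)
      ((hΦm a).mul (CE_measurable μ p j _)) (fun x => by
        rw [Pi.mul_apply, abs_mul]
        exact mul_le_mul (hΦb _ _) (CE_le μ zero_le_one fun y _ => hdig_le p a _)
          (abs_nonneg _) (by positivity))) (integrable_const 1) hle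
    simpa using this
  have hIntg : ∀ a : ℕ, Integrable (fun x => Φ a (cidx p j x) * hdig p a ((Tmap p)^[j] x)) μ :=
    fun a => integrable_of_bdd (B := e⁻¹ * 1) ((hΦm a).mul (hm a)) fun x => by
      rw [abs_mul]
      exact mul_le_mul (hΦb _ _) (hdig_le p a _) (abs_nonneg _) (by positivity)
  calc ∫ x, (gg μ p j x)⁻¹ ∂μ
      = ∫ x, ∑ a ∈ Finset.range p, Φ a (cidx p j x) * hdig p a ((Tmap p)^[j] x) ∂μ := by
        apply integral_congr_ae
        filter_upwards [ae_Ico μ hT, hlb] with x hx hx'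
        obtain ⟨a, ha, hax⟩ := digit_mem hp (Titer_Ico p j hx)
        rw [Finset.sum_eq_single_of_mem a ha]
        · have e1 : gg μ p j x = F a (cidx p j x) := by
            rw [gg_eq μ hp, hax, VV, hF a]
          have e2 : hdig p a ((Tmap p)^[j] x) = 1 := by simp [hdig, hax]
          rw [e2, mul_one]
          simp only [hΦ]
          rw [← e1, max_eq_left hx']
        · intro b _ hb
          have : hdig p b ((Tmap p)^[j] x) = 0 := by
            rw [hdig, hax, if_neg]
            exact_mod_cast hb.symm
          rw [this, mul_zero]
    _ = ∑ a ∈ Finset.range p, ∫ x, Φ a (cidx p j x) * hdig p a ((Tmap p)^[j] x) ∂μ :=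
        integral_finsetSum _ fun a _ => hIntg a
    _ ≤ ∑ a ∈ Finset.range p, (1:ℝ) := Finset.sum_le_sum fun a _ => hterm a
    _ = p := by simp

end GG


section NonAtomic

variable (μ : Measure ℝ) [IsProbabilityMeasure μ]

lemma neg_log_le {g t : ℝ} (hg : 0 < g) (hg1 : g ≤ 1) (ht : 0 < t) :
    -Real.log g ≤ (1 - g) / t + t * g⁻¹ := by
  have hs : 0 < √g := Real.sqrt_pos.2 hg
  have hsq : √g * √g = g := Real.mul_self_sqrt hg.le
  have hs1 : √g ≤ 1 := Real.sqrt_le_one.2 hg1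
  have h1 : -Real.log g = 2 * Real.log ((√g)⁻¹) := by
    rw [Real.log_inv, Real.log_sqrt hg.le]; ring
  have h2 : Real.log ((√g)⁻¹) ≤ (√g)⁻¹ - 1 := Real.log_le_sub_one_of_pos (by positivity)
  set u := (√g)⁻¹ with hu
  have hug : g⁻¹ = u * u := by rw [hu, ← mul_inv, hsq]
  have husg : u * √g = 1 := inv_mul_cancel₀ hs.ne'
  have hu0 : 0 < u := by positivity
  have h3 : u - 1 ≤ (1 - g) * u := by nlinarith
  have h4 : 2 * ((1 - g) * u) ≤ (1 - g) / t + t * (u * u) := by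
    have h5 : 2 * ((1-g) * u) ≤ (1-g)^2 / t + t * (u*u) := by
      have : (1-g)^2 / t + t * (u*u) - 2 * ((1-g)*u) = ((1-g) - t * u)^2 / t := by
        field_simp; ring
      have h6 : 0 ≤ ((1-g) - t * u)^2 / t := by positivity
      linarith
    have h7 : (1-g)^2 / t ≤ (1-g)/t := by
      apply div_le_div_of_nonneg_right _ ht.le
      nlinarith
    linarith
  rw [h1, hug]; linarith

lemma gg_inv_int {p : ℕ} (hp : 1 ≤ p) (hT : MeasurePreserving (Tmap p) μ μ) (j : ℕ) :
    Integrable (fun x => (gg μ p j x)⁻¹) μ := by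
  obtain ⟨e, he, hlb⟩ := gg_lb μ hp hT j
  refine Integrable.of_bound (gg_measurable μ p j).inv.aestronglyMeasurable e⁻¹ ?_
  filter_upwards [hlb] with x hx
  rw [Real.norm_eq_abs, abs_of_nonneg (inv_nonneg.2 (gg_nonneg μ p j x))]
  exact inv_anti₀ he hx

lemma log_gg_int {p : ℕ} (hp : 1 ≤ p) (hT : MeasurePreserving (Tmap p) μ μ) (j : ℕ) :
    Integrable (fun x => -Real.log (gg μ p j x)) μ := by
  obtain ⟨e, he, hlb⟩ := gg_lb μ hp hT j
  refine Integrable.of_bound (gg_measurable μ p j).log.neg.aestronglyMeasurable (-Real.log e) ?_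
  filter_upwards [hlb] with x hx
  have h1 := Real.log_nonpos (gg_nonneg μ p j x) (gg_le_one μ hp j x)
  rw [Real.norm_eq_abs, abs_of_nonneg (by linarith)]
  have := Real.log_le_log he hx
  linarith

lemma int_log_gg {p : ℕ} (hp : 1 ≤ p) (hT : MeasurePreserving (Tmap p) μ μ) (j : ℕ) {t : ℝ}
    (ht : 0 < t) : ∫ x, -Real.log (gg μ p j x) ∂μ ≤ (1 - ∫ x, gg μ p j x ∂μ) / t + t * p := by
  have ig : Integrable (gg μ p j) μ := integrable_of_bdd (gg_measurable μ p j) (gg_abs μ hp j)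
  have ii := gg_inv_int μ hp hT j
  have i1 : Integrable (fun x => (1 - gg μ p j x) / t) μ := ((integrable_const 1).sub ig).div_const t
  obtain ⟨e, he, hlb⟩ := gg_lb μ hp hT j
  have h1 : ∫ x, -Real.log (gg μ p j x) ∂μ ≤ ∫ x, ((1 - gg μ p j x) / t + t * (gg μ p j x)⁻¹) ∂μ := by
    refine integral_mono_ae (log_gg_int μ hp hT j) (i1.add (ii.const_mul t)) ?_
    filter_upwards [hlb] with x hx
    exact neg_log_le (he.trans_le hx) (gg_le_one μ hp j x) ht
  refine h1.trans ?_
  rw [integral_add i1 (ii.const_mul t), integral_const_mul, integral_div,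
    integral_sub (integrable_const 1) ig]
  have := int_inv_gg μ hp hT j
  simp only [integral_const, probReal_univ, smul_eq_mul, mul_one]
  gcongr

lemma sum_log_gg {p : ℕ} (hp : 1 ≤ p) (hT : MeasurePreserving (Tmap p) μ μ) :
    ∀ᵐ x ∂μ, ∀ N, ∑ j ∈ Finset.range N, -Real.log (gg μ p j x) = -Real.log (μ.real (cell p N x)) := by
  have hpos : ∀ᵐ x ∂μ, ∀ k, 0 < μ.real (cell p k x) := ae_all_iff.2 fun k => ae_cell_pos μ p k
  have h0 : μ (Ico (0:ℝ) 1) = 1 := by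
    have := ae_Ico μ hT
    rw [← prob_compl_eq_zero_iff measurableSet_Ico]
    exact mem_ae_iff.1 this
  filter_upwards [hpos, ae_Ico μ hT] with x hx hx'
  intro N
  induction N with
  | zero =>
    have : cell p 0 x = Ico (0:ℝ) 1 := by
      ext y
      have hf : ⌊x⌋ = 0 := Int.floor_eq_zero_iff.2 hx'
      simp only [cell, cidx, pow_zero, one_mul, hf, mem_ofPred_eq, Int.floor_eq_zero_iff]
    rw [this, Measure.real, h0]; simp
  | succ N ih =>
    rw [Finset.sum_range_succ, ih, gg, Real.log_div (hx _).ne' (hx _).ne']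
    ring

lemma gg_not_one {p : ℕ} (hp : 2 ≤ p) (hT : MeasurePreserving (Tmap p) μ μ)
    (hdim : 0 < measureDim μ) :
    ¬ Tendsto (fun j => ∫ x, gg μ p j x ∂μ) atTop (𝓝 1) := by
  intro hlim
  have hp1 : 1 ≤ p := by omega
  obtain ⟨η, hη, hdec⟩ := cell_decay μ hp hdim
  have hlogp : 0 < Real.log p := Real.log_pos (by exact_mod_cast (by omega : 1 < p))
  have hp0 : (0:ℝ) < p := by positivity
  set L : ℕ → ℝ := fun j => ∫ x, -Real.log (gg μ p j x) ∂μ with hL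
  have hL0 : ∀ j, 0 ≤ L j := fun j => integral_nonneg fun x => by
    have h1 := Real.log_nonpos (gg_nonneg μ p j x) (gg_le_one μ hp1 j x)
    simpa using h1
  have hLlim : Tendsto L atTop (𝓝 0) := by
    rw [Metric.tendsto_atTop]
    intro e he
    set t := e / (4 * p) with ht
    have htp : 0 < t := by positivity
    obtain ⟨J, hJ⟩ := (Metric.tendsto_atTop.1 hlim) (t * (e/4)) (by positivity)
    refine ⟨J, fun j hj => ?_⟩
    have h1 := hJ j hj
    rw [Real.dist_eq, abs_lt] at h1
    have h2 := int_log_gg μ hp1 hT j htp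
    have h3 : (1 - ∫ x, gg μ p j x ∂μ) / t ≤ e / 4 := by
      rw [div_le_iff₀ htp]; linarith
    have h4 : t * p = e / 4 := by rw [ht]; field_simp
    rw [Real.dist_eq, sub_zero, abs_of_nonneg (hL0 j)]
    simp only [hL]
    linarith
  have hces := hLlim.cesaro
  set A : ℕ → Set ℝ := fun N => {x | η * N * Real.log p ≤ -Real.log (μ.real (cell p N x))} with hA
  have hAm : ∀ N, MeasurableSet (A N) := fun N =>
    measurableSet_le measurable_const (real_cell_measurable μ p N).log.neg
  have hAle : ∀ N, η * N * Real.log p * μ.real (A N) ≤ ∑ j ∈ Finset.range N, L j := by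
    intro N
    have hi : Integrable (fun x => -Real.log (μ.real (cell p N x))) μ := by
      refine (integrable_finsetSum (Finset.range N) fun j _ => log_gg_int μ hp1 hT j).congr ?_
      filter_upwards [sum_log_gg μ hp1 hT] with x hx
      exact hx N
    have h1 := mul_meas_ge_le_integral_of_nonneg (μ := μ) (Eventually.of_forall fun x => by
      have := Real.log_nonpos (measureReal_nonneg (μ := μ) (s := cell p N x)) measureReal_le_one
      simpa using this) hi (η * N * Real.log p)
    refine h1.trans (le_of_eq ?_)
    rw [← integral_finsetSum (Finset.range N) fun j _ => log_gg_int μ hp1 hT j]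
    apply integral_congr_ae
    filter_upwards [sum_log_gg μ hp1 hT] with x hx
    exact (hx N).symm
  have hA0 : Tendsto (fun N => μ.real (A N)) atTop (𝓝 0) := by
    have h2 := (hces.const_mul ((η * Real.log p)⁻¹))
    rw [mul_zero] at h2
    refine tendsto_of_tendsto_of_tendsto_of_le_of_le' tendsto_const_nhds h2
      (Eventually.of_forall fun N => measureReal_nonneg) ?_
    filter_upwards [eventually_gt_atTop 0] with N hN
    have hN' : (0:ℝ) < N := by exact_mod_cast hN
    have := hAle N
    rw [le_inv_mul_iff₀ (by positivity), le_inv_mul_iff₀ hN']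
    linarith
  have hA1 : Tendsto (fun N => ∫ x, (A N).indicator (fun _ => (1:ℝ)) x ∂μ) atTop
      (𝓝 (∫ x, (1:ℝ) ∂μ)) := by
    refine tendsto_integral_of_dominated_convergence (fun _ => (1:ℝ))
      (fun N => (measurable_const.indicator (hAm N)).aestronglyMeasurable) (integrable_const 1)
      (fun N => Eventually.of_forall fun x => ?_) ?_
    · by_cases hx : x ∈ A N
      · simp [indicator_of_mem hx]
      · simp [indicator_of_notMem hx]
    · filter_upwards [hdec, ae_all_iff.2 fun k => ae_cell_pos μ p k] with x hx hx'
      refine tendsto_const_nhds.congr' ?_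
      filter_upwards [hx] with N hN
      have : x ∈ A N := by
        have h3 := Real.log_lt_log (hx' N) hN
        rw [Real.log_rpow hp0] at h3
        show η * N * Real.log p ≤ -Real.log (μ.real (cell p N x))
        linarith
      rw [indicator_of_mem this]
  have h5 : ∀ N, ∫ x, (A N).indicator (fun _ => (1:ℝ)) x ∂μ = μ.real (A N) := fun N => by
    rw [integral_indicator (hAm N)]; simp
  simp_rw [h5] at hA1
  have := tendsto_nhds_unique hA0 hA1
  simp at this

/-- Non-atomicity of the conditional measures, uniformly. -/
lemma nonatomic {p : ℕ} (hp : 2 ≤ p) (hT : Ergodic (Tmap p) μ)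
    (hdim : 0 < measureDim μ) {ε : ℝ} (hε : 0 < ε) :
    ∃ n D0 : ℕ, ∀ D ≥ D0,
      ∫ x, μ.real (cell p (D+n) x) / μ.real (cell p D x) ∂μ ≤ ε := by
  have hp1 : 1 ≤ p := by omega
  have hmp := hT.toMeasurePreserving
  have hnot := gg_not_one μ hp hmp hdim
  have ig : ∀ j, Integrable (gg μ p j) μ := fun j =>
    integrable_of_bdd (gg_measurable μ p j) (gg_abs μ hp1 j)
  have hle1 : ∀ j, ∫ x, gg μ p j x ∂μ ≤ 1 := fun j => by
    have := integral_mono (ig j) (integrable_const (1:ℝ)) (gg_le_one μ hp1 j)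
    simpa using this
  obtain ⟨θ, hθ, hfreq⟩ : ∃ θ > 0, ∀ J, ∃ j ≥ J, ∫ x, gg μ p j x ∂μ ≤ 1 - 2 * θ := by
    by_contra hcon
    push Not at hcon
    apply hnot
    rw [Metric.tendsto_atTop]
    intro e he
    obtain ⟨J, hJ⟩ := hcon (e/2) (by positivity)
    refine ⟨J, fun j hj => ?_⟩
    have h1 := hJ j hj
    have h2 := hle1 j
    rw [Real.dist_eq, abs_lt]; constructor <;> linarith
  have hθ1 : θ ≤ 1 / 2 := by
    obtain ⟨j, -, hj⟩ := hfreq 0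
    have : 0 ≤ ∫ x, gg μ p j x ∂μ := integral_nonneg (gg_nonneg μ p j)
    linarith
  set e := ε * θ / 4 with he
  have hepos : 0 < e := by positivity
  obtain ⟨J, hJ⟩ := gg_L1 μ hp1 hmp hepos
  obtain ⟨D0, hD0, hD0g⟩ := hfreq J
  have hme := mean_ergodic_L1 hT (gg_measurable μ p D0) (gg_abs μ hp1 D0)
  have hpow : Tendsto (fun n : ℕ => (1 - θ) ^ n) atTop (𝓝 0) :=
    tendsto_pow_atTop_nhds_zero_of_lt_one (by linarith) (by linarith)
  obtain ⟨n, hn1, hn2, hn0⟩ := ((hme.eventually (gt_mem_nhds hepos)).and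
    ((hpow.eventually (gt_mem_nhds (half_pos hε))).and (eventually_gt_atTop 0))).exists
  refine ⟨n, D0, fun D hD => ?_⟩
  have hn0' : (0:ℝ) < n := by exact_mod_cast hn0
  set I := ∫ x, gg μ p D0 x ∂μ with hI
  set av : ℝ → ℝ := fun x => (1 / n : ℝ) * ∑ i ∈ Finset.range n, gg μ p (D+i) x with hav
  set aw : ℝ → ℝ := fun x => (1 / n : ℝ) * ∑ i ∈ Finset.range n, gg μ p D0 ((Tmap p)^[i] x) with haw
  have havm : Measurable av := (Finset.measurable_sum _ fun i _ => gg_measurable μ p _).const_mul _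
  have hawm : Measurable aw := (Finset.measurable_sum _ fun i _ =>
    (gg_measurable μ p _).comp (Titer_measurable p i)).const_mul _
  have hav0 : ∀ x, 0 ≤ av x := fun x => by
    have : 0 ≤ ∑ i ∈ Finset.range n, gg μ p (D+i) x := Finset.sum_nonneg fun i _ => gg_nonneg μ p _ x
    simp only [hav]; positivity
  have hsum1 : ∀ u : ℕ → ℝ, (∀ i, u i ≤ 1) → (1 / n : ℝ) * ∑ i ∈ Finset.range n, u i ≤ 1 := by
    intro u hu
    have : ∑ i ∈ Finset.range n, u i ≤ ∑ i ∈ Finset.range n, (1:ℝ) := Finset.sum_le_sum fun i _ => hu i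
    simp at this
    rw [one_div, inv_mul_le_iff₀ hn0']; linarith
  have hav1 : ∀ x, av x ≤ 1 := fun x => hsum1 _ fun i => gg_le_one μ hp1 _ x
  have haw1 : ∀ x, aw x ≤ 1 := fun x => hsum1 _ fun i => gg_le_one μ hp1 _ _
  have haw0 : ∀ x, 0 ≤ aw x := fun x => by
    have : 0 ≤ ∑ i ∈ Finset.range n, gg μ p D0 ((Tmap p)^[i] x) :=
      Finset.sum_nonneg fun i _ => gg_nonneg μ p _ _
    simp only [haw]; positivity
  have iav : Integrable av μ := integrable_of_bdd havm (B := 1) fun x => by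
    rw [abs_of_nonneg (hav0 x)]; exact hav1 x
  have hS := hmp.iterate (D - D0)
  have iaw : Integrable aw μ := integrable_of_bdd hawm (B := 1) fun x => by
    rw [abs_of_nonneg (haw0 x)]; exact haw1 x
  have iaws : Integrable (fun x => aw ((Tmap p)^[D-D0] x)) μ := hS.integrable_comp_of_integrable iaw
  have hc1 : ∫ x, |aw ((Tmap p)^[D-D0] x) - I| ∂μ ≤ e := by
    have := integral_map (μ := μ) hS.aemeasurable (f := fun x => |aw x - I|)
      ((hawm.sub_const I).abs).aestronglyMeasurable
    rw [hS.map_eq] at this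
    rw [← this]
    exact hn1.le
  have hgi : ∀ i, Integrable (fun x => |gg μ p (D+i) x - gg μ p D0 ((Tmap p)^[D+i-D0] x)|) μ :=
    fun i => ((ig _).sub ((hmp.iterate (D+i-D0)).integrable_comp_of_integrable (ig D0))).abs
  have hc2 : ∫ x, |av x - aw ((Tmap p)^[D-D0] x)| ∂μ ≤ e := by
    calc ∫ x, |av x - aw ((Tmap p)^[D-D0] x)| ∂μ
        ≤ ∫ x, (1 / n : ℝ) * ∑ i ∈ Finset.range n,
            |gg μ p (D+i) x - gg μ p D0 ((Tmap p)^[D+i-D0] x)| ∂μ := by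
          refine integral_mono (iav.sub iaws).abs
            ((integrable_finsetSum _ fun i _ => hgi i).const_mul _) fun x => ?_
          simp only [hav, haw]
          rw [← mul_sub, ← Finset.sum_sub_distrib, abs_mul, abs_of_pos (by positivity)]
          refine mul_le_mul_of_nonneg_left ((Finset.abs_sum_le_sum_abs _ _).trans (le_of_eq ?_))
            (by positivity)
          refine Finset.sum_congr rfl fun i _ => ?_
          rw [← Function.iterate_add_apply, show i + (D - D0) = D + i - D0 by omega]
      _ = (1 / n : ℝ) * ∑ i ∈ Finset.range n,
            ∫ x, |gg μ p (D+i) x - gg μ p D0 ((Tmap p)^[D+i-D0] x)| ∂μ := by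
          rw [integral_const_mul, integral_finsetSum _ fun i _ => hgi i]
      _ ≤ (1 / n : ℝ) * ∑ i ∈ Finset.range n, e := by
          gcongr with i hi
          exact hJ D0 hD0 (D+i) (by omega)
      _ = e := by simp; field_simp
  have hc3 : ∫ x, |av x - I| ∂μ ≤ 2 * e := by
    have : ∫ x, |av x - I| ∂μ ≤ ∫ x, (|av x - aw ((Tmap p)^[D-D0] x)| +
        |aw ((Tmap p)^[D-D0] x) - I|) ∂μ := by
      refine integral_mono (iav.sub (integrable_const I)).abs
        ((iav.sub iaws).abs.add (iaws.sub (integrable_const I)).abs) fun x => ?_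
      exact abs_sub_le _ _ _
    have h' := integral_add (iav.sub iaws).abs (iaws.sub (integrable_const I)).abs
    simp only [Pi.sub_apply] at h'
    rw [h'] at this
    linarith
  have hprod : ∀ᵐ x ∂μ, μ.real (cell p (D+n) x) / μ.real (cell p D x) =
      ∏ i ∈ Finset.range n, gg μ p (D+i) x := by
    filter_upwards [ae_all_iff.2 fun k => ae_cell_pos μ p k] with x hx
    clear hn1 hn2 hn0 hn0'
    have : ∀ k, ∏ i ∈ Finset.range k, gg μ p (D+i) x =
        μ.real (cell p (D+k) x) / μ.real (cell p D x) := by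
      intro k
      induction k with
      | zero => simp [(hx D).ne']
      | succ k ih =>
        rw [Finset.prod_range_succ, ih, gg]
        have := (hx (D+k)).ne'
        have := (hx D).ne'
        rw [show D + (k+1) = D + k + 1 by ring]
        field_simp
    exact (this n).symm
  have hbound : ∀ᵐ x ∂μ, μ.real (cell p (D+n) x) / μ.real (cell p D x) ≤
      (1 - θ) ^ n + |av x - I| / θ := by
    filter_upwards [hprod] with x hx
    rw [hx]
    have hamgm : ∏ i ∈ Finset.range n, gg μ p (D+i) x ≤ av x ^ n := by
      have h1 := Real.geom_mean_le_arith_mean_weighted (Finset.range n) (fun _ => (1 / n : ℝ))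
        (fun i => gg μ p (D+i) x) (fun _ _ => by positivity) (by simp; field_simp)
        (fun i _ => gg_nonneg μ p _ x)
      rw [Real.finsetProd_rpow _ _ (fun i _ => gg_nonneg μ p _ x), ← Finset.mul_sum] at h1
      have h2 : 0 ≤ ∏ i ∈ Finset.range n, gg μ p (D+i) x :=
        Finset.prod_nonneg fun i _ => gg_nonneg μ p _ x
      have h3 := pow_le_pow_left₀ (Real.rpow_nonneg h2 _) h1 n
      rwa [one_div, Real.rpow_inv_natCast_pow h2 hn0.ne', ← one_div] at h3
    refine hamgm.trans ?_
    have habs := abs_nonneg (av x - I)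
    by_cases hx1 : av x ≤ 1 - θ
    · have := pow_le_pow_left₀ (hav0 x) hx1 n
      have : 0 ≤ |av x - I| / θ := by positivity
      linarith
    · have h1 : av x ^ n ≤ 1 := pow_le_one₀ (hav0 x) (hav1 x)
      have h2 : 1 ≤ |av x - I| / θ := by
        rw [le_div_iff₀ hθ]
        have := le_abs_self (av x - I)
        linarith
      have h3 : 0 ≤ (1 - θ) ^ n := pow_nonneg (by linarith) n
      linarith
  have iabs : Integrable (fun x => |av x - I| / θ) μ :=
    (iav.sub (integrable_const I)).abs.div_const θ
  have hfin := integral_mono_of_nonneg (Eventually.of_forall fun x => by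
      show (0:ℝ) ≤ μ.real (cell p (D+n) x) / μ.real (cell p D x); positivity)
    ((integrable_const ((1-θ)^n)).add iabs) hbound
  refine hfin.trans ?_
  rw [integral_add' (integrable_const _) iabs, integral_div]
  simp only [integral_const, probReal_univ, smul_eq_mul, one_mul]
  have h10 : (∫ x, |av x - I| ∂μ) / θ ≤ ε / 2 := by
    rw [div_le_iff₀ hθ]
    rw [he] at hc3; linarith
  linarith

end NonAtomic


section VdC

/-- Lebesgue measure on `[0,1)`. -/
noncomputable abbrev lam : Measure ℝ := volume.restrict (Ico (0:ℝ) 1)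

instance lam_prob : IsProbabilityMeasure lam := ⟨by simp [lam]⟩

lemma vdc {p : ℝ} (hp : 1 < p) {w : ℝ} (hw : w ≠ 0) :
    |∫ t, Real.cos (w * p ^ t) ∂lam| ≤ (2 / Real.log p + 1) / |w| := by
  have hp0 : 0 < p := by linarith
  set L := Real.log p with hL
  have hLpos : 0 < L := Real.log_pos hp
  have hpt : ∀ t : ℝ, 0 < p ^ t := fun t => Real.rpow_pos_of_pos hp0 t
  have hder : ∀ t : ℝ, HasDerivAt (fun t : ℝ => Real.sin (w * p ^ t) / (w * L * p ^ t))
      (Real.cos (w * p ^ t) - Real.sin (w * p ^ t) / (w * p ^ t)) t := by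
    intro t
    have h1 : HasDerivAt (fun t : ℝ => p ^ t) (p ^ t * L) t := by
      simpa [mul_comm] using (Real.hasStrictDerivAt_const_rpow hp0 t).hasDerivAt
    have h2 := (h1.const_mul w).sin
    have h3 := h1.const_mul (w * L)
    have h4 := h2.div h3 (by have := (hpt t).ne'; positivity)
    have e : (Real.cos (w * p ^ t) * (w * (p ^ t * L)) * (w * L * p ^ t) -
        Real.sin (w * p ^ t) * (w * L * (p ^ t * L))) / (w * L * p ^ t) ^ 2 =
        Real.cos (w * p ^ t) - Real.sin (w * p ^ t) / (w * p ^ t) := by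
      have h5 := (hpt t).ne'
      have h6 := hLpos.ne'
      generalize Real.cos (w * p ^ t) = A
      generalize Real.sin (w * p ^ t) = B
      generalize p ^ t = P at *
      field_simp
    rw [← e]
    exact h4
  have hcpt : Continuous fun t : ℝ => p ^ t := Real.continuous_const_rpow hp0.ne'
  have hc1 : Continuous fun t : ℝ => Real.cos (w * p ^ t) := by fun_prop
  have hc2 : Continuous fun t : ℝ => Real.sin (w * p ^ t) / (w * p ^ t) := by
    refine Continuous.div (by fun_prop) (by fun_prop) fun t => ?_
    have := (hpt t).ne'; positivity
  have hftc := intervalIntegral.integral_eq_sub_of_hasDerivAt (a := 0) (b := 1)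
    (fun t _ => hder t) ((hc1.sub hc2).intervalIntegrable 0 1)
  rw [intervalIntegral.integral_sub (hc1.intervalIntegrable 0 1) (hc2.intervalIntegrable 0 1)] at hftc
  have hconv : ∫ t, Real.cos (w * p ^ t) ∂lam = ∫ t in (0:ℝ)..1, Real.cos (w * p ^ t) := by
    rw [intervalIntegral.integral_of_le zero_le_one, lam, integral_Ico_eq_integral_Ioo,
      integral_Ioc_eq_integral_Ioo]
  have hw0 : 0 < |w| := abs_pos.2 hw
  have hb : |∫ t in (0:ℝ)..1, Real.sin (w * p ^ t) / (w * p ^ t)| ≤ 1 / |w| * |1 - 0| := by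
    rw [← Real.norm_eq_abs]
    refine intervalIntegral.norm_integral_le_of_norm_le_const (a := 0) (b := 1) (C := 1 / |w|)
      (f := fun t : ℝ => Real.sin (w * p ^ t) / (w * p ^ t)) ?_
    intro t ht
    rw [uIoc_of_le zero_le_one] at ht
    rw [Real.norm_eq_abs, abs_div, abs_mul, abs_of_pos (hpt t)]
    have h1 : 1 ≤ p ^ t := Real.one_le_rpow hp.le ht.1.le
    apply div_le_div₀ zero_le_one (Real.abs_sin_le_one _) hw0
    nlinarith
  have hend : ∀ t : ℝ, 0 ≤ t → |Real.sin (w * p ^ t) / (w * L * p ^ t)| ≤ 1 / (|w| * L) := by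
    intro t ht
    rw [abs_div, abs_mul, abs_mul, abs_of_pos (hpt t), abs_of_pos hLpos]
    have h1 : 1 ≤ p ^ t := Real.one_le_rpow hp.le ht
    apply div_le_div₀ zero_le_one (Real.abs_sin_le_one _) (by positivity)
    have : 0 < |w| * L := by positivity
    nlinarith
  have e0 := abs_le.1 (hend 0 le_rfl)
  have e1 := abs_le.1 (hend 1 zero_le_one)
  have hb' := abs_le.1 hb
  simp only [sub_zero, abs_one, mul_one] at hb'
  have hR : (2 / L + 1) / |w| = 2 * (1 / (|w| * L)) + 1 / |w| := by field_simp
  rw [hconv, hR, abs_le]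
  constructor <;> linarith

lemma sq_le_double {Ω : Type*} [MeasurableSpace Ω] {ν : Measure Ω} [IsFiniteMeasure ν]
    {u : Ω → ℝ} (hu : Measurable u) (s φ : ℝ) :
    (∫ y, Real.cos (s * u y + φ) ∂ν) ^ 2 ≤
      ∫ z, Real.cos (s * (u z.1 - u z.2)) ∂(ν.prod ν) := by
  have h1 := integral_prod_mul (μ := ν) (ν := ν) (fun y => Real.cos (s * u y + φ))
    (fun y => Real.cos (s * u y + φ))
  have h2 := integral_prod_mul (μ := ν) (ν := ν) (fun y => Real.sin (s * u y + φ))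
    (fun y => Real.sin (s * u y + φ))
  have b : ∀ {a b : ℝ}, |a| ≤ 1 → |b| ≤ 1 → |a * b| ≤ 1 := fun ha hb => by
    rw [abs_mul]; exact mul_le_one₀ ha (abs_nonneg _) hb
  have i1 : Integrable (fun z : Ω × Ω => Real.cos (s * u z.1 + φ) * Real.cos (s * u z.2 + φ))
      (ν.prod ν) := integrable_of_bdd (by fun_prop) fun z =>
        b (Real.abs_cos_le_one _) (Real.abs_cos_le_one _)
  have i2 : Integrable (fun z : Ω × Ω => Real.sin (s * u z.1 + φ) * Real.sin (s * u z.2 + φ))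
      (ν.prod ν) := integrable_of_bdd (by fun_prop) fun z =>
        b (Real.abs_sin_le_one _) (Real.abs_sin_le_one _)
  have e : ∀ z : Ω × Ω, Real.cos (s * (u z.1 - u z.2)) =
      Real.cos (s * u z.1 + φ) * Real.cos (s * u z.2 + φ) +
        Real.sin (s * u z.1 + φ) * Real.sin (s * u z.2 + φ) := fun z => by
    rw [← Real.cos_sub]; congr 1; ring
  simp_rw [e]
  rw [integral_add i1 i2, h1, h2]
  nlinarith [sq_nonneg (∫ y, Real.sin (s * u y + φ) ∂ν)]

lemma int_t_sq_le {Ω : Type*} [MeasurableSpace Ω] {ν : Measure Ω} [IsFiniteMeasure ν]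
    {u : Ω → ℝ} (hu : Measurable u) {p : ℝ} (hp : 1 < p) {κ r : ℝ} (hκ : κ ≠ 0) (hr : 0 < r)
    (φ : ℝ) :
    ∫ t, (∫ y, Real.cos (κ * p ^ t * u y + φ) ∂ν) ^ 2 ∂lam ≤
      (2 / Real.log p + 1) / (|κ| * r) * ν.real univ ^ 2 +
        (ν.prod ν).real {z | |u z.1 - u z.2| < r} := by
  have hp0 : 0 < p := by linarith
  have hLpos : 0 < Real.log p := Real.log_pos hp
  have hcpt : Continuous fun t : ℝ => p ^ t := Real.continuous_const_rpow hp0.ne'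
  have hptm : Measurable fun t : ℝ => p ^ t := hcpt.measurable
  have hjm : Measurable (Function.uncurry fun (t : ℝ) (z : Ω × Ω) =>
      Real.cos (κ * p ^ t * (u z.1 - u z.2))) := by
    unfold Function.uncurry
    have h1 : Measurable fun q : ℝ × (Ω × Ω) => p ^ q.1 := hptm.comp measurable_fst
    fun_prop
  have hji : Integrable (Function.uncurry fun (t : ℝ) (z : Ω × Ω) =>
      Real.cos (κ * p ^ t * (u z.1 - u z.2))) (lam.prod (ν.prod ν)) :=
    integrable_of_bdd hjm (B := 1) fun q => Real.abs_cos_le_one _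
  have hjm2 : Measurable (Function.uncurry fun (t : ℝ) (y : Ω) =>
      Real.cos (κ * p ^ t * u y + φ)) := by
    unfold Function.uncurry
    have h1 : Measurable fun q : ℝ × Ω => p ^ q.1 := hptm.comp measurable_fst
    fun_prop
  have hm3 : Measurable fun t : ℝ => ∫ y, Real.cos (κ * p ^ t * u y + φ) ∂ν :=
    (hjm2.stronglyMeasurable.integral_prod_right (ν := ν)).measurable
  have hb3 : ∀ t : ℝ, |∫ y, Real.cos (κ * p ^ t * u y + φ) ∂ν| ≤ ν.real univ := fun t => by
    have := norm_integral_le_of_norm_le_const (μ := ν) (f := fun y => Real.cos (κ * p ^ t * u y + φ))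
      (C := 1) (Eventually.of_forall fun y => Real.abs_cos_le_one _)
    simpa using this
  have h1 : ∫ t, (∫ y, Real.cos (κ * p ^ t * u y + φ) ∂ν) ^ 2 ∂lam ≤
      ∫ t, (∫ z, Real.cos (κ * p ^ t * (u z.1 - u z.2)) ∂(ν.prod ν)) ∂lam := by
    refine integral_mono ?_ hji.integral_prod_left fun t => sq_le_double hu _ φ
    refine integrable_of_bdd (hm3.pow_const 2) (B := ν.real univ ^ 2) fun t => ?_
    rw [abs_pow]; exact pow_le_pow_left₀ (abs_nonneg _) (hb3 t) 2
  refine h1.trans ?_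
  rw [integral_integral_swap hji]
  set C := (2 / Real.log p + 1) / (|κ| * r) with hC
  have hC0 : 0 ≤ C := by positivity
  have hSm : MeasurableSet {z : Ω × Ω | |u z.1 - u z.2| < r} :=
    measurableSet_lt (by fun_prop) measurable_const
  have i2 : Integrable ({z : Ω × Ω | |u z.1 - u z.2| < r}.indicator fun _ => (1:ℝ)) (ν.prod ν) :=
    (integrable_const _).indicator hSm
  have h2 : ∫ z, (∫ t, Real.cos (κ * p ^ t * (u z.1 - u z.2)) ∂lam) ∂(ν.prod ν) ≤
      ∫ z, (C + {z : Ω × Ω | |u z.1 - u z.2| < r}.indicator (fun _ => (1:ℝ)) z) ∂(ν.prod ν) := by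
    refine integral_mono hji.integral_prod_right ((integrable_const _).add i2) fun z => ?_
    by_cases hz : z ∈ {z : Ω × Ω | |u z.1 - u z.2| < r}
    · simp only [indicator_of_mem hz]
      have := norm_integral_le_of_norm_le_const (μ := lam)
        (f := fun t => Real.cos (κ * p ^ t * (u z.1 - u z.2)))
        (C := 1) (Eventually.of_forall fun y => Real.abs_cos_le_one _)
      simp only [probReal_univ, mul_one] at this
      have := (abs_le.1 this).2
      linarith
    · simp only [indicator_of_notMem hz, add_zero]
      have hz' : r ≤ |u z.1 - u z.2| := not_lt.1 hz
      have hd : u z.1 - u z.2 ≠ 0 := fun h => by rw [h, abs_zero] at hz'; linarith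
      have := vdc hp (mul_ne_zero hκ hd)
      have e : ∀ t : ℝ, κ * p ^ t * (u z.1 - u z.2) = κ * (u z.1 - u z.2) * p ^ t := fun t => by ring
      simp_rw [e]
      refine (le_abs_self _).trans (this.trans ?_)
      rw [abs_mul, hC]
      gcongr
  refine h2.trans (le_of_eq ?_)
  rw [integral_add (integrable_const _) i2, integral_indicator hSm, integral_const]
  simp only [smul_eq_mul, integral_const, mul_one, measureReal_restrict_apply_univ]
  have : (ν.prod ν).real univ = ν.real univ ^ 2 := by
    rw [← univ_prod_univ, measureReal_prod_prod]; ring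
  rw [this]; ring

end VdC


section ClaimC

lemma near_diag_enn {Ω : Type*} [MeasurableSpace Ω] (ν : Measure Ω) [IsFiniteMeasure ν]
    {J : Ω → ℤ} (hJ : Measurable J) :
    (ν.prod ν) {z | |J z.1 - J z.2| ≤ 1} ≤ 6 * ∫⁻ y, ν {w | J w = J y} ∂ν := by
  set a : ℤ → ℝ≥0∞ := fun c => ν {w | J w = c} with ha
  have hS : ∑' c, a c ^ 2 = ∫⁻ y, ν {w | J w = J y} ∂ν := by
    have h1 : ∫⁻ y, ν {w | J w = J y} ∂ν = ∫⁻ c, a c ∂(ν.map J) := by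
      rw [lintegral_map measurable_from_top hJ]
    rw [h1, lintegral_countable']
    refine tsum_congr fun c => ?_
    rw [Measure.map_apply hJ (MeasurableSet.singleton c), sq]; rfl
  have hsub : {z : Ω × Ω | |J z.1 - J z.2| ≤ 1} ⊆
      ⋃ e ∈ ({-1, 0, 1} : Finset ℤ), ⋃ c : ℤ, {w | J w = c} ×ˢ {w | J w = c + e} := by
    intro z hz
    have hz' : |J z.1 - J z.2| ≤ 1 := hz
    rw [abs_le] at hz'
    simp only [mem_iUnion]
    refine ⟨J z.2 - J z.1, ?_, J z.1, rfl, ?_⟩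
    · simp only [Finset.mem_insert, Finset.mem_singleton]; omega
    · change J z.2 = _; ring
  have hshift : ∀ e : ℤ, ∑' c, a (c + e) ^ 2 = ∑' c, a c ^ 2 := fun e =>
    (Equiv.addRight e).tsum_eq (fun c => a c ^ 2)
  have hmul : ∀ x y : ℝ≥0∞, x * y ≤ x ^ 2 + y ^ 2 := fun x y => by
    rcases le_total x y with h | h
    · calc x * y ≤ y * y := by gcongr
        _ = y ^ 2 := (sq y).symm
        _ ≤ _ := le_add_self
    · calc x * y ≤ x * x := by gcongr
        _ = x ^ 2 := (sq x).symm
        _ ≤ _ := le_self_add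
  have he : ∀ e : ℤ, (ν.prod ν) (⋃ c : ℤ, {w | J w = c} ×ˢ {w | J w = c + e}) ≤
      2 * ∑' c, a c ^ 2 := fun e => by
    refine (measure_iUnion_le _).trans ?_
    calc _ = ∑' c, a c * a (c + e) := tsum_congr fun c => Measure.prod_prod _ _
      _ ≤ ∑' c, (a c ^ 2 + a (c + e) ^ 2) := ENNReal.tsum_le_tsum fun c => hmul _ _
      _ = _ := by rw [ENNReal.tsum_add, hshift, two_mul]
  rw [← hS]
  calc _ ≤ _ := measure_mono hsub
    _ ≤ ∑ e ∈ ({-1, 0, 1} : Finset ℤ), (ν.prod ν) (⋃ c : ℤ, {w | J w = c} ×ˢ {w | J w = c + e}) :=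
      measure_biUnion_finset_le _ _
    _ ≤ ∑ e ∈ ({-1, 0, 1} : Finset ℤ), 2 * ∑' c, a c ^ 2 := Finset.sum_le_sum fun e _ => he e
    _ = 6 * ∑' c, a c ^ 2 := by
      rw [Finset.sum_const, show ({-1, 0, 1} : Finset ℤ).card = 3 from rfl, nsmul_eq_mul, ← mul_assoc]
      norm_num

variable (μ : Measure ℝ) [IsProbabilityMeasure μ]

lemma near_diag {p : ℕ} (hp : 1 ≤ p) {D n : ℕ} (hD : 1 ≤ D) (x : ℝ) :
    ((μ.restrict (cell p D x)).prod (μ.restrict (cell p D x))).real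
      {z | |(Tmap p)^[D] z.1 - (Tmap p)^[D] z.2| < ((p:ℝ)^n)⁻¹} ≤
    6 * ∫ y in cell p D x, μ.real (cell p (D+n) y) ∂μ := by
  set ν := μ.restrict (cell p D x) with hν
  have hJ := cidx_measurable p (D+n)
  have hpos : (0:ℝ) < (p:ℝ)^n := by positivity
  have hmem : ∀ᵐ y ∂ν, y ∈ cell p D x := ae_restrict_mem (cell_measurable p D x)
  have h1 : ∀ᵐ z ∂(ν.prod ν), z.1 ∈ cell p D x := Measure.quasiMeasurePreserving_fst.ae hmem
  have h2 : ∀ᵐ z ∂(ν.prod ν), z.2 ∈ cell p D x := Measure.quasiMeasurePreserving_snd.ae hmem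
  have hle : (ν.prod ν) {z | |(Tmap p)^[D] z.1 - (Tmap p)^[D] z.2| < ((p:ℝ)^n)⁻¹} ≤
      (ν.prod ν) {z | |cidx p (D+n) z.1 - cidx p (D+n) z.2| ≤ 1} := by
    apply measure_mono_ae
    filter_upwards [h1, h2] with z hz1 hz2 hz
    change |cidx p (D+n) z.1 - cidx p (D+n) z.2| ≤ 1
    have hz' : |(Tmap p)^[D] z.1 - (Tmap p)^[D] z.2| < ((p:ℝ)^n)⁻¹ := hz
    rw [Tmap_iterate p D hD, Tmap_iterate p D hD] at hz'
    have e1 : cidx p D z.1 = cidx p D x := hz1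
    have e2 : cidx p D z.2 = cidx p D x := hz2
    rw [cidx_fract_add, cidx_fract_add p D n z.2, e1, e2]
    set v := Int.fract ((p:ℝ)^D * z.1)
    set w := Int.fract ((p:ℝ)^D * z.2)
    have h3 : |(p:ℝ)^n * v - (p:ℝ)^n * w| < 1 := by
      rw [← mul_sub, abs_mul, abs_of_pos hpos]
      calc (p:ℝ)^n * |v - w| < (p:ℝ)^n * ((p:ℝ)^n)⁻¹ := by gcongr
        _ = 1 := mul_inv_cancel₀ hpos.ne'
    rw [add_sub_add_left_eq_sub]
    unfold cidx
    rw [abs_lt] at h3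
    have f1 := Int.floor_le ((p:ℝ)^n * v)
    have f2 := Int.lt_floor_add_one ((p:ℝ)^n * v)
    have f3 := Int.floor_le ((p:ℝ)^n * w)
    have f4 := Int.lt_floor_add_one ((p:ℝ)^n * w)
    set A := ⌊(p:ℝ)^n * v⌋
    set B := ⌊(p:ℝ)^n * w⌋
    have g1 : (A:ℝ) < (B + 2 : ℤ) := by push_cast; linarith
    have g2 : (B:ℝ) < (A + 2 : ℤ) := by push_cast; linarith
    have g1' : A < B + 2 := by exact_mod_cast g1
    have g2' : B < A + 2 := by exact_mod_cast g2
    rw [abs_le]; omega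
  have h3 := hle.trans (near_diag_enn ν hJ)
  have h4 : ∫⁻ y, ν {w | cidx p (D+n) w = cidx p (D+n) y} ∂ν ≤
      ∫⁻ y in cell p D x, μ (cell p (D+n) y) ∂μ :=
    lintegral_mono fun y => Measure.restrict_apply_le _ _
  have h5 : ∫ y in cell p D x, μ.real (cell p (D+n) y) ∂μ =
      (∫⁻ y in cell p D x, μ (cell p (D+n) y) ∂μ).toReal := by
    simp only [Measure.real]
    rw [integral_toReal]
    · exact ((measurable_from_top (f := fun c : ℤ => μ {y | cidx p (D+n) y = c})).comp
        (cidx_measurable p (D+n))).aemeasurable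
    · exact Eventually.of_forall fun y => measure_lt_top _ _
  have hfin : ∫⁻ y in cell p D x, μ (cell p (D+n) y) ∂μ ≠ ⊤ := by
    refine ne_top_of_le_ne_top (b := ∫⁻ y in cell p D x, 1 ∂μ) (by simp) ?_
    exact lintegral_mono fun y => prob_le_one
  rw [h5, Measure.real]
  have h6 := h3.trans (mul_le_mul_right h4 6)
  have := ENNReal.toReal_mono (ENNReal.mul_ne_top (by simp) hfin) h6
  simpa using this

/-- shifted cosine -/
noncomputable def hc (φ s u : ℝ) : ℝ := Real.cos (s * u + φ)

lemma hc_measurable (φ s : ℝ) : Measurable (hc φ s) := by unfold hc; fun_prop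

lemma hc_le (φ s u : ℝ) : |hc φ s u| ≤ 1 := Real.abs_cos_le_one _

lemma VV_hc_joint {p : ℕ} (hp : 1 ≤ p) (φ κ : ℝ) (D : ℕ) :
    Measurable fun q : ℝ × ℝ => VV μ p (hc φ (κ * (p:ℝ) ^ q.1)) D q.2 := by
  have hp0 : (p:ℝ) ≠ 0 := by positivity
  have hcpt : Continuous fun t : ℝ => (p:ℝ) ^ t := Real.continuous_const_rpow hp0
  have hptm : Measurable fun t : ℝ => (p:ℝ) ^ t := hcpt.measurable
  have hjm2 : Measurable (Function.uncurry fun (t : ℝ) (y : ℝ) =>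
      Real.cos (κ * (p:ℝ) ^ t * ((Tmap p)^[D] y) + φ)) := by
    unfold Function.uncurry
    have h1 : Measurable fun q : ℝ × ℝ => (p:ℝ) ^ q.1 := hptm.comp measurable_fst
    have h2 : Measurable fun q : ℝ × ℝ => (Tmap p)^[D] q.2 := (Titer_measurable p D).comp measurable_snd
    fun_prop
  have h1 : Measurable fun q : ℝ × ℤ => (μ.real {y | cidx p D y = q.2})⁻¹ *
      ∫ y in {y | cidx p D y = q.2}, Real.cos (κ * (p:ℝ) ^ q.1 * ((Tmap p)^[D] y) + φ) ∂μ := by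
    refine measurable_from_prod_countable_left fun c => ?_
    exact ((hjm2.stronglyMeasurable.integral_prod_right
      (ν := μ.restrict {y | cidx p D y = c})).measurable).const_mul
        ((μ.real {y | cidx p D y = c})⁻¹)
  exact h1.comp (measurable_fst.prodMk ((cidx_measurable p D).comp measurable_snd))

lemma VV_sq_t {p : ℕ} (hp : 2 ≤ p) {D n : ℕ} (hD : 1 ≤ D) (φ : ℝ) {κ : ℝ} (hκ : κ ≠ 0) {x : ℝ}
    (hx : 0 < μ.real (cell p D x)) :
    ∫ t, (VV μ p (hc φ (κ * (p:ℝ) ^ t)) D x) ^ 2 ∂lam ≤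
      (2 / Real.log p + 1) / (|κ| * ((p:ℝ)^n)⁻¹) +
      6 * CE μ p D (fun y => μ.real (cell p (D+n) y) / μ.real (cell p D y)) x := by
  have hp1 : (1:ℝ) < p := by exact_mod_cast (by omega : 1 < p)
  have hpos : (0:ℝ) < (p:ℝ)^n := by positivity
  set ν := μ.restrict (cell p D x) with hν
  set c := μ.real (cell p D x) with hc'
  have h1 := int_t_sq_le (ν := ν) (Titer_measurable p D) hp1 hκ (r := ((p:ℝ)^n)⁻¹) (by positivity) φ
  have h2 := near_diag μ (by omega : 1 ≤ p) (n := n) hD x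
  have hu : ν.real univ = c := by simp [hν, hc']
  rw [hu] at h1
  have h3 : ∫ t, (VV μ p (hc φ (κ * (p:ℝ) ^ t)) D x) ^ 2 ∂lam =
      (c⁻¹)^2 * ∫ t, (∫ y, Real.cos (κ * (p:ℝ) ^ t * ((Tmap p)^[D] y) + φ) ∂ν) ^ 2 ∂lam := by
    rw [← integral_const_mul]
    congr 1; ext t
    rw [← mul_pow]; rfl
  have h4 : CE μ p D (fun y => μ.real (cell p (D+n) y) / μ.real (cell p D y)) x =
      (c⁻¹)^2 * ∫ y in cell p D x, μ.real (cell p (D+n) y) ∂μ := by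
    rw [CE, setIntegral_congr_fun (cell_measurable p D x)
      (g := fun y => c⁻¹ * μ.real (cell p (D+n) y)) (fun y hy => by
        have : cidx p D y = cidx p D x := hy
        simp only [cell_eq this]; rw [div_eq_inv_mul]), integral_const_mul]
    ring
  rw [h3, h4]
  have h5 := mul_le_mul_of_nonneg_left (h1.trans (add_le_add_right h2 _)) (by positivity : 0 ≤ (c⁻¹)^2)
  refine h5.trans (le_of_eq ?_)
  have : c⁻¹ * c = 1 := inv_mul_cancel₀ hx.ne'
  have : (c⁻¹)^2 * c^2 = 1 := by rw [← mul_pow, this, one_pow]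
  linear_combination ((2 / Real.log p + 1) / (|κ| * ((p:ℝ)^n)⁻¹)) * this

lemma claimC {p : ℕ} (hp : 2 ≤ p) (hT : Ergodic (Tmap p) μ) (hdim : 0 < measureDim μ) {ε : ℝ}
    (hε : 0 < ε) : ∃ D0 : ℕ, ∃ κ0 > 0, ∀ D ≥ D0, ∀ φ κ : ℝ, κ0 ≤ |κ| →
      ∫ q, |VV μ p (hc φ (κ * (p:ℝ) ^ q.1)) D q.2| ∂(lam.prod μ) ≤ ε := by
  have hp1 : (1:ℝ) < p := by exact_mod_cast (by omega : 1 < p)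
  obtain ⟨n, D0, hD0⟩ := nonatomic μ hp hT hdim (ε := ε^2/12) (by positivity)
  have hL := Real.log_pos hp1
  have hpn : (0:ℝ) < (p:ℝ)^n := by positivity
  set C := (2 / Real.log p + 1) with hC
  have hCpos : 0 < C := by positivity
  refine ⟨max D0 1, 2 * C * (p:ℝ)^n / ε^2, by positivity, fun D hD φ κ hκ => ?_⟩
  have hD1 : 1 ≤ D := le_trans (le_max_right _ _) hD
  have hk0 : 0 < |κ| := lt_of_lt_of_le (by positivity) hκ
  have hκ0 : κ ≠ 0 := abs_pos.1 hk0
  have hJ := VV_hc_joint μ (by omega : 1 ≤ p) φ κ D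
  have hb : ∀ q : ℝ × ℝ, |VV μ p (hc φ (κ * (p:ℝ) ^ q.1)) D q.2| ≤ 1 := fun q =>
    VV_le μ p (hc_le _ _) D _
  have hi2 : Integrable (fun q : ℝ × ℝ => VV μ p (hc φ (κ * (p:ℝ) ^ q.1)) D q.2 ^ 2) (lam.prod μ) := by
    refine integrable_of_bdd (hJ.pow_const 2) (B := 1) fun q => ?_
    rw [abs_pow]; exact pow_le_one₀ (abs_nonneg _) (hb q)
  have key : ∫ q, VV μ p (hc φ (κ * (p:ℝ) ^ q.1)) D q.2 ^ 2 ∂(lam.prod μ) ≤ ε^2 := by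
    rw [integral_prod_symm _ hi2]
    set R : ℝ → ℝ := fun y => μ.real (cell p (D+n) y) / μ.real (cell p D y) with hR
    have hRm : Measurable R := (real_cell_measurable μ p (D+n)).div (real_cell_measurable μ p D)
    have hRb : ∀ y, |R y| ≤ 1 := fun y => by
      rw [abs_of_nonneg (by simp only [hR]; positivity)]
      exact div_le_one_of_le₀ (measureReal_mono (cell_subset (by omega) (Nat.le_add_right _ _) y))
        measureReal_nonneg
    have iCE : Integrable (CE μ p D R) μ := integrable_of_bdd (CE_measurable μ p D R)
      fun x => CE_le μ zero_le_one fun y _ => hRb y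
    calc _ ≤ ∫ x, (C / (|κ| * ((p:ℝ)^n)⁻¹) + 6 * CE μ p D R x) ∂μ := by
          refine integral_mono_ae hi2.integral_prod_right
            ((integrable_const _).add (iCE.const_mul 6)) ?_
          filter_upwards [ae_cell_pos μ p D] with x hx
          exact VV_sq_t μ hp hD1 φ hκ0 hx
      _ = C / (|κ| * ((p:ℝ)^n)⁻¹) + 6 * ∫ x, R x ∂μ := by
          rw [integral_add (integrable_const _) (iCE.const_mul 6), integral_const_mul,
            integral_CE μ hRm hRb]
          simp
      _ ≤ ε^2 / 2 + 6 * (ε^2/12) := by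
          have h1 := hD0 D (le_trans (le_max_left _ _) hD)
          refine add_le_add ?_ (by linarith)
          rw [div_le_iff₀ (by positivity)]
          rw [div_le_iff₀ (by positivity)] at hκ
          have : (|κ| * ((p:ℝ)^n)⁻¹) * (p:ℝ)^n = |κ| := by field_simp
          by_contra hcon
          push Not at hcon
          have := mul_lt_mul_of_pos_right hcon hpn
          nlinarith
      _ = ε^2 := by ring
  have := integral_abs_le_sqrt (μ := lam.prod μ) hJ hb key
  rwa [Real.sqrt_sq hε.le] at this

end ClaimC


section ClaimB

lemma dense_fract {α : ℝ} (hα : Irrational α) {a b : ℝ} (ha : 0 ≤ a) (hab : a < b) (hb : b ≤ 1) :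
    ∃ j : ℕ, Int.fract (j * α) ∈ Ioo a b := by
  have h1 : DenseRange (· • (α : AddCircle (1:ℝ)) : ℤ → AddCircle (1:ℝ)) := by
    rw [AddCircle.denseRange_zsmul_coe_iff]; simpa using hα
  rw [denseRange_zsmul_iff_nsmul] at h1
  have hU : IsOpen ((fun x : ℝ => (x : AddCircle (1:ℝ))) '' Ioo a b) :=
    QuotientAddGroup.isOpenMap_coe _ isOpen_Ioo
  obtain ⟨j, s, hs, hj⟩ := h1.exists_mem_open hU ((nonempty_Ioo.2 hab).image _)
  refine ⟨j, ?_⟩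
  have hs01 : s ∈ Ico (0:ℝ) (0 + 1) := ⟨ha.trans hs.1.le, by linarith [hs.2]⟩
  have hf01 : Int.fract (j * α) ∈ Ico (0:ℝ) (0 + 1) :=
    ⟨Int.fract_nonneg _, by rw [zero_add]; exact Int.fract_lt_one _⟩
  have e : ((Int.fract (j * α) : ℝ) : AddCircle (1:ℝ)) = (s : AddCircle (1:ℝ)) := by
    rw [AddCircle.coe_fract]
    have h2 : (s : AddCircle (1:ℝ)) = j • (α : AddCircle (1:ℝ)) := hj
    rw [h2, ← AddCircle.coe_nsmul, nsmul_eq_mul]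
  haveI : Fact ((0:ℝ) < 1) := ⟨one_pos⟩
  rw [AddCircle.coe_eq_coe_iff_of_mem_Ico hf01 hs01] at e
  rw [e]; exact hs

lemma fract_mp (α : ℝ) : MeasurePreserving (fun t => Int.fract (t + α)) lam lam := by
  have hm : Measurable fun t : ℝ => Int.fract (t + α) := by fun_prop
  refine ⟨hm, ?_⟩
  ext s hs
  rw [Measure.map_apply hm hs]
  have hms : MeasurableSet (Int.fract ⁻¹' s : Set ℝ) := measurable_fract hs
  have h := (isAddFundamentalDomain_Ioc (T := (1:ℝ)) one_pos α).measure_set_eq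
    (isAddFundamentalDomain_Ioc (T := (1:ℝ)) one_pos 0) (A := Int.fract ⁻¹' s) hms (by
      rintro ⟨g, n, rfl⟩
      ext x
      simp only [mem_preimage]
      have h0 : ∀ h, (⟨n • (1:ℝ), h⟩ : AddSubgroup.zmultiples (1:ℝ)) +ᵥ x = (n:ℝ) + x := fun h => by
        change n • (1:ℝ) + x = _
        simp
      have h1 := h0 ⟨n, rfl⟩
      have h2 : Int.fract ((n:ℝ) + x) = Int.fract x := Int.fract_intCast_add n x
      rw [← h2, ← h1])
  have e1 : lam = volume.restrict (Ioc (0:ℝ) 1) := by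
    rw [lam]; exact Measure.restrict_congr_set Ico_ae_eq_Ioc
  rw [e1, Measure.restrict_apply (hm hs), Measure.restrict_apply hs]
  have h2 : volume ((fun t => Int.fract (t + α)) ⁻¹' s ∩ Ioc (0:ℝ) 1) =
      volume ((Int.fract ⁻¹' s : Set ℝ) ∩ Ioc α (α + 1)) := by
    rw [← measure_preimage_add_right volume α ((Int.fract ⁻¹' s : Set ℝ) ∩ Ioc α (α + 1))]
    congr 1
    ext t
    simp only [mem_inter_iff, mem_preimage, mem_Ioc]
    constructor
    · rintro ⟨h1, h2, h3⟩; exact ⟨h1, by linarith, by linarith⟩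
    · rintro ⟨h1, h2, h3⟩; exact ⟨h1, by linarith, by linarith⟩
  rw [h2, h]
  have h3 : ((Int.fract ⁻¹' s : Set ℝ) ∩ Ioc (0:ℝ) (0 + 1) : Set ℝ) =ᵐ[volume] (s ∩ Ioc (0:ℝ) 1 : Set ℝ) := by
    have : ∀ᵐ x : ℝ ∂volume, x ≠ 1 := by simp [ae_iff]
    filter_upwards [this] with x hx
    apply propext
    change (Int.fract x ∈ s ∧ x ∈ Ioc (0:ℝ) (0+1)) ↔ (x ∈ s ∧ x ∈ Ioc (0:ℝ) 1)
    rw [zero_add]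
    refine and_congr_left fun h => ?_
    rw [Int.fract_eq_self.2 ⟨h.1.le, lt_of_le_of_ne h.2 hx⟩]
  exact measure_congr h3

variable {Ω : Type*} [MeasurableSpace Ω] (μ : Measure Ω) [IsProbabilityMeasure μ]

/-- skew product over the rotation -/
noncomputable def SK (T : Ω → Ω) (α : ℝ) (q : ℝ × Ω) : ℝ × Ω :=
  (Int.fract (q.1 + α), T^[⌊q.1 + α⌋₊] q.2)

lemma SK_mp {T : Ω → Ω} (hT : MeasurePreserving T μ μ) (α : ℝ) :
    MeasurePreserving (SK T α) (lam.prod μ) (lam.prod μ) := by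
  have hgm : Measurable (Function.uncurry fun (t : ℝ) (x : Ω) => T^[⌊t + α⌋₊] x) := by
    have h1 : Measurable fun q : ℕ × Ω => T^[q.1] q.2 :=
      measurable_from_prod_countable_right fun n => hT.measurable.iterate n
    have h2 : Measurable fun t : ℝ => ⌊t + α⌋₊ := Nat.measurable_floor.comp (by fun_prop)
    exact h1.comp ((h2.comp measurable_fst).prodMk measurable_snd)
  exact (fract_mp α).skew_product hgm (Eventually.of_forall fun t => (hT.iterate _).map_eq)

lemma floor_add' {u v : ℝ} (hu : 0 ≤ u) (hv : 0 ≤ v) :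
    ⌊Int.fract u + v⌋₊ + ⌊u⌋₊ = ⌊u + v⌋₊ := by
  have h1 : u + v = (Int.fract u + v) + (⌊u⌋₊ : ℝ) := by
    rw [natCast_floor_eq_intCast_floor hu]
    have := Int.self_sub_floor u
    linarith
  rw [h1, Nat.floor_add_natCast (add_nonneg (Int.fract_nonneg _) hv)]

lemma SK_iter (T : Ω → Ω) {α : ℝ} (hα : 0 < α) {t : ℝ} (ht : t ∈ Ico (0:ℝ) 1) (x : Ω) (i : ℕ) :
    (SK T α)^[i] (t, x) = (Int.fract (t + i * α), T^[⌊t + i * α⌋₊] x) := by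
  induction i with
  | zero =>
    have : ⌊t⌋₊ = 0 := Nat.floor_eq_zero.2 ht.2
    simp [Int.fract_eq_self.2 ht, this]
  | succ i ih =>
    rw [Function.iterate_succ_apply', ih, SK]
    have h0 : 0 ≤ t + i * α := by have := ht.1; positivity
    have e : t + (i + 1 : ℕ) * α = (t + i * α) + α := by push_cast; ring
    rw [e]
    ext1
    · simp only
      rw [Int.fract_eq_fract]
      refine ⟨-⌊t + i * α⌋, ?_⟩
      push_cast
      have := Int.self_sub_floor (t + i * α)
      linarith
    · simp only
      rw [← Function.iterate_add_apply, floor_add' h0 hα.le]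

lemma claimB {T : Ω → Ω} (hT : MeasurePreserving T μ μ) {α : ℝ} (hα0 : 0 < α) (hα : Irrational α)
    {G : ℝ × Ω → ℝ} (hG : Measurable G) {B Λ : ℝ} (hG0 : ∀ q, 0 ≤ G q) (hGB : ∀ q, G q ≤ B)
    (hL : ∀ s ∈ Ico (0:ℝ) 1, ∀ t ∈ Ico (0:ℝ) 1, ∀ x, |G (s, x) - G (t, x)| ≤ Λ * |s - t|)
    {δ : ℝ} (hδ : 0 < δ) :
    μ.real {x | ∃ᶠ N : ℕ in atTop,
      δ * N < ∑ i ∈ Finset.range N, G (Int.fract (i * α), T^[⌊i * α⌋₊] x)} ≤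
      4 / δ * ∫ q, G q ∂(lam.prod μ) := by
  set F := {x | ∃ᶠ N : ℕ in atTop,
      δ * N < ∑ i ∈ Finset.range N, G (Int.fract (i * α), T^[⌊i * α⌋₊] x)} with hF
  obtain ⟨x0⟩ : Nonempty Ω := by
    by_contra h
    rw [not_nonempty_iff] at h
    have := measure_univ (μ := μ)
    rw [Measure.eq_zero_of_isEmpty μ] at this; simp at this
  have hB0 : 0 ≤ B := (hG0 (0, x0)).trans (hGB _)
  set A : ℝ → ℕ → Ω → ℝ := fun t N x => ∑ i ∈ Finset.range N,
    G (Int.fract (t + i * α), T^[⌊t + i * α⌋₊] x) with hA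
  have step1 : ∀ j : ℕ, μ F ≤ μ {y | ∃ᶠ N : ℕ in atTop, δ / 2 * N < A (Int.fract (j * α)) N y} := by
    intro j
    set θ := Int.fract (j * α)
    set k := ⌊j * α⌋₊
    have hterm : ∀ (i : ℕ) x, G (Int.fract ((j + i : ℕ) * α), T^[⌊(j + i : ℕ) * α⌋₊] x) =
        G (Int.fract (θ + i * α), T^[⌊θ + i * α⌋₊] (T^[k] x)) := by
      intro i x
      have e : ((j + i : ℕ) : ℝ) * α = j * α + i * α := by push_cast; ring
      rw [e, ← Function.iterate_add_apply, floor_add' (by positivity) (by positivity)]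
      congr 2
      rw [Int.fract_eq_fract]
      refine ⟨⌊j * α⌋, ?_⟩
      have := Int.self_sub_floor (j * α)
      change _ - (Int.fract (j * α) + _) = _
      linarith
    have hA_le : ∀ N x, ∑ i ∈ Finset.range N, G (Int.fract (i * α), T^[⌊i * α⌋₊] x) ≤
        j * B + A θ N (T^[k] x) := by
      intro N x
      have h1 : ∑ i ∈ Finset.range N, G (Int.fract (i * α), T^[⌊i * α⌋₊] x) ≤
          ∑ i ∈ Finset.range (j + N), G (Int.fract (i * α), T^[⌊i * α⌋₊] x) :=
        Finset.sum_le_sum_of_subset_of_nonneg (Finset.range_mono (by omega)) fun _ _ _ => hG0 _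
      refine h1.trans ?_
      rw [Finset.sum_range_add]
      refine add_le_add ?_ (le_of_eq (Finset.sum_congr rfl fun i _ => hterm i x))
      calc _ ≤ ∑ i ∈ Finset.range j, B := Finset.sum_le_sum fun _ _ => hGB _
        _ = j * B := by simp
    have hsub : F ⊆ T^[k] ⁻¹' {y | ∃ᶠ N : ℕ in atTop, δ / 2 * N < A θ N y} := by
      intro x hx
      have hx' : ∃ᶠ N : ℕ in atTop,
        δ * N < ∑ i ∈ Finset.range N, G (Int.fract (i * α), T^[⌊i * α⌋₊] x) := hx
      have hev : ∀ᶠ N : ℕ in atTop, j * B ≤ δ / 2 * N := by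
        have : Tendsto (fun N : ℕ => δ / 2 * (N:ℝ)) atTop atTop :=
          tendsto_natCast_atTop_atTop.const_mul_atTop (by positivity)
        exact this.eventually_ge_atTop _
      change ∃ᶠ N : ℕ in atTop, δ / 2 * N < A θ N (T^[k] x)
      refine (hx'.and_eventually hev).mono fun N hN => ?_
      have := hA_le N x
      linarith [hN.1, hN.2]
    have hAm : ∀ N, Measurable (A θ N) := fun N => by
      refine Finset.measurable_sum _ fun i _ => ?_
      exact hG.comp (measurable_const.prodMk (hT.measurable.iterate _))
    have hms : MeasurableSet {y | ∃ᶠ N : ℕ in atTop, δ / 2 * N < A θ N y} := by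
      have : {y | ∃ᶠ N : ℕ in atTop, δ / 2 * N < A θ N y} =
        limsup (fun N : ℕ => {y | δ / 2 * N < A θ N y}) atTop := by
        ext y; rw [mem_limsup_iff_frequently_mem]; rfl
      rw [this]
      exact MeasurableSet.measurableSet_limsup fun N => measurableSet_lt measurable_const (hAm N)
    exact (measure_mono hsub).trans ((hT.iterate k).measure_preimage hms.nullMeasurableSet).le
  have main : ∀ τ : ℝ, 0 < τ → τ ≤ 1 → Λ * τ ≤ δ / 4 →
      μ.real F ≤ 4 / δ * (∫ q, G q ∂(lam.prod μ) + B * τ) := by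
    intro τ hτ hτ1 hΛτ
    set G' : ℝ × Ω → ℝ := fun q => G q + (Iio τ).indicator (fun _ => B) q.1 with hG'
    have hind : Measurable fun q : ℝ × Ω => (Iio τ).indicator (fun _ => B) q.1 :=
      (measurable_const.indicator measurableSet_Iio).comp measurable_fst
    have hind0 : ∀ s : ℝ, 0 ≤ (Iio τ).indicator (fun _ => B) s := fun s =>
      indicator_nonneg (fun _ _ => hB0) s
    have hindB : ∀ s : ℝ, (Iio τ).indicator (fun _ => B) s ≤ B := fun s => by
      by_cases h : s ∈ Iio τ
      · rw [indicator_of_mem h]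
      · rw [indicator_of_notMem h]; exact hB0
    have hG'm : Measurable G' := hG.add hind
    have hG'0 : ∀ q, 0 ≤ G' q := fun q => add_nonneg (hG0 q) (hind0 _)
    have hG'B : ∀ q, |G' q| ≤ B + B := fun q => by
      rw [abs_of_nonneg (hG'0 q)]; exact add_le_add (hGB q) (hindB _)
    set E := {q : ℝ × Ω | ∃ N : ℕ, δ / 4 * N < ∑ i ∈ Finset.range N, G' ((SK T α)^[i] q)} with hE
    have hmax := maximal_ergodic (SK_mp μ hT α) hG'm hG'B hG'0 (δ / 4)
    have hEm : MeasurableSet E := by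
      have : E = ⋃ N : ℕ, {q | δ / 4 * N < ∑ i ∈ Finset.range N, G' ((SK T α)^[i] q)} := by
        ext q; simp [hE]
      rw [this]
      refine MeasurableSet.iUnion fun N => measurableSet_lt measurable_const ?_
      exact Finset.measurable_sum _ fun i _ => hG'm.comp ((SK_mp μ hT α).measurable.iterate i)
    have hintG : Integrable G (lam.prod μ) := integrable_of_bdd hG (B := B) fun q => by
      rw [abs_of_nonneg (hG0 q)]; exact hGB q
    have hintI : Integrable (fun q : ℝ × Ω => (Iio τ).indicator (fun _ => B) q.1) (lam.prod μ) :=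
      integrable_of_bdd hind (B := B) fun q => by
        rw [abs_of_nonneg (hind0 _)]; exact hindB _
    have hIval : ∫ q : ℝ × Ω, (Iio τ).indicator (fun _ => B) q.1 ∂(lam.prod μ) ≤ B * τ := by
      rw [integral_prod _ hintI]
      simp only [integral_const, probReal_univ, smul_eq_mul, one_mul]
      rw [integral_indicator measurableSet_Iio, integral_const]
      have : (lam.restrict (Iio τ)).real univ ≤ τ := by
        rw [measureReal_restrict_apply_univ, Measure.real, lam,
          Measure.restrict_apply measurableSet_Iio]
        refine ENNReal.toReal_le_of_le_ofReal hτ.le ?_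
        calc volume (Iio τ ∩ Ico (0:ℝ) 1) ≤ volume (Ico (0:ℝ) τ) :=
              measure_mono fun y hy => ⟨hy.2.1, hy.1⟩
          _ = _ := by simp
      rw [smul_eq_mul, mul_comm]
      gcongr
    have hG'int : ∫ q, G' q ∂(lam.prod μ) ≤ ∫ q, G q ∂(lam.prod μ) + B * τ := by
      simp only [hG']
      rw [integral_add hintG hintI]
      linarith
    have hcomp : ∀ t ∈ Ioo (0:ℝ) 1, μ F ≤ μ (Prod.mk t ⁻¹' E) := by
      intro t ht
      obtain ⟨j, hj⟩ := dense_fract hα (a := max 0 (t - τ)) (b := t) (le_max_left _ _)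
        (max_lt ht.1 (by linarith)) ht.2.le
      refine (step1 j).trans (measure_mono ?_)
      set θ := Int.fract (j * α)
      have hθt : θ < t := hj.2
      have hθt2 : t - θ < τ := by have := lt_of_le_of_lt (le_max_right _ _) hj.1; linarith
      have hθ0 : 0 ≤ θ := Int.fract_nonneg _
      intro y hy
      have hy' : ∃ᶠ N : ℕ in atTop, δ / 2 * N < A θ N y := hy
      obtain ⟨N, hN⟩ := hy'.exists
      refine ⟨N, ?_⟩
      have hterm : ∀ i ∈ Finset.range N, G (Int.fract (θ + i * α), T^[⌊θ + i * α⌋₊] y) ≤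
          δ / 4 + G' ((SK T α)^[i] (t, y)) := by
        intro i _
        rw [SK_iter T hα0 ⟨ht.1.le, ht.2⟩]
        have hnn : 0 ≤ θ + i * α := by positivity
        have hnn2 : 0 ≤ t + i * α := by have := ht.1; positivity
        have f1 := Int.fract_nonneg (θ + i * α)
        have f2 := Int.fract_lt_one (θ + i * α)
        have f3 := Int.self_sub_floor (θ + i * α)
        rcases lt_or_ge (Int.fract (θ + i * α) + (t - θ)) 1 with hlt | hge
        · have hfl : ⌊t + i * α⌋ = ⌊θ + i * α⌋ := by
            rw [Int.floor_eq_iff]; constructor <;> linarith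
          have hfl' : ⌊t + i * α⌋₊ = ⌊θ + i * α⌋₊ := by
            rw [← Int.floor_toNat, hfl, Int.floor_toNat]
          have f4 := Int.self_sub_floor (t + i * α)
          rw [hfl] at f4
          rw [hfl']
          have := hL _ ⟨f1, f2⟩ _ ⟨Int.fract_nonneg (t + i * α), Int.fract_lt_one _⟩
            (T^[⌊θ + i * α⌋₊] y)
          have e : Int.fract (θ + i * α) - Int.fract (t + i * α) = -(t - θ) := by linarith
          rw [e, abs_neg, abs_of_pos (by linarith : 0 < t - θ)] at this
          have h1 := (abs_le.1 this).2
          have h2 : Λ * (t - θ) ≤ δ / 4 := by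
            rcases le_total 0 Λ with h | h
            · exact (mul_le_mul_of_nonneg_left hθt2.le h).trans hΛτ
            · exact (mul_nonpos_of_nonpos_of_nonneg h (by linarith)).trans (by linarith)
          have h3 := hind0 (Int.fract (t + i * α))
          simp only [hG']
          linarith
        · have hfl : ⌊t + i * α⌋ = ⌊θ + i * α⌋ + 1 := by
            rw [Int.floor_eq_iff]; push_cast; constructor <;> linarith
          have f4 := Int.self_sub_floor (t + i * α)
          rw [hfl] at f4
          push_cast at f4
          have hlt : Int.fract (t + i * α) ∈ Iio τ := by
            change _ < τ
            linarith
          simp only [hG', indicator_of_mem hlt]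
          linarith [hGB (Int.fract (θ + i * α), T^[⌊θ + i * α⌋₊] y),
            hG0 (Int.fract (t + i * α), T^[⌊t + i * α⌋₊] y)]
      have hs := Finset.sum_le_sum hterm
      rw [Finset.sum_add_distrib] at hs
      simp only [Finset.sum_const, Finset.card_range, nsmul_eq_mul] at hs
      have hN' : δ / 2 * N < ∑ i ∈ Finset.range N, G (Int.fract (θ + i * α), T^[⌊θ + i * α⌋₊] y) := hN
      linarith
    have hFE : μ F ≤ (lam.prod μ) E := by
      rw [Measure.prod_apply hEm]
      calc μ F = ∫⁻ t, μ F ∂lam := by simp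
        _ ≤ _ := by
          refine lintegral_mono_ae ?_
          have h1 : ∀ᵐ t ∂lam, t ∈ Ico (0:ℝ) 1 := ae_restrict_mem measurableSet_Ico
          have h2 : ∀ᵐ t ∂lam, t ≠ 0 := ae_restrict_of_ae (by simp [ae_iff])
          filter_upwards [h1, h2] with t h1 h2
          exact hcomp t ⟨lt_of_le_of_ne h1.1 h2.symm, h1.2⟩
    have hFE' : μ.real F ≤ (lam.prod μ).real E := ENNReal.toReal_mono (measure_ne_top _ _) hFE
    have h5 : δ / 4 * μ.real F ≤ ∫ q, G q ∂(lam.prod μ) + B * τ :=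
      (mul_le_mul_of_nonneg_left hFE' (by positivity)).trans (hmax.trans hG'int)
    have h6 := mul_le_mul_of_nonneg_left h5 (by positivity : 0 ≤ 4 / δ)
    have h7 : 4 / δ * (δ / 4 * μ.real F) = μ.real F := by field_simp
    rwa [h7] at h6
  have hlim : Tendsto (fun τ : ℝ => 4 / δ * (∫ q, G q ∂(lam.prod μ) + B * τ)) (𝓝[>] 0)
      (𝓝 (4 / δ * (∫ q, G q ∂(lam.prod μ) + B * 0))) := by
    refine Tendsto.mono_left ?_ nhdsWithin_le_nhds
    exact Continuous.tendsto (by fun_prop) 0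
  rw [mul_zero, add_zero] at hlim
  refine ge_of_tendsto hlim ?_
  have h1 : ∀ᶠ τ : ℝ in 𝓝[>] 0, Λ * τ < δ / 4 := by
    have : Tendsto (fun τ : ℝ => Λ * τ) (𝓝[>] 0) (𝓝 (Λ * 0)) :=
      Tendsto.mono_left (Continuous.tendsto (by fun_prop) 0) nhdsWithin_le_nhds
    rw [mul_zero] at this
    exact this.eventually_lt_const (by positivity)
  have h2 : ∀ᶠ τ : ℝ in 𝓝[>] 0, τ < 1 :=
    (tendsto_id.mono_left nhdsWithin_le_nhds).eventually_lt_const one_pos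
  filter_upwards [h1, h2, self_mem_nhdsWithin] with τ h1 h2 h3
  exact main τ h3 h2.le h1.le

end ClaimB


section Step1

lemma sum_half (N : ℕ) : ∑ i ∈ Finset.range N, (1/2:ℝ)^(N - i) ≤ 1 := by
  have h : ∑ i ∈ Finset.range N, (1/2:ℝ)^(N - i) = 1 - (1/2)^N := by
    induction N with
    | zero => simp
    | succ N ih =>
      rw [Finset.sum_range_succ, Finset.sum_congr rfl (g := fun i => (1/2:ℝ)^(N - i) * (1/2))
        (fun i hi => by
          rw [Finset.mem_range] at hi
          rw [show N + 1 - i = (N - i) + 1 by omega, pow_succ]), ← Finset.sum_mul, ih]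
      simp; ring
  rw [h]
  have : (0:ℝ) ≤ (1/2)^N := by positivity
  linarith

lemma second_moment_of_decay {Ω : Type*} [MeasurableSpace Ω] {μ : Measure Ω}
    [IsProbabilityMeasure μ] {Z : ℕ → Ω → ℝ} (hZ : ∀ i, Measurable (Z i)) {B C : ℝ} (hB : ∀ i x, |Z i x| ≤ B)
    (hC : ∀ i j, i ≤ j → |∫ x, Z i x * Z j x ∂μ| ≤ C * (1/2)^(j - i)) (N : ℕ) :
    ∫ x, (∑ i ∈ Finset.range N, Z i x)^2 ∂μ ≤ 3 * C * N := by
  have hC0 : 0 ≤ C := by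
    have := (abs_nonneg _).trans (hC 0 0 le_rfl); simpa using this
  have hIntg : ∀ i j, Integrable (fun x => Z i x * Z j x) μ := fun i j =>
    integrable_of_bdd ((hZ i).mul (hZ j)) (B := B * B) fun x => by
      rw [abs_mul]; exact mul_le_mul (hB i x) (hB j x) (abs_nonneg _) ((abs_nonneg _).trans (hB i x))
  induction N with
  | zero => simp
  | succ N ih =>
    have hSm : Measurable fun x => ∑ i ∈ Finset.range N, Z i x := Finset.measurable_sum _ fun i _ => hZ i
    have hSB : ∀ x, |∑ i ∈ Finset.range N, Z i x| ≤ N * B := fun x => by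
      refine (Finset.abs_sum_le_sum_abs _ _).trans ?_
      refine (Finset.sum_le_sum fun i _ => hB i x).trans ?_
      simp
    have i1 : Integrable (fun x => (∑ i ∈ Finset.range N, Z i x)^2) μ :=
      integrable_of_bdd (hSm.pow_const 2) (B := (N * B)^2) fun x => by
        rw [abs_pow]; exact pow_le_pow_left₀ (abs_nonneg _) (hSB x) 2
    have i2 : Integrable (fun x => 2 * ∑ i ∈ Finset.range N, Z i x * Z N x) μ :=
      (integrable_finsetSum _ fun i _ => hIntg i N).const_mul 2
    have i3 := hIntg N N
    have e : ∀ x, (∑ i ∈ Finset.range (N+1), Z i x)^2 = (∑ i ∈ Finset.range N, Z i x)^2 +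
        2 * ∑ i ∈ Finset.range N, Z i x * Z N x + Z N x * Z N x := fun x => by
      rw [Finset.sum_range_succ, ← Finset.sum_mul]; ring
    simp_rw [e]
    have h12 : Integrable (fun x => (∑ i ∈ Finset.range N, Z i x)^2 +
      2 * ∑ i ∈ Finset.range N, Z i x * Z N x) μ := i1.add i2
    rw [integral_add h12 i3, integral_add i1 i2, integral_const_mul,
      integral_finsetSum _ fun i _ => hIntg i N]
    have h1 : ∑ i ∈ Finset.range N, ∫ x, Z i x * Z N x ∂μ ≤ C := by
      calc _ ≤ ∑ i ∈ Finset.range N, C * (1/2)^(N - i) := Finset.sum_le_sum fun i hi =>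
            (le_abs_self _).trans (hC i N (Finset.mem_range.1 hi).le)
        _ = C * ∑ i ∈ Finset.range N, (1/2)^(N - i) := by rw [Finset.mul_sum]
        _ ≤ C * 1 := by gcongr; exact sum_half N
        _ = C := mul_one C
    have h2 : ∫ x, Z N x * Z N x ∂μ ≤ C := by
      have := (le_abs_self _).trans (hC N N le_rfl); simpa using this
    push_cast
    linarith

variable (μ : Measure ℝ) [IsProbabilityMeasure μ]

lemma cos_lip (a b : ℝ) : |Real.cos a - Real.cos b| ≤ |a - b| := by
  have := Real.lipschitzWith_cos.dist_le_mul a b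
  simpa [Real.dist_eq] using this

lemma pow_floor_bound {p : ℕ} (hp : 2 ≤ p) {M : ℕ} {α : ℝ} (hα : 0 < α)
    (hM : (M:ℝ) = (p:ℝ) ^ α) (j : ℕ) :
    (M:ℝ)^j = (p:ℝ)^⌊j * α⌋₊ * (p:ℝ) ^ (Int.fract (j * α)) := by
  have hp0 : (0:ℝ) < p := by positivity
  rw [hM, ← Real.rpow_natCast, ← Real.rpow_mul hp0.le, ← Real.rpow_natCast (p:ℝ) ⌊j * α⌋₊,
    ← Real.rpow_add hp0]
  congr 1
  rw [natCast_floor_eq_intCast_floor (by positivity)]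
  have := Int.self_sub_floor (j * α)
  linarith

lemma step1 {p : ℕ} (hp : 2 ≤ p) {M : ℕ} (hM2 : 2 ≤ M) {α : ℝ} (hα : 0 < α)
    (hM : (M:ℝ) = (p:ℝ) ^ α) (ξ φ : ℕ → ℝ) {K : ℝ} (hK : ∀ i, |ξ i| ≤ K * (M:ℝ)^i) :
    ∀ᵐ x ∂μ, Tendsto (fun N : ℕ => (1 / N : ℝ) * ∑ i ∈ Finset.range N,
      (Real.cos (ξ i * x + φ i) - CE μ p ⌊i * α⌋₊ (fun y => Real.cos (ξ i * y + φ i)) x))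
      atTop (𝓝 0) := by
  set k : ℕ → ℕ := fun i => ⌊i * α⌋₊ with hk
  set cc : ℕ → ℝ → ℝ := fun i y => Real.cos (ξ i * y + φ i) with hcc
  have hccm : ∀ i, Measurable (cc i) := fun i => by simp only [hcc]; fun_prop
  have hccB : ∀ i y, |cc i y| ≤ 1 := fun i y => Real.abs_cos_le_one _
  set Z : ℕ → ℝ → ℝ := fun i x => cc i x - CE μ p (k i) (cc i) x with hZ
  have hZm : ∀ i, Measurable (Z i) := fun i => (hccm i).sub (CE_measurable μ _ _ _)
  have hZB : ∀ i x, |Z i x| ≤ 2 := fun i x => by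
    have h1 := abs_le.1 (hccB i x)
    have h2 := abs_le.1 (CE_le μ (p := p) (k := k i) (f := cc i) (x := x) zero_le_one fun y _ => hccB i y)
    simp only [hZ]
    rw [abs_le]; constructor <;> linarith [h1.1, h1.2, h2.1, h2.2]
  have hp0 : (0:ℝ) < p := by positivity
  have hp1 : (1:ℝ) < p := by exact_mod_cast (by omega : 1 < p)
  have hM0 : (0:ℝ) < M := by positivity
  have hK0 : 0 ≤ K := by have := (abs_nonneg _).trans (hK 0); simpa using this
  have hpk : ∀ j, ((p:ℝ)^(k j))⁻¹ ≤ p * ((M:ℝ)^j)⁻¹ := fun j => by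
    have h1 := pow_floor_bound hp hα hM j
    have h2 : (p:ℝ) ^ (Int.fract (j * α)) ≤ p := by
      calc (p:ℝ) ^ (Int.fract (j * α)) ≤ (p:ℝ) ^ (1:ℝ) :=
            Real.rpow_le_rpow_of_exponent_le hp1.le (Int.fract_lt_one _).le
        _ = p := Real.rpow_one _
    have h3 : (M:ℝ)^j ≤ (p:ℝ)^(k j) * p := by rw [h1]; gcongr
    rw [← div_eq_mul_inv, le_div_iff₀ (by positivity), inv_mul_le_iff₀ (by positivity)]
    exact h3
  have hdec : ∀ i j, i ≤ j → |∫ x, Z i x * Z j x ∂μ| ≤ (2 * K * p) * (1/2)^(j - i) := by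
    intro i j hij
    have hkij : k i ≤ k j := Nat.floor_mono (by gcongr)
    obtain ⟨F, hF⟩ := CE_factor μ p (k j) (Z i)
    set F' : ℤ → ℝ := fun c => max (-2) (min 2 (F c)) with hF'
    have hFB' : ∀ c, |F' c| ≤ 2 := fun c => by
      rw [abs_le]; exact ⟨le_max_left _ _, max_le (by norm_num) (min_le_left _ _)⟩
    have hFF' : ∀ x, F' (cidx p (k j) x) = CE μ p (k j) (Z i) x := fun x => by
      have h1 := abs_le.1 (CE_le μ (p := p) (k := k j) (f := Z i) (x := x) zero_le_two fun y _ => hZB i y)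
      rw [hF] at h1 ⊢
      simp only [hF']
      rw [min_eq_right h1.2, max_eq_right h1.1]
    have horth := integral_mul_CE μ (p := p) (k := k j) (hccm j) (hccB j) F' hFB'
    have hF'm : Measurable fun x => F' (cidx p (k j) x) :=
      (measurable_from_top (f := F')).comp (cidx_measurable p (k j))
    have bmul : ∀ {a b : ℝ}, |a| ≤ 2 → |b| ≤ 2 → |a * b| ≤ 4 := fun {a b} ha hb => by
      rw [abs_mul]; nlinarith [abs_nonneg a, abs_nonneg b]
    have h0 : ∫ x, F' (cidx p (k j) x) * Z j x ∂μ = 0 := by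
      have e : ∀ x, F' (cidx p (k j) x) * Z j x = F' (cidx p (k j) x) * cc j x -
        F' (cidx p (k j) x) * CE μ p (k j) (cc j) x := fun x => by simp only [hZ]; ring
      simp_rw [e]
      rw [integral_sub, horth, sub_self]
      · exact integrable_of_bdd (hF'm.mul (hccm j)) (B := 4) fun x =>
          bmul (hFB' _) ((hccB j x).trans one_le_two)
      · exact integrable_of_bdd (hF'm.mul (CE_measurable μ _ _ _)) (B := 4) fun x =>
          bmul (hFB' _) ((CE_le μ zero_le_one fun y _ => hccB j y).trans one_le_two)
    have h1 : ∫ x, Z i x * Z j x ∂μ = ∫ x, (Z i x - F' (cidx p (k j) x)) * Z j x ∂μ := by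
      simp_rw [sub_mul]
      rw [integral_sub, h0, sub_zero]
      · exact integrable_of_bdd ((hZm i).mul (hZm j)) (B := 4) fun x => bmul (hZB i x) (hZB j x)
      · exact integrable_of_bdd (hF'm.mul (hZm j)) (B := 4) fun x => bmul (hFB' _) (hZB j x)
    have h2 : ∀ᵐ x ∂μ, ‖(Z i x - F' (cidx p (k j) x)) * Z j x‖ ≤ (2 * K * p) * (1/2)^(j - i) := by
      filter_upwards [ae_cell_pos μ p (k j)] with x hx
      have hc1 : CE μ p (k j) (fun _ => Z i x) x = Z i x := CE_self μ (fun _ => Z i x) hx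
      have h3 : |Z i x - F' (cidx p (k j) x)| ≤ |ξ i| * ((p:ℝ)^(k j))⁻¹ := by
        rw [hFF']
        nth_rewrite 1 [← hc1]
        refine CE_sub_le μ (integrable_const _) (integrable_of_bdd (hZm i) (hZB i)) (by positivity) ?_
        intro y hy
        have hy2 : cidx p (k i) y = cidx p (k i) x := cell_subset (by omega) hkij x hy
        have hd := dist_le_of_mem_cell (by omega) hy
        simp only [hZ]
        rw [CE_congr μ hy2, sub_sub_sub_cancel_right]
        refine (cos_lip _ _).trans ?_
        rw [show ξ i * x + φ i - (ξ i * y + φ i) = ξ i * (x - y) by ring, abs_mul, abs_sub_comm x y]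
        gcongr
      have h4 : |ξ i| * ((p:ℝ)^(k j))⁻¹ ≤ K * p * (1/2)^(j - i) := by
        calc |ξ i| * ((p:ℝ)^(k j))⁻¹ ≤ (K * (M:ℝ)^i) * (p * ((M:ℝ)^j)⁻¹) :=
              mul_le_mul (hK i) (hpk j) (by positivity) (by positivity)
          _ = K * p * ((M:ℝ)⁻¹)^(j - i) := by
              obtain ⟨d, rfl⟩ := Nat.exists_eq_add_of_le hij
              rw [Nat.add_sub_cancel_left, pow_add, inv_pow]
              field_simp
          _ ≤ K * p * (1/2)^(j - i) := by
              have : (M:ℝ)⁻¹ ≤ 1/2 := by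
                rw [inv_eq_one_div]
                exact one_div_le_one_div_of_le two_pos (by exact_mod_cast hM2)
              gcongr
      rw [Real.norm_eq_abs, abs_mul]
      calc _ ≤ (K * p * (1/2)^(j - i)) * 2 :=
            mul_le_mul (h3.trans h4) (hZB j x) (abs_nonneg _) (by positivity)
        _ = _ := by ring
    rw [h1]
    have := norm_integral_le_of_norm_le_const h2
    simpa using this
  exact slln_of_second_moment Z hZm hZB (second_moment_of_decay hZm hZB hdec)

end Step1


section Step3

variable (μ : Measure ℝ) [IsProbabilityMeasure μ]

lemma hc_int (p : ℕ) (φ s : ℝ) (k : ℕ) : Integrable (fun y => hc φ s ((Tmap p)^[k] y)) μ :=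
  integrable_of_bdd ((hc_measurable φ s).comp (Titer_measurable p k)) (B := 1) fun _ => hc_le _ _ _

lemma step2 (p : ℕ) (hp : 1 ≤ p) {k : ℕ} (hk : 1 ≤ k) (ξ φ x : ℝ) :
    |CE μ p k (fun y => Real.cos (ξ * y + φ)) x| ≤
      |VV μ p (hc 0 (ξ / (p:ℝ)^k)) k x| + |VV μ p (hc (Real.pi/2) (ξ / (p:ℝ)^k)) k x| := by
  have hpk : (0:ℝ) < (p:ℝ)^k := by positivity
  set s := ξ / (p:ℝ)^k with hs
  set ψ := s * cidx p k x + φ with hψ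
  have e : CE μ p k (fun y => Real.cos (ξ * y + φ)) x =
      Real.cos ψ * VV μ p (hc 0 s) k x + Real.sin ψ * VV μ p (hc (Real.pi/2) s) k x := by
    have h1 : ∫ y in cell p k x, Real.cos (ξ * y + φ) ∂μ =
        ∫ y in cell p k x, (Real.cos ψ * hc 0 s ((Tmap p)^[k] y) +
          Real.sin ψ * hc (Real.pi/2) s ((Tmap p)^[k] y)) ∂μ := by
      refine setIntegral_congr_fun (cell_measurable p k x) fun y hy => ?_
      have hy' : ⌊(p:ℝ)^k * y⌋ = cidx p k x := hy
      simp only [hc]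
      rw [Tmap_iterate p k hk, add_zero, Real.cos_add_pi_div_two]
      have h2 := Int.self_sub_floor ((p:ℝ)^k * y)
      rw [hy'] at h2
      have h3 : ξ * y + φ = s * Int.fract ((p:ℝ)^k * y) + ψ := by
        rw [← h2, hψ, hs]; field_simp; ring
      rw [h3, Real.cos_add]; ring
    rw [CE, h1, integral_add ((hc_int μ p 0 s k).integrableOn.const_mul _)
      ((hc_int μ p (Real.pi/2) s k).integrableOn.const_mul _), integral_const_mul, integral_const_mul]
    simp only [VV, CE]; ring
  rw [e]
  refine (abs_add_le _ _).trans (add_le_add ?_ ?_)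
  · rw [abs_mul]; exact mul_le_of_le_one_left (abs_nonneg _) (Real.abs_cos_le_one _)
  · rw [abs_mul]; exact mul_le_of_le_one_left (abs_nonneg _) (Real.abs_sin_le_one _)

lemma VV_lip (p : ℕ) {k : ℕ} (hk : 1 ≤ k) (φ s s' x : ℝ) :
    |VV μ p (hc φ s) k x - VV μ p (hc φ s') k x| ≤ |s - s'| := by
  refine CE_sub_le μ (hc_int μ p φ s k) (hc_int μ p φ s' k) (abs_nonneg _) fun y _ => ?_
  refine (cos_lip _ _).trans ?_
  rw [Tmap_iterate p k hk]
  set u := Int.fract ((p:ℝ)^k * y)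
  have h0 : 0 ≤ u := Int.fract_nonneg _
  have h1 : u ≤ 1 := (Int.fract_lt_one _).le
  rw [show s * u + φ - (s' * u + φ) = (s - s') * u by ring, abs_mul, abs_of_nonneg h0]
  exact mul_le_of_le_one_right (abs_nonneg _) h1

lemma rpow_lip {p : ℝ} (hp : 1 < p) {s t : ℝ} (hs : s ∈ Icc (0:ℝ) 1) (ht : t ∈ Icc (0:ℝ) 1) :
    |p ^ s - p ^ t| ≤ p * Real.log p * |s - t| := by
  have hp0 : 0 < p := by linarith
  have hL := Real.log_pos hp
  have h := (convex_Icc (0:ℝ) 1).norm_image_sub_le_of_norm_hasDerivWithin_le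
    (f := fun t : ℝ => p ^ t) (f' := fun t => Real.log p * p ^ t) (C := p * Real.log p) (x := t) (y := s)
    (fun z _ => (Real.hasStrictDerivAt_const_rpow hp0 z).hasDerivAt.hasDerivWithinAt.congr_deriv
      (by ring)) (fun z hz => by
        have h1 : p ^ z ≤ p := by
          calc p ^ z ≤ p ^ (1:ℝ) := Real.rpow_le_rpow_of_exponent_le hp.le hz.2
            _ = p := Real.rpow_one p
        have h2 := Real.rpow_pos_of_pos hp0 z
        rw [Real.norm_eq_abs, abs_of_pos (by positivity)]
        nlinarith) ht hs
  simpa [Real.norm_eq_abs] using h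

lemma fiber_sum {α : ℝ} (hα : 0 < α) {w : ℕ → ℝ} (hw : ∀ k, 0 ≤ w k) (N : ℕ) :
    ∑ i ∈ Finset.range N, w ⌊i * α⌋₊ ≤ ⌈1/α⌉₊ * ∑ k ∈ Finset.range (⌊N * α⌋₊ + 1), w k := by
  classical
  set Q := ⌈1/α⌉₊ with hQ
  have hQα : 1 ≤ Q * α := by
    have : 1/α ≤ Q := Nat.le_ceil _
    rwa [div_le_iff₀ hα] at this
  have hQ0 : 0 < Q := Nat.ceil_pos.2 (by positivity)
  set f : ℕ → ℕ × ℕ := fun i => (⌊i * α⌋₊, i % Q) with hf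
  have hinj' : ∀ i j : ℕ, i < j → f i ≠ f j := by
    intro i j hij h
    simp only [hf, Prod.mk.injEq] at h
    have hd : Q ∣ j - i := (Nat.modEq_iff_dvd' hij.le).1 h.2
    have hle : Q ≤ j - i := Nat.le_of_dvd (by omega) hd
    have h1 : (i:ℝ) + Q ≤ j := by exact_mod_cast (by omega : i + Q ≤ j)
    have h2 : i * α + 1 ≤ j * α := by nlinarith
    have h3 := Nat.floor_mono h2
    rw [Nat.floor_add_one (by positivity)] at h3
    omega
  have hinj : Function.Injective f := fun i j h => by
    rcases lt_trichotomy i j with h1 | h1 | h1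
    · exact absurd h (hinj' i j h1)
    · exact h1
    · exact absurd h.symm (hinj' j i h1)
  calc ∑ i ∈ Finset.range N, w ⌊i * α⌋₊ = ∑ i ∈ Finset.range N, (fun q : ℕ × ℕ => w q.1) (f i) := rfl
    _ = ∑ q ∈ (Finset.range N).image f, w q.1 := by rw [Finset.sum_image fun a _ b _ h => hinj h]
    _ ≤ ∑ q ∈ Finset.range (⌊N * α⌋₊ + 1) ×ˢ Finset.range Q, w q.1 := by
        refine Finset.sum_le_sum_of_subset_of_nonneg ?_ fun _ _ _ => hw _
        intro q hq
        obtain ⟨i, hi, rfl⟩ := Finset.mem_image.1 hq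
        rw [Finset.mem_product, Finset.mem_range, Finset.mem_range]
        refine ⟨Nat.lt_succ_of_le (Nat.floor_mono ?_), Nat.mod_lt _ hQ0⟩
        have : (i:ℝ) ≤ N := by exact_mod_cast (Finset.mem_range.1 hi).le
        gcongr
    _ = _ := by
        rw [Finset.sum_product]
        simp [Finset.mul_sum]

lemma step3 {p : ℕ} (hp : 2 ≤ p) (hT : Ergodic (Tmap p) μ) (hdim : 0 < measureDim μ)
    {α : ℝ} (hα0 : 0 < α) (hα : Irrational α) {δ ε : ℝ} (hδ : 0 < δ) (hε : 0 < ε) :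
    ∃ κ0 > 0, ∀ κ φ : ℝ, κ0 ≤ |κ| → ∀ s : ℕ → ℝ,
      Tendsto (fun i : ℕ => s i - κ * (p:ℝ) ^ (Int.fract (i * α))) atTop (𝓝 0) →
      μ.real {x | ∃ᶠ N : ℕ in atTop, δ * N <
        ∑ i ∈ Finset.range N, |VV μ p (hc φ (s i)) ⌊i * α⌋₊ x|} ≤ ε := by
  have hTm : MeasurePreserving (Tmap p) μ μ := hT.toMeasurePreserving
  have hp1 : (1:ℝ) < p := by exact_mod_cast (by omega : 1 < p)
  have hp1' : 1 ≤ p := by omega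
  obtain ⟨DC, κ0, hκ0, hC⟩ := claimC μ hp hT hdim (ε := ε * (δ/5) / 8) (by positivity)
  refine ⟨κ0, hκ0, fun κ φ hκ s hs => ?_⟩
  set Q := ⌈1/α⌉₊ with hQ
  have hQ0 : 0 < Q := Nat.ceil_pos.2 (by positivity)
  have hL := Real.log_pos hp1
  set Λ := |κ| * (p * Real.log p) with hΛ
  have hΛ0 : 0 ≤ Λ := by positivity
  obtain ⟨R, hR⟩ := exists_nat_gt (2 * Λ / (δ/5))
  have hR0 : (0:ℝ) < R := lt_of_le_of_lt (by positivity) hR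
  have hRn : 0 < R := by exact_mod_cast hR0
  have hη : 2 * (Λ / R) ≤ δ/5 := by
    rw [div_lt_iff₀ (by positivity)] at hR
    rw [← mul_div_assoc, div_le_iff₀ hR0]; linarith
  set δ' := δ/5 / (R * Q * (α + 1)) with hδ'
  have hδ'0 : 0 < δ' := by positivity
  set H : ℝ → ℝ → ℝ := fun t => hc φ (κ * (p:ℝ) ^ t) with hH
  choose D0 hD0 using fun r : ℕ => maker μ hp1' hTm (hc_measurable φ (κ * (p:ℝ) ^ ((r:ℝ)/R)))
    (hc_le φ _) hδ'0 (ε := ε / (2 * R)) (by positivity)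
  set D := max 1 (max DC ((Finset.range R).sup D0)) with hD
  have hD1 : 1 ≤ D := le_max_left _ _
  have hDC : DC ≤ D := (le_max_left _ _).trans (le_max_right _ _)
  have hDr : ∀ r ∈ Finset.range R, D0 r ≤ D := fun r hr =>
    (Finset.le_sup hr).trans ((le_max_right _ _).trans (le_max_right _ _))
  set k : ℕ → ℕ := fun i => ⌊i * α⌋₊ with hk
  set θ : ℕ → ℝ := fun i => Int.fract (i * α) with hθ
  have hθ01 : ∀ i, θ i ∈ Icc (0:ℝ) 1 := fun i => ⟨Int.fract_nonneg _, (Int.fract_lt_one _).le⟩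
  set W : ℕ → ℕ → ℝ → ℝ := fun r n x => if D ≤ n then
    |VV μ p (H ((r:ℝ)/R)) n x - VV μ p (H ((r:ℝ)/R)) D ((Tmap p)^[n-D] x)| else 0 with hW
  have hW0 : ∀ r n x, 0 ≤ W r n x := fun r n x => by
    simp only [hW]; split_ifs; exacts [abs_nonneg _, le_rfl]
  set G : ℝ × ℝ → ℝ := fun q => |VV μ p (H q.1) D q.2| with hG
  set g : ℕ → ℝ → ℝ := fun i x => if D ≤ k i then G (θ i, (Tmap p)^[k i - D] x) else 0 with hg
  set e : ℕ → ℝ := fun i => |s i - κ * (p:ℝ) ^ (θ i)| + if D ≤ k i then 0 else 1 with he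
  have hHlip : ∀ t ∈ Icc (0:ℝ) 1, ∀ t' ∈ Icc (0:ℝ) 1, ∀ n, 1 ≤ n → ∀ x,
      |VV μ p (H t) n x - VV μ p (H t') n x| ≤ Λ * |t - t'| := by
    intro t ht t' ht' n hn x
    refine (VV_lip μ p hn φ _ _ x).trans ?_
    rw [← mul_sub, abs_mul, hΛ, mul_assoc]
    gcongr
    exact rpow_lip hp1 ht ht'
  set E1 : ℕ → Set ℝ := fun r => {x | ∃ N : ℕ, δ' * N < ∑ n ∈ Finset.range N, W r n x} with hE1
  set E2 : Set ℝ := {x | ∃ᶠ N : ℕ in atTop, δ/5 * N < ∑ i ∈ Finset.range N, g i x} with hE2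
  have hE1m : ∀ r ∈ Finset.range R, μ.real (E1 r) ≤ ε / (2 * R) := fun r hr => hD0 r D (hDr r hr)
  have hGm : Measurable G := by
    have := VV_hc_joint μ hp1' φ κ D
    exact this.abs
  have hGB : ∀ q, G q ≤ 1 := fun q => VV_le μ p (hc_le _ _) D _
  have hE2m : μ.real E2 ≤ ε / 2 := by
    have hB := claimB μ hTm hα0 hα hGm (B := 1) (Λ := Λ) (fun q => abs_nonneg _) hGB
      (fun t ht t' ht' x => by
        refine (abs_abs_sub_abs_le_abs_sub _ _).trans ?_
        exact hHlip t ⟨ht.1, ht.2.le⟩ t' ⟨ht'.1, ht'.2.le⟩ D hD1 x) (δ := δ/5) (by positivity)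
    have hCC := hC D hDC φ κ hκ
    have h1 : 4 / (δ/5) * ∫ q, G q ∂(lam.prod μ) ≤ ε / 2 := by
      calc _ ≤ 4 / (δ/5) * (ε * (δ/5) / 8) := by gcongr
        _ = ε / 2 := by field_simp; ring
    refine le_trans ?_ (hB.trans h1)
    have hgm : ∀ N : ℕ, Measurable fun x => ∑ i ∈ Finset.range N, g i x := fun N => by
      refine Finset.measurable_sum _ fun i _ => ?_
      simp only [hg]
      split_ifs
      · exact hGm.comp (measurable_const.prodMk (Titer_measurable p _))
      · exact measurable_const
    have hms : MeasurableSet E2 := by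
      have : E2 = limsup (fun N : ℕ => {x | δ/5 * N < ∑ i ∈ Finset.range N, g i x}) atTop := by
        ext y; rw [mem_limsup_iff_frequently_mem]; rfl
      rw [this]
      exact MeasurableSet.measurableSet_limsup fun N => measurableSet_lt measurable_const (hgm N)
    have h2 : μ.real E2 = μ.real ((Tmap p)^[D] ⁻¹' E2) := by
      rw [Measure.real, Measure.real, (hTm.iterate D).measure_preimage hms.nullMeasurableSet]
    rw [h2]
    refine measureReal_mono ?_
    intro x hx
    have hx' : ∃ᶠ N : ℕ in atTop, δ/5 * N < ∑ i ∈ Finset.range N, g i ((Tmap p)^[D] x) := hx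
    refine hx'.mono fun N hN => lt_of_lt_of_le hN (Finset.sum_le_sum fun i _ => ?_)
    simp only [hg]
    split_ifs with h
    · rw [← Function.iterate_add_apply, Nat.sub_add_cancel h]
    · exact abs_nonneg _
  have hek : ∀ᶠ i : ℕ in atTop, D ≤ k i := by
    have h1 : Tendsto (fun i : ℕ => (i:ℝ) * α) atTop atTop :=
      tendsto_natCast_atTop_atTop.atTop_mul_const hα0
    filter_upwards [h1.eventually_ge_atTop (D:ℝ)] with i hi
    exact Nat.le_floor hi
  have he0 : Tendsto e atTop (𝓝 0) := by
    have h1 := hs.abs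
    rw [abs_zero] at h1
    refine h1.congr' ?_
    filter_upwards [hek] with i hi
    simp only [he, if_pos hi, add_zero, hθ]
  have heN : ∀ᶠ N : ℕ in atTop, ∑ i ∈ Finset.range N, e i ≤ δ/5 * N := by
    have h1 := he0.cesaro
    filter_upwards [h1.eventually_le_const (by positivity : 0 < δ/5), eventually_gt_atTop 0] with N hN hN0
    have hN0' : (0:ℝ) < N := by exact_mod_cast hN0
    rwa [inv_mul_le_iff₀ hN0', mul_comm] at hN
  have hterm : ∀ i x, |VV μ p (hc φ (s i)) (k i) x| ≤
      e i + 2 * (Λ / R) + ∑ r ∈ Finset.range R, W r (k i) x + g i x := by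
    intro i x
    by_cases hki : D ≤ k i
    · simp only [he, hg, if_pos hki, add_zero]
      have hk1 : 1 ≤ k i := hD1.trans hki
      set r := ⌊(R:ℝ) * θ i⌋₊ with hr
      have hRθ : 0 ≤ (R:ℝ) * θ i := mul_nonneg hR0.le (hθ01 i).1
      have hrR : r ∈ Finset.range R := by
        rw [Finset.mem_range, hr, Nat.floor_lt hRθ]
        have : θ i < 1 := Int.fract_lt_one _
        nlinarith
      have hr1 := Nat.floor_le hRθ
      have hr2 := Nat.lt_floor_add_one ((R:ℝ) * θ i)
      rw [← hr] at hr1 hr2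
      have hrI : (r:ℝ)/R ∈ Icc (0:ℝ) 1 := ⟨by positivity, by
        rw [div_le_one hR0]; exact_mod_cast (Finset.mem_range.1 hrR).le⟩
      have hclose : |θ i - (r:ℝ)/R| ≤ 1 / R := by
        have h3 : θ i - (r:ℝ)/R = (R * θ i - r) / R := by field_simp
        rw [h3, abs_div, abs_of_pos hR0, abs_of_nonneg (by linarith)]
        gcongr; linarith
      have hcl : Λ * |θ i - (r:ℝ)/R| ≤ Λ / R := by
        calc _ ≤ Λ * (1/R) := by gcongr
          _ = Λ / R := by ring
      have a1 := VV_lip μ p hk1 φ (s i) (κ * (p:ℝ) ^ (θ i)) x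
      have a2 := (hHlip (θ i) (hθ01 i) _ hrI (k i) hk1 x).trans hcl
      have a3 := (hHlip (θ i) (hθ01 i) _ hrI D hD1 ((Tmap p)^[k i - D] x)).trans hcl
      have a4 : W r (k i) x ≤ ∑ r ∈ Finset.range R, W r (k i) x :=
        Finset.single_le_sum (f := fun r => W r (k i) x) (fun r _ => hW0 r _ _) hrR
      simp only [hW, if_pos hki] at a4 ⊢
      simp only [hG]
      simp only [hH] at *
      generalize VV μ p (hc φ (s i)) (k i) x = v0 at *
      generalize VV μ p (hc φ (κ * (p:ℝ) ^ (θ i))) (k i) x = v1 at *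
      generalize VV μ p (hc φ (κ * (p:ℝ) ^ ((r:ℝ)/R))) (k i) x = v2 at *
      generalize VV μ p (hc φ (κ * (p:ℝ) ^ ((r:ℝ)/R))) D ((Tmap p)^[k i - D] x) = v3 at *
      generalize VV μ p (hc φ (κ * (p:ℝ) ^ (θ i))) D ((Tmap p)^[k i - D] x) = v4 at *
      have b1 : |v0| ≤ |v0 - v1| + |v1 - v2| + |v2 - v3| + |v4 - v3| + |v4| := by
        have t1 := abs_add_le (v0 - v1) v1
        have t2 := abs_add_le (v1 - v2) v2
        have t3 := abs_add_le (v2 - v3) v3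
        have t4 := abs_add_le (v3 - v4) v4
        rw [abs_sub_comm v3 v4] at t4
        simp only [sub_add_cancel] at t1 t2 t3 t4
        linarith
      linarith
    · have h1 : |VV μ p (hc φ (s i)) (k i) x| ≤ 1 := VV_le μ p (hc_le _ _) _ _
      have h2 : 0 ≤ ∑ r ∈ Finset.range R, W r (k i) x := Finset.sum_nonneg fun r _ => hW0 r _ _
      simp only [he, hg, if_neg hki, add_zero]
      have h3 : 0 ≤ 2 * (Λ / R) := by positivity
      linarith [abs_nonneg (s i - κ * (p:ℝ) ^ (θ i))]
  have hsub : {x | ∃ᶠ N : ℕ in atTop, δ * N <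
      ∑ i ∈ Finset.range N, |VV μ p (hc φ (s i)) ⌊i * α⌋₊ x|} ⊆
      (⋃ r ∈ Finset.range R, E1 r) ∪ E2 := by
    intro x hx
    by_contra hcon
    rw [mem_union, not_or] at hcon
    obtain ⟨hc1, hc2⟩ := hcon
    have hx' : ∃ᶠ N : ℕ in atTop, δ * N <
      ∑ i ∈ Finset.range N, |VV μ p (hc φ (s i)) ⌊i * α⌋₊ x| := hx
    have hc2' : ∀ᶠ N : ℕ in atTop, ∑ i ∈ Finset.range N, g i x ≤ δ/5 * N := by
      have : ¬ ∃ᶠ N : ℕ in atTop, δ/5 * N < ∑ i ∈ Finset.range N, g i x := hc2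
      rw [not_frequently] at this
      exact this.mono fun N hN => not_lt.1 hN
    have hc1' : ∀ r ∈ Finset.range R, ∀ N : ℕ, ∑ n ∈ Finset.range N, W r n x ≤ δ' * N := by
      intro r hr N
      by_contra h
      push Not at h
      exact hc1 (mem_biUnion hr ⟨N, h⟩)
    obtain ⟨N, hN, hN1, hN2, hN3⟩ := (hx'.and_eventually
      (heN.and (hc2'.and (eventually_gt_atTop 0)))).exists
    have hN1' : (1:ℝ) ≤ N := by exact_mod_cast hN3
    have hWs : ∑ i ∈ Finset.range N, ∑ r ∈ Finset.range R, W r (k i) x ≤ δ/5 * N := by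
      rw [Finset.sum_comm]
      have h1 : ∀ r ∈ Finset.range R, ∑ i ∈ Finset.range N, W r (k i) x ≤
          Q * (δ' * ((α + 1) * N)) := by
        intro r hr
        refine (fiber_sum hα0 (w := fun n => W r n x) (fun n => hW0 r n x) N).trans ?_
        refine mul_le_mul_of_nonneg_left ((hc1' r hr _).trans ?_) (by positivity)
        refine mul_le_mul_of_nonneg_left ?_ hδ'0.le
        push_cast
        have := Nat.floor_le (by positivity : 0 ≤ N * α)
        nlinarith
      refine (Finset.sum_le_sum h1).trans (le_of_eq ?_)
      rw [Finset.sum_const, Finset.card_range, nsmul_eq_mul, hδ']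
      have : (0:ℝ) < Q := by exact_mod_cast hQ0
      field_simp
    have hfin := Finset.sum_le_sum fun i (_ : i ∈ Finset.range N) => hterm i x
    rw [Finset.sum_add_distrib, Finset.sum_add_distrib, Finset.sum_add_distrib] at hfin
    simp only [Finset.sum_const, Finset.card_range, nsmul_eq_mul] at hfin
    have h4 : (N:ℝ) * (2 * (Λ / R)) ≤ δ/5 * N := by nlinarith
    have hN' : δ * N < ∑ i ∈ Finset.range N, |VV μ p (hc φ (s i)) (k i) x| := hN
    nlinarith
  calc _ ≤ μ.real ((⋃ r ∈ Finset.range R, E1 r) ∪ E2) := measureReal_mono hsub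
    _ ≤ μ.real (⋃ r ∈ Finset.range R, E1 r) + μ.real E2 := measureReal_union_le _ _
    _ ≤ ∑ r ∈ Finset.range R, μ.real (E1 r) + ε/2 := by
        gcongr; exact measureReal_biUnion_finset_le _ _
    _ ≤ ∑ r ∈ Finset.range R, ε / (2 * R) + ε/2 := by
        gcongr with r hr; exact hE1m r hr
    _ = ε := by
        rw [Finset.sum_const, Finset.card_range, nsmul_eq_mul]; field_simp; ring

end Step3


section Main1

variable (μ : Measure ℝ) [IsProbabilityMeasure μ]

lemma main_quant {p : ℕ} (hp : 2 ≤ p) (hT : Ergodic (Tmap p) μ) (hdim : 0 < measureDim μ)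
    {M : ℕ} (hM2 : 2 ≤ M) {α : ℝ} (hα0 : 0 < α) (hα : Irrational α) (hM : (M:ℝ) = (p:ℝ) ^ α)
    (ξ φ : ℕ → ℝ) {κ : ℝ} (hκ : κ ≠ 0)
    (hξ : Tendsto (fun i : ℕ => ξ i / (M:ℝ)^i) atTop (𝓝 κ)) {δ ε : ℝ} (hδ : 0 < δ) (hε : 0 < ε) :
    μ.real {x | ∃ᶠ N : ℕ in atTop, δ * N <
        |∑ i ∈ Finset.range N, Real.cos (ξ i * x + φ i)|} ≤ ε := by
  have hM0 : (0:ℝ) < M := by positivity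
  have hM1 : (1:ℝ) < M := by exact_mod_cast (by omega : 1 < M)
  have hp1 : (1:ℝ) < p := by exact_mod_cast (by omega : 1 < p)
  obtain ⟨κ0, hκ0, h3⟩ := step3 μ hp hT hdim hα0 hα (δ := δ/4) (ε := ε/2) (by positivity) (by positivity)
  obtain ⟨j, hj⟩ : ∃ j : ℕ, κ0 / |κ| < (M:ℝ)^j := pow_unbounded_of_one_lt _ hM1
  have hκp : 0 < |κ| := abs_pos.2 hκ
  set κ' := κ * (M:ℝ)^j with hκ'
  have hκ'0 : κ0 ≤ |κ'| := by
    rw [hκ', abs_mul, abs_of_pos (by positivity : (0:ℝ) < (M:ℝ)^j)]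
    rw [div_lt_iff₀ hκp] at hj; linarith
  set ξ' : ℕ → ℝ := fun i => ξ (j + i) with hξ'
  set φ' : ℕ → ℝ := fun i => φ (j + i) with hφ'
  have hξ'l : Tendsto (fun i : ℕ => ξ' i / (M:ℝ)^i) atTop (𝓝 κ') := by
    have h1 := ((hξ.comp (tendsto_add_atTop_nat j)).mul_const ((M:ℝ)^j))
    refine h1.congr fun i => ?_
    simp only [Function.comp, hξ']
    rw [add_comm i j, pow_add]; field_simp
  obtain ⟨K, hK⟩ : ∃ K, ∀ i, |ξ' i| ≤ K * (M:ℝ)^i := by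
    obtain ⟨K, hK⟩ := hξ'l.abs.bddAbove_range
    refine ⟨K, fun i => ?_⟩
    have := hK ⟨i, rfl⟩
    simp only [abs_div, abs_of_pos (pow_pos hM0 i)] at this
    rwa [div_le_iff₀ (pow_pos hM0 i)] at this
  have h1 := step1 μ hp hM2 hα0 hM ξ' φ' hK
  set s : ℕ → ℝ := fun i => ξ' i / (p:ℝ) ^ ⌊i * α⌋₊ with hs
  have hsl : Tendsto (fun i : ℕ => s i - κ' * (p:ℝ) ^ (Int.fract (i * α))) atTop (𝓝 0) := by
    have e : ∀ i : ℕ, s i - κ' * (p:ℝ) ^ (Int.fract (i * α)) =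
        (ξ' i / (M:ℝ)^i - κ') * (p:ℝ) ^ (Int.fract (i * α)) := by
      intro i
      have h2 := pow_floor_bound hp hα0 hM i
      have h4 : (0:ℝ) < (p:ℝ) ^ ⌊i * α⌋₊ := by positivity
      have h5 : (0:ℝ) < (p:ℝ) ^ (Int.fract (i * α)) := by positivity
      rw [h2, hs]; field_simp
    simp only [e]
    have h0 : Tendsto (fun i : ℕ => |ξ' i / (M:ℝ)^i - κ'| * p) atTop (𝓝 0) := by
      have := ((hξ'l.sub_const κ').abs).mul_const (p:ℝ)
      simpa using this
    refine squeeze_zero_norm (fun i => ?_) h0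
    rw [Real.norm_eq_abs, abs_mul, abs_of_nonneg (by positivity : (0:ℝ) ≤ (p:ℝ) ^ (Int.fract (i * α)))]
    refine mul_le_mul_of_nonneg_left ?_ (abs_nonneg _)
    calc (p:ℝ) ^ (Int.fract (i * α)) ≤ (p:ℝ) ^ (1:ℝ) :=
          Real.rpow_le_rpow_of_exponent_le hp1.le (Int.fract_lt_one _).le
      _ = p := Real.rpow_one _
  set B1 := {x | ∃ᶠ N : ℕ in atTop, δ/4 * N <
        ∑ i ∈ Finset.range N, |VV μ p (hc 0 (s i)) ⌊i * α⌋₊ x|} with hB1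
  set B2 := {x | ∃ᶠ N : ℕ in atTop, δ/4 * N <
        ∑ i ∈ Finset.range N, |VV μ p (hc (Real.pi/2) (s i)) ⌊i * α⌋₊ x|} with hB2
  have hb1 : μ.real B1 ≤ ε/2 := h3 κ' 0 hκ'0 s hsl
  have hb2 : μ.real B2 ≤ ε/2 := h3 κ' (Real.pi/2) hκ'0 s hsl
  obtain ⟨J, hJ⟩ := exists_nat_gt (1/α)
  have hkJ : ∀ i : ℕ, J ≤ i → 1 ≤ ⌊i * α⌋₊ := by
    intro i hi
    rw [Nat.one_le_floor_iff]
    rw [div_lt_iff₀ hα0] at hJ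
    have : (J:ℝ) ≤ i := by exact_mod_cast hi
    nlinarith
  have key : ∀ᵐ x ∂μ, x ∈ {x | ∃ᶠ N : ℕ in atTop, δ * N <
        |∑ i ∈ Finset.range N, Real.cos (ξ i * x + φ i)|} → x ∈ B1 ∪ B2 := by
    filter_upwards [h1] with x hx hbad
    by_contra hnot
    rw [mem_union, not_or] at hnot
    obtain ⟨n1, n2⟩ := hnot
    simp only [hB1, hB2, mem_ofPred_eq, not_frequently, not_lt] at n1 n2
    refine hbad ?_
    have e1 : ∀ᶠ N : ℕ in atTop, |∑ i ∈ Finset.range N,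
      (Real.cos (ξ' i * x + φ' i) - CE μ p ⌊i * α⌋₊ (fun y => Real.cos (ξ' i * y + φ' i)) x)| ≤ δ/8 * N := by
      have := (Metric.tendsto_nhds.1 hx) (δ/8) (by positivity)
      filter_upwards [this, eventually_gt_atTop 0] with N hN hN0
      have hN0' : (0:ℝ) < N := by exact_mod_cast hN0
      rw [Real.dist_eq, sub_zero, abs_mul, abs_of_pos (by positivity : (0:ℝ) < 1/N)] at hN
      rw [one_div, inv_mul_lt_iff₀ hN0'] at hN
      linarith
    have e2 : ∀ᶠ N : ℕ in atTop, (J + 2 * j : ℝ) ≤ δ/8 * N := by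
      have : Tendsto (fun N : ℕ => δ/8 * (N:ℝ)) atTop atTop :=
        tendsto_natCast_atTop_atTop.const_mul_atTop (by positivity)
      exact this.eventually_ge_atTop _
    filter_upwards [e1, e2, n1, n2] with N f1 f2 f3 f4
    rw [not_lt]
    have g1 : ∀ i : ℕ, |CE μ p ⌊i * α⌋₊ (fun y => Real.cos (ξ' i * y + φ' i)) x| ≤
        |VV μ p (hc 0 (s i)) ⌊i * α⌋₊ x| + |VV μ p (hc (Real.pi/2) (s i)) ⌊i * α⌋₊ x| +
        (if i < J then 1 else 0) := by
      intro i
      by_cases hi : i < J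
      · have : |CE μ p ⌊i * α⌋₊ (fun y => Real.cos (ξ' i * y + φ' i)) x| ≤ 1 :=
          CE_le μ zero_le_one fun y _ => Real.abs_cos_le_one _
        rw [if_pos hi]
        have a1 := abs_nonneg (VV μ p (hc 0 (s i)) ⌊i * α⌋₊ x)
        have a2 := abs_nonneg (VV μ p (hc (Real.pi/2) (s i)) ⌊i * α⌋₊ x)
        linarith
      · rw [if_neg hi, add_zero]
        exact step2 μ p (by omega) (hkJ i (not_lt.1 hi)) _ _ _
    have g2 : ∑ i ∈ Finset.range N, (if i < J then (1:ℝ) else 0) ≤ J := by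
      rw [← Finset.sum_filter, Finset.sum_const, nsmul_eq_mul, mul_one]
      have : ((Finset.range N).filter (fun i => i < J)).card ≤ J := by
        calc _ ≤ (Finset.range J).card := Finset.card_le_card (fun i hi => by
              rw [Finset.mem_filter] at hi; exact Finset.mem_range.2 hi.2)
          _ = J := Finset.card_range J
      exact_mod_cast this
    have g3 : |∑ i ∈ Finset.range N, CE μ p ⌊i * α⌋₊ (fun y => Real.cos (ξ' i * y + φ' i)) x| ≤
        δ/4 * N + δ/4 * N + J := by
      refine (Finset.abs_sum_le_sum_abs _ _).trans ((Finset.sum_le_sum fun i _ => g1 i).trans ?_)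
      rw [Finset.sum_add_distrib, Finset.sum_add_distrib]
      linarith
    have g4 : |∑ i ∈ Finset.range N, Real.cos (ξ' i * x + φ' i)| ≤ δ/8*N + δ/4 * N + δ/4 * N + J := by
      rw [Finset.sum_sub_distrib] at f1
      have := abs_sub_abs_le_abs_sub (∑ i ∈ Finset.range N, Real.cos (ξ' i * x + φ' i))
        (∑ i ∈ Finset.range N, CE μ p ⌊i * α⌋₊ (fun y => Real.cos (ξ' i * y + φ' i)) x)
      linarith
    have b : ∀ (n : ℕ) (w : ℕ → ℝ), |∑ i ∈ Finset.range n, Real.cos (w i)| ≤ n := by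
      intro n w
      refine (Finset.abs_sum_le_sum_abs _ _).trans
        ((Finset.sum_le_sum fun i _ => Real.abs_cos_le_one _).trans ?_)
      simp
    have q1 := Finset.sum_range_add (fun i => Real.cos (ξ i * x + φ i)) j N
    have q2 := Finset.sum_range_add (fun i => Real.cos (ξ i * x + φ i)) N j
    rw [add_comm N j] at q2
    have b1 := b j (fun i => ξ i * x + φ i)
    have b2 := b j (fun i => ξ (N + i) * x + φ (N + i))
    simp only [hξ', hφ'] at g4
    rw [abs_le] at b1 b2 g4 ⊢
    constructor <;> linarith [b1.1, b1.2, b2.1, b2.2, g4.1, g4.2]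
  have hle : μ {x | ∃ᶠ N : ℕ in atTop, δ * N <
        |∑ i ∈ Finset.range N, Real.cos (ξ i * x + φ i)|} ≤ μ (B1 ∪ B2) := measure_mono_ae key
  have : μ.real {x | ∃ᶠ N : ℕ in atTop, δ * N <
        |∑ i ∈ Finset.range N, Real.cos (ξ i * x + φ i)|} ≤ μ.real (B1 ∪ B2) :=
    ENNReal.toReal_mono (measure_ne_top _ _) hle
  have := measureReal_union_le (μ := μ) B1 B2
  linarith

lemma main_single {p : ℕ} (hp : 2 ≤ p) (hT : Ergodic (Tmap p) μ) (hdim : 0 < measureDim μ)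
    {M : ℕ} (hM2 : 2 ≤ M) (hind : Irrational (Real.log p / Real.log M))
    (ξ φ : ℕ → ℝ) {κ : ℝ} (hκ : κ ≠ 0)
    (hξ : Tendsto (fun i : ℕ => ξ i / (M:ℝ)^i) atTop (𝓝 κ)) :
    ∀ᵐ x ∂μ, Tendsto (fun N : ℕ => (1 / N : ℝ) *
      ∑ i ∈ Finset.range N, Real.cos (ξ i * x + φ i)) atTop (𝓝 0) := by
  have hM1 : (1:ℝ) < M := by exact_mod_cast (by omega : 1 < M)
  have hp1 : (1:ℝ) < p := by exact_mod_cast (by omega : 1 < p)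
  have lM := Real.log_pos hM1
  have lp := Real.log_pos hp1
  have hα : Irrational (Real.log M / Real.log p) := by
    rw [← inv_div]; exact hind.inv
  have hM : (M:ℝ) = (p:ℝ) ^ (Real.log M / Real.log p) := by
    rw [Real.rpow_def_of_pos (by linarith), mul_div_cancel₀ _ lp.ne', Real.exp_log (by linarith)]
  have hz : ∀ n : ℕ, μ {x | ∃ᶠ N : ℕ in atTop, (1/((n:ℝ)+1)) * N <
        |∑ i ∈ Finset.range N, Real.cos (ξ i * x + φ i)|} = 0 := by
    intro n
    rw [← measureReal_eq_zero_iff (measure_ne_top _ _)]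
    refine le_antisymm (le_of_forall_pos_le_add fun ε hε => ?_) measureReal_nonneg
    rw [zero_add]
    exact main_quant μ hp hT hdim hM2 (div_pos lM lp) hα hM ξ φ hκ hξ (by positivity) hε
  have hae : ∀ᵐ x ∂μ, ∀ n : ℕ, ∀ᶠ N : ℕ in atTop,
      |∑ i ∈ Finset.range N, Real.cos (ξ i * x + φ i)| ≤ (1/((n:ℝ)+1)) * N := by
    rw [ae_all_iff]; intro n
    have := compl_mem_ae_iff.2 (hz n)
    filter_upwards [this] with x hx
    simpa only [mem_compl_iff, mem_ofPred_eq, not_frequently, not_lt] using hx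
  filter_upwards [hae] with x hx
  rw [Metric.tendsto_nhds]
  intro ε hε
  obtain ⟨n, hn⟩ := exists_nat_one_div_lt hε
  filter_upwards [hx n, eventually_gt_atTop 0] with N hN hN0
  have hN0' : (0:ℝ) < N := by exact_mod_cast hN0
  rw [Real.dist_eq, sub_zero, abs_mul, abs_of_pos (by positivity : (0:ℝ) < 1/N), one_div,
    inv_mul_lt_iff₀ hN0']
  calc _ ≤ _ := hN
    _ < N * ε := by nlinarith

end Main1


section Weyl

/-- The point of the two-torus with coordinates `s, t`. -/
noncomputable def tpt (q : ℝ × ℝ) : UnitAddTorus (Fin 2) := ![(q.1 : UnitAddCircle), (q.2 : UnitAddCircle)]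

/-- Lebesgue measure on the unit square. -/
noncomputable def sqm : Measure (ℝ × ℝ) :=
  (volume.restrict (Set.Icc (0:ℝ) 1)).prod (volume.restrict (Set.Icc (0:ℝ) 1))

lemma unit_prob : IsProbabilityMeasure ((volume : Measure ℝ).restrict (Set.Icc (0:ℝ) 1)) :=
  ⟨by simp⟩

instance sqm_prob : IsProbabilityMeasure sqm := by
  have := unit_prob
  unfold sqm; infer_instance

lemma tpt_continuous : Continuous tpt := by
  refine continuous_pi fun i => ?_
  fin_cases i
  · exact (AddCircle.continuous_mk' (1:ℝ)).comp continuous_fst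
  · exact (AddCircle.continuous_mk' (1:ℝ)).comp continuous_snd

lemma mF_tpt (n : Fin 2 → ℤ) (q : ℝ × ℝ) : UnitAddTorus.mFourier n (tpt q) =
    Complex.exp (2 * Real.pi * Complex.I * n 0 * q.1) * Complex.exp (2 * Real.pi * Complex.I * n 1 * q.2) := by
  simp only [UnitAddTorus.mFourier, ContinuousMap.coe_mk, Fin.prod_univ_two, tpt]
  simp [fourier_coe_apply]

lemma int_exp_zero {k : ℤ} (hk : k ≠ 0) :
    ∫ s in Set.Icc (0:ℝ) 1, Complex.exp (2 * Real.pi * Complex.I * k * s) = 0 := by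
  rw [integral_Icc_eq_integral_Ioc, ← intervalIntegral.integral_of_le zero_le_one]
  have hc : (2 * Real.pi * Complex.I * k : ℂ) ≠ 0 := by
    simp [hk, Real.pi_ne_zero]
  rw [integral_exp_mul_complex hc]
  have : Complex.exp (2 * Real.pi * Complex.I * k * (1:ℝ)) = 1 := by
    rw [Complex.exp_eq_one_iff]; exact ⟨k, by push_cast; ring⟩
  rw [this]; simp

lemma G_int (G : C(UnitAddTorus (Fin 2), ℂ)) : Integrable (fun q => G (tpt q)) sqm := by
  refine Integrable.of_bound (C := ‖G‖) (G.continuous.comp tpt_continuous).aestronglyMeasurable ?_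
  exact Eventually.of_forall fun q => G.norm_coe_le_norm _

lemma weyl_complex {u v : ℕ → ℝ}
    (h : ∀ k l : ℤ, ¬ (k = 0 ∧ l = 0) → ∀ φ : ℝ, φ = 0 ∨ φ = -(Real.pi/2) →
      Tendsto (fun N : ℕ => (1 / N : ℝ) * ∑ i ∈ Finset.range N,
        Real.cos (2 * Real.pi * (k * u i + l * v i) + φ)) atTop (𝓝 0))
    (G : C(UnitAddTorus (Fin 2), ℂ)) :
    Tendsto (fun N : ℕ => (1 / N : ℂ) * ∑ i ∈ Finset.range N, G (tpt (u i, v i))) atTop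
      (𝓝 (∫ q, G (tpt q) ∂sqm)) := by
  have hmem : G ∈ (Submodule.span ℂ (Set.range (UnitAddTorus.mFourier (d := Fin 2)))).topologicalClosure := by
    rw [UnitAddTorus.span_mFourier_closure_eq_top]; trivial
  have hspan : ∀ H ∈ Submodule.span ℂ (Set.range (UnitAddTorus.mFourier (d := Fin 2))),
      Tendsto (fun N : ℕ => (1 / N : ℂ) * ∑ i ∈ Finset.range N, H (tpt (u i, v i))) atTop
      (𝓝 (∫ q, H (tpt q) ∂sqm)) := by
    intro H hH
    induction hH using Submodule.span_induction with
    | zero => simp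
    | add x y _ _ hx hy =>
      have e : ∫ q, (x + y) (tpt q) ∂sqm = ∫ q, x (tpt q) ∂sqm + ∫ q, y (tpt q) ∂sqm :=
        integral_add (G_int x) (G_int y)
      rw [e]
      refine (hx.add hy).congr fun N => ?_
      simp only [ContinuousMap.add_apply, Finset.sum_add_distrib]; ring
    | smul a x _ hx =>
      have e : ∫ q, (a • x) (tpt q) ∂sqm = a * ∫ q, x (tpt q) ∂sqm := integral_const_mul _ _
      rw [e]
      refine (hx.const_mul a).congr fun N => ?_
      simp only [ContinuousMap.smul_apply, smul_eq_mul, ← Finset.mul_sum]; ring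
    | mem x hx =>
      obtain ⟨n, rfl⟩ := hx
      by_cases hn : n 0 = 0 ∧ n 1 = 0
      · have h1 : ∀ q, UnitAddTorus.mFourier n (tpt q) = 1 := fun q => by
          rw [mF_tpt, hn.1, hn.2]; simp
        simp only [h1]
        simp only [Finset.sum_const, Finset.card_range, nsmul_eq_mul, mul_one, integral_const,
          probReal_univ, one_smul]
        refine tendsto_const_nhds.congr' ?_
        filter_upwards [eventually_gt_atTop 0] with N hN
        have : (N:ℂ) ≠ 0 := by exact_mod_cast hN.ne'
        field_simp
      · have h0 : ∫ q, UnitAddTorus.mFourier n (tpt q) ∂sqm = 0 := by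
          simp only [mF_tpt]
          have := unit_prob
          rw [sqm, integral_prod_mul (fun s : ℝ => Complex.exp (2 * Real.pi * Complex.I * n 0 * s))
            (fun s : ℝ => Complex.exp (2 * Real.pi * Complex.I * n 1 * s))]
          by_cases h1 : n 0 = 0
          · rw [int_exp_zero (k := n 1) (fun h2 => hn ⟨h1, h2⟩), mul_zero]
          · rw [int_exp_zero (k := n 0) h1, zero_mul]
        rw [h0]
        have c1 := h (n 0) (n 1) hn 0 (Or.inl rfl)
        have c2 := h (n 0) (n 1) hn _ (Or.inr rfl)
        have c1' := (Complex.continuous_ofReal.tendsto 0).comp c1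
        have c2' := ((Complex.continuous_ofReal.tendsto 0).comp c2).mul_const Complex.I
        have c3 := c1'.add c2'
        simp only [Complex.ofReal_zero, zero_mul, add_zero] at c3
        refine c3.congr fun N => ?_
        simp only [Function.comp]
        push_cast
        rw [mul_assoc, ← mul_add, Finset.sum_mul, ← Finset.sum_add_distrib]
        congr 1
        refine Finset.sum_congr rfl fun i _ => ?_
        rw [mF_tpt, ← Complex.exp_add]
        have e1 : (2 * Real.pi * Complex.I * n 0 * (u i, v i).1 + 2 * Real.pi * Complex.I * n 1 * (u i, v i).2 : ℂ)
          = ((2 * Real.pi * (n 0 * u i + n 1 * v i) : ℝ) : ℂ) * Complex.I := by push_cast; ring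
        rw [e1, Complex.exp_mul_I]
        congr 1
        · push_cast; simp
        · congr 1
          rw [← sub_eq_add_neg, Complex.cos_sub_pi_div_two]; push_cast; simp
  rw [Metric.tendsto_nhds]
  intro ε hε
  have hcl : G ∈ closure (Submodule.span ℂ (Set.range (UnitAddTorus.mFourier (d := Fin 2))) :
      Set C(UnitAddTorus (Fin 2), ℂ)) := hmem
  obtain ⟨H, hH, hGH⟩ := Metric.mem_closure_iff.1 hcl (ε/4) (by positivity)
  have hd : ∀ y, ‖G y - H y‖ ≤ ε/4 := fun y => by
    rw [← dist_eq_norm]; exact (ContinuousMap.dist_apply_le_dist y).trans hGH.le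
  have hI : ‖∫ q, G (tpt q) ∂sqm - ∫ q, H (tpt q) ∂sqm‖ ≤ ε/4 := by
    rw [← integral_sub (G_int G) (G_int H)]
    have := norm_integral_le_of_norm_le_const (μ := sqm) (f := fun q => G (tpt q) - H (tpt q))
      (C := ε/4) (Eventually.of_forall fun q => hd _)
    simpa using this
  filter_upwards [(Metric.tendsto_nhds.1 (hspan H hH)) (ε/4) (by positivity), eventually_gt_atTop 0]
    with N hN hN0
  have hN0' : (0:ℝ) < N := by exact_mod_cast hN0
  have hA : ‖(1 / N : ℂ) * ∑ i ∈ Finset.range N, G (tpt (u i, v i)) -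
      (1 / N : ℂ) * ∑ i ∈ Finset.range N, H (tpt (u i, v i))‖ ≤ ε/4 := by
    rw [← mul_sub, ← Finset.sum_sub_distrib, norm_mul]
    have h1 : ‖∑ i ∈ Finset.range N, (G (tpt (u i, v i)) - H (tpt (u i, v i)))‖ ≤ N * (ε/4) := by
      refine (norm_sum_le_of_le _ fun i _ => hd _).trans ?_
      simp
    have h2 : ‖(1 / N : ℂ)‖ = 1/(N:ℝ) := by simp
    rw [h2, one_div, inv_mul_le_iff₀ hN0']; exact h1
  rw [dist_eq_norm] at hN ⊢
  set A := (1 / N : ℂ) * ∑ i ∈ Finset.range N, G (tpt (u i, v i))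
  set B := (1 / N : ℂ) * ∑ i ∈ Finset.range N, H (tpt (u i, v i))
  set C := ∫ q, G (tpt q) ∂sqm
  set D := ∫ q, H (tpt q) ∂sqm
  calc ‖A - C‖ = ‖(A - B) + (B - D) - (C - D)‖ := by congr 1; ring
    _ ≤ ‖A - B‖ + ‖B - D‖ + ‖C - D‖ := (norm_sub_le _ _).trans (by gcongr; exact norm_add_le _ _)
    _ < ε := by linarith

lemma weyl_real {u v : ℕ → ℝ}
    (h : ∀ k l : ℤ, ¬ (k = 0 ∧ l = 0) → ∀ φ : ℝ, φ = 0 ∨ φ = -(Real.pi/2) →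
      Tendsto (fun N : ℕ => (1 / N : ℝ) * ∑ i ∈ Finset.range N,
        Real.cos (2 * Real.pi * (k * u i + l * v i) + φ)) atTop (𝓝 0))
    {G : UnitAddTorus (Fin 2) → ℝ} (hG : Continuous G) :
    Tendsto (fun N : ℕ => (1 / N : ℝ) * ∑ i ∈ Finset.range N, G (tpt (u i, v i))) atTop
      (𝓝 (∫ q, G (tpt q) ∂sqm)) := by
  have := weyl_complex h ⟨fun y => (G y : ℂ), Complex.continuous_ofReal.comp hG⟩
  simp only [ContinuousMap.coe_mk] at this
  rw [integral_complex_ofReal] at this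
  have h2 := (Complex.continuous_re.tendsto _).comp this
  rw [Complex.ofReal_re] at h2
  refine h2.congr fun N => ?_
  simp only [Function.comp]
  rw [← Complex.ofReal_re ((1 / N : ℝ) * ∑ i ∈ Finset.range N, G (tpt (u i, v i)))]
  congr 1; push_cast; rfl

end Weyl


section Weyl2

/-- Cutoff function vanishing at the end points of the unit interval. -/
noncomputable def chi (n : ℕ) (s : ℝ) : ℝ := 1 - ((2 * s - 1)^2)^n

lemma chi_continuous (n : ℕ) : Continuous (chi n) := by unfold chi; fun_prop

lemma chi_zero {n : ℕ} : chi n 0 = 0 := by simp [chi]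

lemma chi_one {n : ℕ} : chi n 1 = 0 := by norm_num [chi]

lemma chi_mem (n : ℕ) {s : ℝ} (hs : s ∈ Icc (0:ℝ) 1) : chi n s ∈ Icc (0:ℝ) 1 := by
  have h1 : (2 * s - 1)^2 ≤ 1 := by nlinarith [hs.1, hs.2]
  have h2 := pow_le_one₀ (n := n) (sq_nonneg (2 * s - 1)) h1
  have h3 := pow_nonneg (sq_nonneg (2 * s - 1)) n
  unfold chi; constructor <;> linarith

lemma chi_tendsto {s : ℝ} (hs : s ∈ Ioo (0:ℝ) 1) : Tendsto (fun n => chi n s) atTop (𝓝 1) := by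
  have h1 : (2 * s - 1)^2 < 1 := by nlinarith [hs.1, hs.2]
  have := tendsto_pow_atTop_nhds_zero_of_lt_one (sq_nonneg (2 * s - 1)) h1
  simpa [chi] using this.const_sub 1

/-- Representative in `[0,1)`. -/
noncomputable def rep (x : UnitAddCircle) : ℝ := (AddCircle.equivIco (1:ℝ) 0 x : ℝ)

lemma rep_coe (s : ℝ) : rep (s : UnitAddCircle) = Int.fract s := by
  have := AddCircle.coe_equivIco_mk_apply (1:ℝ) s
  simpa [rep] using this

lemma rep_mem (x : UnitAddCircle) : rep x ∈ Icc (0:ℝ) 1 := by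
  have := (AddCircle.equivIco (1:ℝ) 0 x).2
  exact ⟨this.1, by simpa [rep] using this.2.le⟩

lemma rep_contAt {x : UnitAddCircle} (hx : x ≠ 0) : ContinuousAt rep x := by
  refine continuous_subtype_val.continuousAt.comp ?_
  exact AddCircle.continuousAt_equivIco (1:ℝ) 0 (by simpa using hx)

lemma chi_rep_continuous (n : ℕ) : Continuous (fun x => chi n (rep x)) := by
  have := AddCircle.liftIco_continuous (p := (1:ℝ)) (a := 0) (f := chi n)
    (by rw [zero_add, chi_zero, chi_one]) (chi_continuous n).continuousOn
  exact this

lemma rep_zero : rep 0 = 0 := by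
  have := rep_coe 0
  simpa using this

lemma cut_continuous (n : ℕ) (F : BoundedContinuousFunction (ℝ × ℝ) ℝ) :
    Continuous (fun y : UnitAddTorus (Fin 2) =>
      F (rep (y 0), rep (y 1)) * (chi n (rep (y 0)) * chi n (rep (y 1)))) := by
  have w : Continuous (fun y : UnitAddTorus (Fin 2) => chi n (rep (y 0)) * chi n (rep (y 1))) :=
    ((chi_rep_continuous n).comp (continuous_apply 0)).mul
      ((chi_rep_continuous n).comp (continuous_apply 1))
  rw [continuous_iff_continuousAt]
  intro y
  by_cases h : y 0 ≠ 0 ∧ y 1 ≠ 0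
  · refine ContinuousAt.mul ?_ w.continuousAt
    refine F.continuous.continuousAt.comp ?_
    exact ((rep_contAt h.1).comp (f := fun y : UnitAddTorus (Fin 2) => y 0)
        (continuous_apply 0).continuousAt).prodMk
      ((rep_contAt h.2).comp (f := fun y : UnitAddTorus (Fin 2) => y 1)
        (continuous_apply 1).continuousAt)
  · have hy : chi n (rep (y 0)) * chi n (rep (y 1)) = 0 := by
      by_cases h0 : y 0 = 0
      · rw [h0, rep_zero, chi_zero, zero_mul]
      · have h1 : y 1 = 0 := by by_contra h1; exact h ⟨h0, h1⟩
        rw [h1, rep_zero, chi_zero, mul_zero]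
    have hw := w.tendsto y
    simp only [hy] at hw
    rw [ContinuousAt]
    simp only [hy, mul_zero]
    have h2 : Tendsto (fun y : UnitAddTorus (Fin 2) =>
        ‖F‖ * |chi n (rep (y 0)) * chi n (rep (y 1))|) (𝓝 y) (𝓝 0) := by
      simpa using hw.abs.const_mul ‖F‖
    refine squeeze_zero_norm (fun z => ?_) h2
    rw [norm_mul]
    exact mul_le_mul_of_nonneg_right (F.norm_coe_le_norm _) (norm_nonneg _)

lemma sqm_ae : ∀ᵐ q ∂sqm, q.1 ∈ Ioo (0:ℝ) 1 ∧ q.2 ∈ Ioo (0:ℝ) 1 := by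
  have h : ∀ᵐ s ∂((volume : Measure ℝ).restrict (Set.Icc (0:ℝ) 1)), s ∈ Ioo (0:ℝ) 1 := by
    rw [Measure.restrict_congr_set Ioo_ae_eq_Icc.symm]
    exact ae_restrict_mem measurableSet_Ioo
  have := unit_prob
  have h1 : ∀ᵐ q ∂sqm, q.1 ∈ Ioo (0:ℝ) 1 := Measure.quasiMeasurePreserving_fst.ae h
  have h2 : ∀ᵐ q ∂sqm, q.2 ∈ Ioo (0:ℝ) 1 := Measure.quasiMeasurePreserving_snd.ae h
  filter_upwards [h1, h2] with q a b using ⟨a, b⟩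

lemma fract_Ioo {s : ℝ} (hs : s ∈ Ioo (0:ℝ) 1) : Int.fract s = s :=
  Int.fract_eq_self.2 ⟨hs.1.le, hs.2⟩

lemma cut_int (n : ℕ) (F : BoundedContinuousFunction (ℝ × ℝ) ℝ) :
    ∫ q, F (rep (tpt q 0), rep (tpt q 1)) * (chi n (rep (tpt q 0)) * chi n (rep (tpt q 1))) ∂sqm =
    ∫ q, F q * (chi n q.1 * chi n q.2) ∂sqm := by
  refine integral_congr_ae ?_
  filter_upwards [sqm_ae] with q hq
  have e0 : rep (tpt q 0) = q.1 := by
    simp only [tpt, Matrix.cons_val_zero]; rw [rep_coe, fract_Ioo hq.1]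
  have e1 : rep (tpt q 1) = q.2 := by
    simp only [tpt, Matrix.cons_val_zero, Matrix.cons_val_one]; rw [rep_coe, fract_Ioo hq.2]
  simp only [e0, e1]

lemma cut_lim (F : BoundedContinuousFunction (ℝ × ℝ) ℝ) :
    Tendsto (fun n : ℕ => ∫ q, F q * (chi n q.1 * chi n q.2) ∂sqm) atTop (𝓝 (∫ q, F q ∂sqm)) := by
  refine tendsto_integral_of_dominated_convergence (fun _ => ‖F‖) (fun n => ?_) (integrable_const _)
    (fun n => ?_) ?_
  · exact (F.continuous.mul (((chi_continuous n).comp continuous_fst).mul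
      ((chi_continuous n).comp continuous_snd))).aestronglyMeasurable
  · filter_upwards [sqm_ae] with q hq
    have h1 := chi_mem n (Ioo_subset_Icc_self hq.1)
    have h2 := chi_mem n (Ioo_subset_Icc_self hq.2)
    rw [norm_mul, norm_mul, Real.norm_of_nonneg h1.1, Real.norm_of_nonneg h2.1]
    exact (mul_le_of_le_one_right (norm_nonneg _) (mul_le_one₀ h1.2 h2.1 h2.2)).trans
      (F.norm_coe_le_norm _)
  · filter_upwards [sqm_ae] with q hq
    simpa using ((chi_tendsto hq.1).mul (chi_tendsto hq.2)).const_mul (F q)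

lemma weyl_square {u v : ℕ → ℝ}
    (h : ∀ k l : ℤ, ¬ (k = 0 ∧ l = 0) → ∀ φ : ℝ, φ = 0 ∨ φ = -(Real.pi/2) →
      Tendsto (fun N : ℕ => (1 / N : ℝ) * ∑ i ∈ Finset.range N,
        Real.cos (2 * Real.pi * (k * u i + l * v i) + φ)) atTop (𝓝 0))
    (F : BoundedContinuousFunction (ℝ × ℝ) ℝ) :
    Tendsto (fun N : ℕ => (1 / N : ℝ) * ∑ i ∈ Finset.range N, F (Int.fract (u i), Int.fract (v i)))
      atTop (𝓝 (∫ q, F q ∂sqm)) := by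
  set w : ℕ → ℕ → ℝ := fun n i => chi n (Int.fract (u i)) * chi n (Int.fract (v i)) with hw
  have hw01 : ∀ n i, w n i ∈ Icc (0:ℝ) 1 := fun n i => by
    have h1 := chi_mem n (s := Int.fract (u i)) ⟨Int.fract_nonneg _, (Int.fract_lt_one _).le⟩
    have h2 := chi_mem n (s := Int.fract (v i)) ⟨Int.fract_nonneg _, (Int.fract_lt_one _).le⟩
    exact ⟨mul_nonneg h1.1 h2.1, mul_le_one₀ h1.2 h2.1 h2.2⟩
  have hcut : ∀ (n : ℕ) (F : BoundedContinuousFunction (ℝ × ℝ) ℝ),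
      Tendsto (fun N : ℕ => (1 / N : ℝ) * ∑ i ∈ Finset.range N,
        F (Int.fract (u i), Int.fract (v i)) * w n i)
        atTop (𝓝 (∫ q, F q * (chi n q.1 * chi n q.2) ∂sqm)) := by
    intro n F
    have h1 := weyl_real h (cut_continuous n F)
    rw [cut_int] at h1
    refine h1.congr fun N => ?_
    simp only [tpt, Matrix.cons_val_zero, Matrix.cons_val_one, rep_coe, hw]
  rw [Metric.tendsto_nhds]
  intro ε hε
  set η := ε / (4 * (‖F‖ + 1)) with hη
  have hF1 : 0 < ‖F‖ + 1 := by positivity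
  have hη0 : 0 < η := by positivity
  have l1 := (Metric.tendsto_nhds.1 (cut_lim F)) (ε/4) (by positivity)
  have l2 := (Metric.tendsto_nhds.1 (cut_lim (BoundedContinuousFunction.const _ 1))) (η/2) (by positivity)
  obtain ⟨n, m1, m2⟩ := (l1.and l2).exists
  have k1 := (Metric.tendsto_nhds.1 (hcut n F)) (ε/4) (by positivity)
  have k2 := (Metric.tendsto_nhds.1 (hcut n (BoundedContinuousFunction.const _ 1))) (η/2) (by positivity)
  filter_upwards [k1, k2, eventually_gt_atTop 0] with N j1 j2 hN0
  have hN0' : (0:ℝ) < N := by exact_mod_cast hN0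
  simp only [BoundedContinuousFunction.const_apply, one_mul, integral_const, probReal_univ,
    smul_eq_mul] at m2 j2
  have hone : (1 / N : ℝ) * ∑ i ∈ Finset.range N, (1 - w n i) < η := by
    rw [Finset.sum_sub_distrib, mul_sub]
    have : (1 / N : ℝ) * ∑ i ∈ Finset.range N, (1:ℝ) = 1 := by simp; field_simp
    rw [this]
    rw [Real.dist_eq, abs_lt] at m2 j2
    linarith [m2.1, j2.1]
  have hdiff : |(1 / N : ℝ) * ∑ i ∈ Finset.range N, F (Int.fract (u i), Int.fract (v i)) -
      (1 / N : ℝ) * ∑ i ∈ Finset.range N, F (Int.fract (u i), Int.fract (v i)) * w n i| ≤ ‖F‖ * η := by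
    rw [← mul_sub, ← Finset.sum_sub_distrib, abs_mul, abs_of_pos (by positivity : (0:ℝ) < 1/N)]
    have : |∑ i ∈ Finset.range N, (F (Int.fract (u i), Int.fract (v i)) -
        F (Int.fract (u i), Int.fract (v i)) * w n i)| ≤ ∑ i ∈ Finset.range N, ‖F‖ * (1 - w n i) := by
      refine (Finset.abs_sum_le_sum_abs _ _).trans (Finset.sum_le_sum fun i _ => ?_)
      rw [show F (Int.fract (u i), Int.fract (v i)) - F (Int.fract (u i), Int.fract (v i)) * w n i =
        F (Int.fract (u i), Int.fract (v i)) * (1 - w n i) by ring, abs_mul,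
        abs_of_nonneg (by linarith [(hw01 n i).2] : 0 ≤ 1 - w n i)]
      exact mul_le_mul_of_nonneg_right (F.norm_coe_le_norm _) (by linarith [(hw01 n i).2])
    rw [← Finset.mul_sum] at this
    calc _ ≤ (1 / N : ℝ) * (‖F‖ * ∑ i ∈ Finset.range N, (1 - w n i)) := by gcongr
      _ = ‖F‖ * ((1 / N : ℝ) * ∑ i ∈ Finset.range N, (1 - w n i)) := by ring
      _ ≤ _ := by gcongr
  have hFη : ‖F‖ * η ≤ ε/4 := by
    have : (‖F‖ + 1) * η = ε/4 := by rw [hη]; field_simp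
    nlinarith
  rw [Real.dist_eq] at m1 j1 ⊢
  rw [abs_lt] at m1 j1 ⊢
  rw [abs_le] at hdiff
  constructor <;> linarith [m1.1, m1.2, j1.1, j1.2, hdiff.1, hdiff.2]

end Weyl2

theorem final_thm
    (p m n : ℕ) (hp : 2 ≤ p) (hn : 1 < n) (hnm : n < m)
    (hindm : Irrational (Real.log p / Real.log m))
    (hindn : Irrational (Real.log p / Real.log n))
    (μ : Measure ℝ) [IsProbabilityMeasure μ]
    (herg : Ergodic (Tmap p) μ) (hdim : 0 < measureDim μ)
    (a b c d : ℝ) (ha : a ≠ 0) (hc : c ≠ 0)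
    (f g : ℝ → ℝ) (hf : f = fun x => a * x + b) (hg : g = fun x => c * x + d) :
    ∀ᵐ x ∂μ, ∀ F : BoundedContinuousFunction (ℝ × ℝ) ℝ,
      Tendsto (fun N : ℕ => (1 / N : ℝ) * ∑ i ∈ Finset.range N,
          F ((Tmap m)^[i] (f x), (Tmap n)^[i] (g x))) atTop
        (𝓝 (∫ q, F q ∂sqm)) := by
  have hm0 : (0:ℝ) < m := by exact_mod_cast (by omega : 0 < m)
  have hn0 : (0:ℝ) < n := by exact_mod_cast (by omega : 0 < n)
  have hchar : ∀ (k l : ℤ), ¬ (k = 0 ∧ l = 0) → ∀ φ : ℝ, ∀ᵐ x ∂μ,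
      Tendsto (fun N : ℕ => (1 / N : ℝ) * ∑ i ∈ Finset.range N,
        Real.cos (2 * Real.pi * (k * ((m:ℝ)^i * f x) + l * ((n:ℝ)^i * g x)) + φ)) atTop (𝓝 0) := by
    intro k l hkl φ
    set ξ : ℕ → ℝ := fun i => 2 * Real.pi * (k * a * (m:ℝ)^i + l * c * (n:ℝ)^i) with hξ
    set ψ : ℕ → ℝ := fun i => 2 * Real.pi * (k * b * (m:ℝ)^i + l * d * (n:ℝ)^i) + φ with hψ
    have e : ∀ (i : ℕ) x, 2 * Real.pi * (k * ((m:ℝ)^i * f x) + l * ((n:ℝ)^i * g x)) + φ =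
        ξ i * x + ψ i := by
      intro i x; rw [hf, hg]; simp only [hξ, hψ]; ring
    simp only [e]
    by_cases hk : k = 0
    · have hl : (l:ℝ) ≠ 0 := by
        have : l ≠ 0 := fun h => hkl ⟨hk, h⟩
        exact_mod_cast this
      refine main_single μ hp herg hdim hn hindn ξ ψ (κ := 2 * Real.pi * (l * c))
        (mul_ne_zero (by positivity) (mul_ne_zero hl hc)) ?_
      refine tendsto_const_nhds.congr fun i => ?_
      simp only [hξ, hk]; push_cast; field_simp; ring
    · have hk' : (k:ℝ) ≠ 0 := by exact_mod_cast hk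
      refine main_single μ hp herg hdim (by omega) hindm ξ ψ (κ := 2 * Real.pi * (k * a))
        (mul_ne_zero (by positivity) (mul_ne_zero hk' ha)) ?_
      have h0 : Tendsto (fun i : ℕ => ((n:ℝ)/m)^i) atTop (𝓝 0) :=
        tendsto_pow_atTop_nhds_zero_of_lt_one (by positivity)
          ((div_lt_one hm0).2 (by exact_mod_cast hnm))
      have h1 := ((h0.const_mul (2 * Real.pi * (l * c))).const_add (2 * Real.pi * (k * a)))
      rw [mul_zero, add_zero] at h1
      refine h1.congr fun i => ?_
      simp only [hξ, div_pow]; field_simp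
  have hall : ∀ᵐ x ∂μ, ∀ (k l : ℤ), ¬ (k = 0 ∧ l = 0) → ∀ φ : ℝ, φ = 0 ∨ φ = -(Real.pi/2) →
      Tendsto (fun N : ℕ => (1 / N : ℝ) * ∑ i ∈ Finset.range N,
        Real.cos (2 * Real.pi * (k * ((m:ℝ)^i * f x) + l * ((n:ℝ)^i * g x)) + φ)) atTop (𝓝 0) := by
    rw [ae_all_iff]; intro k
    rw [ae_all_iff]; intro l
    by_cases hkl : k = 0 ∧ l = 0
    · exact Eventually.of_forall fun x h => absurd hkl h
    · filter_upwards [hchar k l hkl 0, hchar k l hkl (-(Real.pi/2))] with x h1 h2 _ φ hφ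
      rcases hφ with rfl | rfl
      · exact h1
      · exact h2
  filter_upwards [hall] with x hx F
  have h1 := weyl_square hx F
  have h2 : Tendsto (fun i : ℕ => F ((Tmap m)^[i] (f x), (Tmap n)^[i] (g x)) -
      F (Int.fract ((m:ℝ)^i * f x), Int.fract ((n:ℝ)^i * g x))) atTop (𝓝 0) := by
    refine tendsto_const_nhds.congr' ?_
    filter_upwards [eventually_ge_atTop 1] with i hi
    rw [Tmap_iterate m i hi, Tmap_iterate n i hi, sub_self]
  have h3 := h1.add h2.cesaro
  rw [add_zero] at h3
  refine h3.congr fun N => ?_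
  rw [Finset.sum_sub_distrib]; simp only [one_div]; ring

/-- Let `μ` be a `T_p`-invariant ergodic probability measure on `[0,1]`
(viewed on the circle) of positive dimension, `m > n > 1` with `m ≁ p` and `n ≁ p`, and
`f, g` non-singular affine maps of `ℝ` with `f([0,1]) ⊆ [0,1]`, `g([0,1]) ⊆ [0,1]`.
Then for `μ`-a.e. `x` the empirical measures of the orbit of `(f(x), g(x))` under
`T_m × T_n` converge weak-* to `λ × λ`. -/
theorem simultaneous_equidistribution_perturbed_times_m_times_n
    (p m n : ℕ) (hp : 2 ≤ p) (hn : 1 < n) (hnm : n < m)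
    (hindm : Irrational (Real.log p / Real.log m))
    (hindn : Irrational (Real.log p / Real.log n))
    (μ : Measure ℝ) [IsProbabilityMeasure μ] (hμsupp : μ (Set.Icc (0:ℝ) 1)ᶜ = 0)
    (herg : Ergodic (Tmap p) μ) (hdim : 0 < measureDim μ)
    (a b c d : ℝ) (ha : a ≠ 0) (hc : c ≠ 0)
    (f g : ℝ → ℝ) (hf : f = fun x => a * x + b) (hg : g = fun x => c * x + d)
    (hfim : f '' Set.Icc 0 1 ⊆ Set.Icc 0 1) (hgim : g '' Set.Icc 0 1 ⊆ Set.Icc 0 1) :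
    ∀ᵐ x ∂μ, ∀ F : BoundedContinuousFunction (ℝ × ℝ) ℝ,
      Tendsto (fun N : ℕ => (1 / N : ℝ) * ∑ i ∈ Finset.range N,
          F ((Tmap m)^[i] (f x), (Tmap n)^[i] (g x))) atTop
        (𝓝 (∫ q, F q ∂((volume.restrict (Set.Icc (0:ℝ) 1)).prod
            (volume.restrict (Set.Icc (0:ℝ) 1))))) := by
  exact final_thm p m n hp hn hnm hindm hindn μ herg hdim a b c d ha hc f g hf hg
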